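/- arXiv:1105.3755 — 3 statements merged into one kernel-verified Lean document; each statement's English description precedes it below -/
import Mathlib

section
/- Suppose $\varrho$, $\varsigma$, $\chi$ are locally finite complex Borel measures on $(a,b)$ with $\mathrm{supp}(\varsigma) = (a,b)$. Then the initial value problem $(\tau - z) u = g$, $u(c) = d_1$, $u^{[1]}(c) = d_2$ has a unique solution for every $z \in \mathbb{C}$, $c \in (a,b)$, $g \in L^1_{loc}((a,b);\varrho)$, $d_1, d_2 \in \mathbb{C}$ if and only if for all $x \in (a,b)$: $\varrho(\{x\})\varsigma(\{x\}) = 0$ and $\chi(\{x\})\varsigma(\{x\}) \neq 1$. -/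
open MeasureTheory Set Filter

/-- The two-sided Lebesgue–Stieltjes integral `∫_c^x h dω`. -/
noncomputable def mInt (ω : Measure ℝ) (h : ℝ → ℂ) (c x : ℝ) : ℂ :=
  if c ≤ x then ∫ t in Set.Ico c x, h t ∂ω else -∫ t in Set.Ico x c, h t ∂ω

/-- Local integrability on compact subintervals of `(a,b)` with respect to `ω`. -/
def LocInt (a b : ℝ) (ω : Measure ℝ) (h : ℝ → ℂ) : Prop :=
  ∀ α ∈ Set.Ioo a b, ∀ β ∈ Set.Ioo a b, MeasureTheory.IntegrableOn h (Set.Ico α β) ω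

/-- `(f, f1, fτ)` consists of a function `f` in the maximal domain `𝔇_τ` of
`τ f = d/dϱ (-df/dς + ∫ f dχ)`, its quasi-derivative `f1 = df/dς` and `fτ = τ f`.
The locally finite complex Borel measures `ς`, `χ`, `ϱ` on `(a,b)` are represented
by their densities `σf`, `χf`, `ρf` with respect to the positive Borel measure `ω`. -/
def InDom (a b : ℝ) (ω : Measure ℝ) (σf χf ρf : ℝ → ℂ) (f f1 fτ : ℝ → ℂ) : Prop :=
  LocInt a b ω (fun t => f1 t * σf t) ∧
  LocInt a b ω (fun t => f t * χf t - fτ t * ρf t) ∧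
  ∀ α ∈ Set.Ioo a b, ∀ β ∈ Set.Ioo a b, α ≤ β →
    f β = f α + ∫ t in Set.Ico α β, f1 t * σf t ∂ω ∧
    f1 β = f1 α + ∫ t in Set.Ico α β, (f t * χf t - fτ t * ρf t) ∂ω

/-- `supp ς = (a,b)`: every nondegenerate compact subinterval carries `ς`-mass. -/
def SuppFull (a b : ℝ) (ω : Measure ℝ) (σf : ℝ → ℂ) : Prop :=
  ∀ α ∈ Set.Ioo a b, ∀ β ∈ Set.Ioo a b, α < β → ∫ t in Set.Ico α β, ‖σf t‖ ∂ω ≠ 0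

/-- `ς` has no point masses in common with `ϱ` or `χ`:
`ς{x}·ϱ{x} = ς{x}·χ{x} = 0` for all `x ∈ (a,b)`. -/
def NoCommonAtoms (a b : ℝ) (ω : Measure ℝ) (σf χf ρf : ℝ → ℂ) : Prop :=
  ∀ x ∈ Set.Ioo a b,
    ((ω {x}).toReal : ℂ) * σf x * (((ω {x}).toReal : ℂ) * ρf x) = 0 ∧
    ((ω {x}).toReal : ℂ) * σf x * (((ω {x}).toReal : ℂ) * χf x) = 0

/-- The measures `ς`, `χ` are real and `ϱ` is positive. -/
def RealCoeffs (σf χf ρf : ℝ → ℂ) : Prop :=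
  (∀ t, (σf t).im = 0) ∧ (∀ t, (χf t).im = 0) ∧ (∀ t, (ρf t).im = 0 ∧ 0 ≤ (ρf t).re)

/-- `x` belongs to the support of the measure `ϱ` (with density `ρf` w.r.t. `ω`). -/
def InSuppRho (a b : ℝ) (ω : Measure ℝ) (ρf : ℝ → ℂ) (x : ℝ) : Prop :=
  ∀ ε > 0, ¬ (∀ᵐ t ∂ω, (t ∈ Set.Ioo (x - ε) (x + ε) ∧ t ∈ Set.Ioo a b) → ρf t = 0)

/-- The gap condition: for each gap `(α,β)` of `supp ϱ` and every `f ∈ 𝔇_τ` with outer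
limits `f(α-) = f(β+) = 0` one has `f ≡ 0` on `(α,β)`. -/
def GapCondition (a b : ℝ) (ω : Measure ℝ) (σf χf ρf : ℝ → ℂ) : Prop :=
  ∀ α ∈ Set.Ioo a b, ∀ β ∈ Set.Ioo a b, α < β →
    (∀ᵐ t ∂ω, t ∈ Set.Ioo α β → ρf t = 0) →
    InSuppRho a b ω ρf α → InSuppRho a b ω ρf β →
    ∀ f f1 fτ : ℝ → ℂ, InDom a b ω σf χf ρf f f1 fτ →
      Filter.Tendsto f (nhdsWithin α (Set.Iio α)) (nhds 0) →
      Filter.Tendsto f (nhdsWithin β (Set.Ioi β)) (nhds 0) →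
      ∀ x ∈ Set.Ioo α β, f x = 0

/-- `supp ϱ` contains at least two points. -/
def SuppRhoTwoPoints (a b : ℝ) (ω : Measure ℝ) (ρf : ℝ → ℂ) : Prop :=
  ∃ x ∈ Set.Ioo a b, ∃ y ∈ Set.Ioo a b, x ≠ y ∧
    InSuppRho a b ω ρf x ∧ InSuppRho a b ω ρf y

/-- `(u,v)` solves the first-order system equivalent to `(τ - z)u = g`,
`u(c) = d₁`, `u^{[1]}(c) = d₂`. -/
def SolIVP (a b : ℝ) (ω : Measure ℝ) (σf χf ρf g : ℝ → ℂ) (z : ℂ) (c : ℝ)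
    (d₁ d₂ : ℂ) (u v : ℝ → ℂ) : Prop :=
  LocInt a b ω (fun t => v t * σf t) ∧
  LocInt a b ω (fun t => u t * χf t - (z * u t + g t) * ρf t) ∧
  ∀ x ∈ Set.Ioo a b,
    u x = d₁ + mInt ω (fun t => v t * σf t) c x ∧
    v x = d₂ + mInt ω (fun t => u t * χf t - (z * u t + g t) * ρf t) c x


section core

set_option linter.unusedSectionVars false

variable {E : Type*} [NormedAddCommGroup E] [NormedSpace ℝ E] [CompleteSpace E]

lemma sm_setIntegral (ν : Measure ℝ) {h : ℝ → E} (hh : Integrable h ν) :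
    StronglyMeasurable (fun t : ℝ => ∫ s in Iio t, h s ∂ν) := by
  refine Integrable.induction
    (P := fun h : ℝ → E => StronglyMeasurable (fun t : ℝ => ∫ s in Iio t, h s ∂ν))
    ?_ ?_ ?_ ?_ hh
  · intro c s hs hfin
    have : (fun t : ℝ => ∫ x in Iio t, s.indicator (fun _ => c) x ∂ν)
        = fun t => (ν.real (Iio t ∩ s)) • c := by
      funext t
      rw [setIntegral_indicator hs, setIntegral_const]
    rw [this]
    have hm : Monotone (fun t : ℝ => ν.real (Iio t ∩ s)) := by
      intro x y hxy
      refine measureReal_mono (inter_subset_inter_left _ (Iio_subset_Iio hxy)) ?_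
      exact ((measure_mono inter_subset_right).trans_lt hfin).ne
    exact (hm.measurable.stronglyMeasurable).smul_const c
  · intro f g _ hf hg h1 h2
    have : (fun t : ℝ => ∫ x in Iio t, (f + g) x ∂ν)
        = fun t => (∫ x in Iio t, f x ∂ν) + ∫ x in Iio t, g x ∂ν := by
      funext t
      exact integral_add hf.integrableOn hg.integrableOn
    rw [this]
    exact h1.add h2
  · rw [← isSeqClosed_iff_isClosed]
    intro f l hf hl
    refine stronglyMeasurable_of_tendsto (u := atTop) (f := fun (n : ℕ) (t : ℝ) => ∫ s in Iio t, f n s ∂ν)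
      (fun n => hf n) ?_
    rw [tendsto_pi_nhds]
    intro t
    exact ((continuous_setIntegral (Iio t)).tendsto l).comp hl
  · intro f g hfg _ h1
    have : (fun t : ℝ => ∫ x in Iio t, g x ∂ν) = (fun t : ℝ => ∫ x in Iio t, f x ∂ν) := by
      funext t
      exact integral_congr_ae (ae_restrict_of_ae hfg.symm)
    rw [this]; exact h1

lemma sm_setIntegral' (ν : Measure ℝ) {h : ℝ → E} (hh : Integrable h ν) :
    StronglyMeasurable (fun t : ℝ => ∫ s in Ici t, h s ∂ν) := by
  have : (fun t : ℝ => ∫ s in Ici t, h s ∂ν)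
      = fun t => (∫ s, h s ∂ν) - ∫ s in Iio t, h s ∂ν := by
    funext t
    rw [eq_sub_iff_add_eq', ← compl_Iio, integral_add_compl measurableSet_Iio hh]
  rw [this]
  exact stronglyMeasurable_const.sub (sm_setIntegral ν hh)

lemma core_exists (ν : Measure ℝ) (G : ℝ → E → E) (k : ℝ → ℝ) (hk : Integrable k ν)
    (hk0 : ∀ t, 0 ≤ k t) (hk1 : ∫ t, k t ∂ν ≤ 1 / 2)
    (hL : ∀ t p q, ‖G t p - G t q‖ ≤ k t * ‖p - q‖)
    (hG : ∀ w : ℝ → E, StronglyMeasurable w → (∃ C, ∀ t, ‖w t‖ ≤ C) →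
      Integrable (fun t => G t (w t)) ν)
    (K : ℝ → Set ℝ)
    (hK : ∀ h : ℝ → E, Integrable h ν → StronglyMeasurable (fun t : ℝ => ∫ s in K t, h s ∂ν))
    (ε : ℝ) (hε : |ε| ≤ 1) (d : E) :
    ∃ w : ℝ → E, Integrable (fun t => G t (w t)) ν ∧
      ∀ t, w t = d + ε • ∫ s in K t, G s (w s) ∂ν := by
  have hbd : ∀ (h : ℝ → E), Integrable h ν → ∀ t, ‖ε • ∫ s in K t, h s ∂ν‖ ≤ ∫ s, ‖h s‖ ∂ν := by
    intro h hh t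
    rw [norm_smul, Real.norm_eq_abs]
    calc |ε| * ‖∫ s in K t, h s ∂ν‖ ≤ 1 * ‖∫ s in K t, h s ∂ν‖ := by gcongr
      _ = ‖∫ s in K t, h s ∂ν‖ := one_mul _
      _ ≤ ∫ s in K t, ‖h s‖ ∂ν := norm_integral_le_integral_norm _
      _ ≤ ∫ s, ‖h s‖ ∂ν :=
        setIntegral_le_integral hh.norm (Eventually.of_forall fun _ => norm_nonneg _)
  have hI : ∀ f : ℝ →₁[ν] E, Integrable (fun t => G t (d + ε • ∫ s in K t, f s ∂ν)) ν := by
    intro f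
    have hf := L1.integrable_coeFn f
    refine hG _ (stronglyMeasurable_const.add ((hK _ hf).const_smul ε)) ⟨‖d‖ + ∫ s, ‖f s‖ ∂ν, ?_⟩
    intro t
    exact (norm_add_le _ _).trans (by gcongr; exact hbd _ hf t)
  let T : (ℝ →₁[ν] E) → (ℝ →₁[ν] E) := fun f => (hI f).toL1 _
  have hT : ContractingWith (1/2 : NNReal) T := by
    refine ⟨by norm_num, LipschitzWith.of_dist_le_mul ?_⟩
    intro f g
    have hf := L1.integrable_coeFn f
    have hg := L1.integrable_coeFn g
    rw [dist_eq_norm, dist_eq_norm, ← Integrable.toL1_sub, L1.norm_of_fun_eq_integral_norm]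
    set D := ‖f - g‖ with hD
    have hDe : D = ∫ s, ‖f s - g s‖ ∂ν := by
      rw [hD, ← dist_eq_norm, L1.dist_eq_integral_dist]
      simp only [dist_eq_norm]
    calc _ ≤ ∫ t, k t * D ∂ν := by
          refine integral_mono ((hI f).sub (hI g)).norm (hk.mul_const D) ?_
          intro t
          refine (hL _ _ _).trans (mul_le_mul_of_nonneg_left ?_ (hk0 t))
          · rw [add_sub_add_left_eq_sub, ← smul_sub, ← integral_sub hf.integrableOn hg.integrableOn, hDe]
            exact hbd _ (hf.sub hg) t
      _ = (∫ t, k t ∂ν) * D := integral_mul_const _ _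
      _ ≤ (1/2) * D := by gcongr
      _ = _ := by simp
  have hfix : T (hT.fixedPoint T) = hT.fixedPoint T := hT.fixedPoint_isFixedPt
  set f := hT.fixedPoint T with hfdef
  have hae : (fun t => G t (d + ε • ∫ s in K t, f s ∂ν)) =ᵐ[ν] f := by
    have h1 := (hI f).coeFn_toL1
    have h2 : (((hI f).toL1 _ : ℝ →₁[ν] E)) = f := hfix
    rw [h2] at h1
    exact h1.symm
  refine ⟨fun t => d + ε • ∫ s in K t, f s ∂ν, hI f, ?_⟩
  intro t
  simp only
  congr 2
  exact integral_congr_ae (ae_restrict_of_ae hae.symm)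

lemma core_unique (ν : Measure ℝ) (G : ℝ → E → E) (k : ℝ → ℝ) (hk : Integrable k ν)
    (hk0 : ∀ t, 0 ≤ k t) (hk1 : ∫ t, k t ∂ν ≤ 1 / 2)
    (hL : ∀ t p q, ‖G t p - G t q‖ ≤ k t * ‖p - q‖)
    (K : ℝ → Set ℝ) (ε : ℝ) (hε : |ε| ≤ 1) (d : E) (S : Set ℝ) (hS : ∀ᵐ t ∂ν, t ∈ S)
    (w w' : ℝ → E) (hw : Integrable (fun t => G t (w t)) ν)
    (hw' : Integrable (fun t => G t (w' t)) ν)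
    (h : ∀ t ∈ S, w t = d + ε • ∫ s in K t, G s (w s) ∂ν)
    (h' : ∀ t ∈ S, w' t = d + ε • ∫ s in K t, G s (w' s) ∂ν) :
    ∀ t ∈ S, w t = w' t := by
  set A := ∫ s, ‖G s (w s) - G s (w' s)‖ ∂ν with hA
  have hA0 : 0 ≤ A := integral_nonneg fun _ => norm_nonneg _
  have hb : ∀ t ∈ S, ‖w t - w' t‖ ≤ A := by
    intro t ht
    rw [h t ht, h' t ht, add_sub_add_left_eq_sub, ← smul_sub,
      ← integral_sub hw.integrableOn hw'.integrableOn, norm_smul, Real.norm_eq_abs]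
    calc |ε| * ‖∫ s in K t, (G s (w s) - G s (w' s)) ∂ν‖
        ≤ 1 * ‖∫ s in K t, (G s (w s) - G s (w' s)) ∂ν‖ := by gcongr
      _ = ‖∫ s in K t, (G s (w s) - G s (w' s)) ∂ν‖ := one_mul _
      _ ≤ ∫ s in K t, ‖(G s (w s) - G s (w' s))‖ ∂ν := norm_integral_le_integral_norm _
      _ ≤ A := setIntegral_le_integral (hw.sub hw').norm (Eventually.of_forall fun _ => norm_nonneg _)
  have hA1 : A ≤ (1/2) * A := by
    calc A ≤ ∫ t, k t * A ∂ν := by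
          refine integral_mono_ae (hw.sub hw').norm (hk.mul_const A) ?_
          filter_upwards [hS] with t ht
          refine (hL _ _ _).trans ?_
          gcongr
          · exact hk0 t
          · exact hb t ht
      _ = (∫ t, k t ∂ν) * A := integral_mul_const _ _
      _ ≤ (1/2) * A := by gcongr
  have hA2 : A = 0 := by linarith
  intro t ht
  have := hb t ht
  rw [hA2] at this
  exact sub_eq_zero.1 (norm_le_zero_iff.1 this)

/-- `w` solves `dw = G(t, w) dω` on `[α, β]`. -/
def SolOn (ω : Measure ℝ) (G : ℝ → E → E) (α β : ℝ) (w : ℝ → E) : Prop :=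
  IntegrableOn (fun t => G t (w t)) (Ico α β) ω ∧
    ∀ x ∈ Icc α β, w x = w α + ∫ t in Ico α x, G t (w t) ∂ω

lemma Ico_split {ω : Measure ℝ} {h : ℝ → E} {α x y : ℝ} (h1 : α ≤ x) (h2 : x ≤ y)
    (hh : IntegrableOn h (Ico α y) ω) :
    ∫ t in Ico α y, h t ∂ω = (∫ t in Ico α x, h t ∂ω) + ∫ t in Ico x y, h t ∂ω := by
  rw [← Ico_union_Ico_eq_Ico h1 h2, setIntegral_union _ measurableSet_Ico
    (hh.mono_set (Ico_subset_Ico_right h2)) (hh.mono_set (Ico_subset_Ico_left h1))]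
  rw [Set.disjoint_left]
  rintro t ⟨_, h3⟩ ⟨h4, _⟩
  exact absurd h3 (not_lt.2 h4)

lemma SolOn.step {ω : Measure ℝ} {G : ℝ → E → E} {α β : ℝ} {w : ℝ → E}
    (h : SolOn ω G α β w) {x y : ℝ} (hx : α ≤ x) (hxy : x ≤ y) (hy : y ≤ β) :
    w y = w x + ∫ t in Ico x y, G t (w t) ∂ω := by
  rw [h.2 y ⟨hx.trans hxy, hy⟩, h.2 x ⟨hx, hxy.trans hy⟩,
    Ico_split hx hxy (h.1.mono_set (Ico_subset_Ico_right hy)), add_assoc]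

lemma SolOn.congr {ω : Measure ℝ} {G : ℝ → E → E} {α β : ℝ} {w w' : ℝ → E}
    (h : SolOn ω G α β w) (hw : ∀ x ∈ Icc α β, w x = w' x) : SolOn ω G α β w' := by
  refine ⟨h.1.congr_fun (fun t ht => ?_) measurableSet_Ico, fun x hx => ?_⟩
  · simp only [hw t ⟨ht.1, ht.2.le⟩]
  · rw [← hw x hx, ← hw α ⟨le_rfl, hx.1.trans hx.2⟩, h.2 x hx]
    congr 1
    refine setIntegral_congr_fun measurableSet_Ico (fun t ht => ?_)
    simp only [hw t ⟨ht.1, ht.2.le.trans hx.2⟩]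

lemma SolOn.sub {ω : Measure ℝ} {G : ℝ → E → E} {α β α' β' : ℝ} {w : ℝ → E}
    (h : SolOn ω G α β w) (h1 : α ≤ α') (h2 : β' ≤ β) : SolOn ω G α' β' w :=
  ⟨h.1.mono_set (Ico_subset_Ico h1 h2), fun _ hx => h.step h1 hx.1 (hx.2.trans h2)⟩

lemma SolOn.concat {ω : Measure ℝ} {G : ℝ → E → E} {α β γ : ℝ} {w : ℝ → E}
    (h : SolOn ω G α γ w) (h' : SolOn ω G γ β w) (h1 : α ≤ γ) (h2 : γ ≤ β) :
    SolOn ω G α β w := by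
  have hi : IntegrableOn (fun t => G t (w t)) (Ico α β) ω := by
    rw [← Ico_union_Ico_eq_Ico h1 h2]; exact h.1.union h'.1
  refine ⟨hi, fun x hx => ?_⟩
  rcases le_total x γ with hxγ | hxγ
  · exact h.2 x ⟨hx.1, hxγ⟩
  · rw [h'.2 x ⟨hxγ, hx.2⟩, h.2 γ ⟨h1, le_rfl⟩,
      Ico_split h1 hxγ (hi.mono_set (Ico_subset_Ico_right hx.2)), add_assoc]

/-- Unique solvability on `[α, β]` from either end point. -/
def WellP (ω : Measure ℝ) (G : ℝ → E → E) (α β : ℝ) : Prop :=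
  (∀ d, ∃ w, SolOn ω G α β w ∧ w α = d) ∧ (∀ d, ∃ w, SolOn ω G α β w ∧ w β = d) ∧
  ∀ w w', SolOn ω G α β w → SolOn ω G α β w' → (w α = w' α ∨ w β = w' β) →
    ∀ x ∈ Icc α β, w x = w' x

lemma WellP.refl (ω : Measure ℝ) (G : ℝ → E → E) (α : ℝ) : WellP ω G α α := by
  have key : ∀ d : E, SolOn ω G α α (fun _ => d) := by
    intro d
    refine ⟨by simp, fun x hx => ?_⟩
    have : x = α := le_antisymm hx.2 hx.1
    simp [this]
  refine ⟨fun d => ⟨_, key d, rfl⟩, fun d => ⟨_, key d, rfl⟩, ?_⟩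
  rintro w w' _ _ h x hx
  have : x = α := le_antisymm hx.2 hx.1
  rw [this]; tauto

lemma glue {ω : Measure ℝ} {G : ℝ → E → E} {α β γ : ℝ} {w w' : ℝ → E}
    (h : SolOn ω G α γ w) (h' : SolOn ω G γ β w') (hγ : w γ = w' γ) (h1 : α ≤ γ) (h2 : γ ≤ β) :
    ∃ v, SolOn ω G α β v ∧ v α = w α ∧ v β = w' β := by
  refine ⟨fun x => if x ≤ γ then w x else w' x, ?_, by simp [h1], ?_⟩
  · refine SolOn.concat (γ := γ) (h.congr ?_) (h'.congr ?_) h1 h2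
    · intro x hx; simp [hx.2]
    · intro x hx
      by_cases hh : x ≤ γ
      · have : x = γ := le_antisymm hh hx.1
        simp [this, hγ]
      · simp [hh]
  · by_cases hh : β ≤ γ
    · have : β = γ := le_antisymm hh h2
      simp [this, hγ]
    · simp [hh]

lemma WellP.trans {ω : Measure ℝ} {G : ℝ → E → E} {α β γ : ℝ}
    (h : WellP ω G α γ) (h' : WellP ω G γ β) (h1 : α ≤ γ) (h2 : γ ≤ β) : WellP ω G α β := by
  refine ⟨fun d => ?_, fun d => ?_, fun w w' hw hw' hor => ?_⟩
  · obtain ⟨w, hw, hd⟩ := h.1 d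
    obtain ⟨w', hw', hd'⟩ := h'.1 (w γ)
    obtain ⟨v, hv, hv1, hv2⟩ := glue hw hw' hd'.symm h1 h2
    exact ⟨v, hv, hv1.trans hd⟩
  · obtain ⟨w', hw', hd'⟩ := h'.2.1 d
    obtain ⟨w, hw, hd⟩ := h.2.1 (w' γ)
    obtain ⟨v, hv, hv1, hv2⟩ := glue hw hw' hd h1 h2
    exact ⟨v, hv, hv2.trans hd'⟩
  · have a1 := h.2.2 w w' (hw.sub le_rfl h2) (hw'.sub le_rfl h2)
    have a2 := h'.2.2 w w' (hw.sub h1 le_rfl) (hw'.sub h1 le_rfl)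
    have hγ : w γ = w' γ := by
      rcases hor with ho | ho
      · exact a1 (Or.inl ho) γ ⟨h1, le_rfl⟩
      · exact a2 (Or.inr ho) γ ⟨le_rfl, h2⟩
    intro x hx
    rcases le_total x γ with hxγ | hxγ
    · exact a1 (Or.inr hγ) x ⟨hx.1, hxγ⟩
    · exact a2 (Or.inl hγ) x ⟨hxγ, hx.2⟩

lemma Ico_split_left {ω : Measure ℝ} {h : ℝ → E} {α x : ℝ} (h1 : α < x)
    (hh : IntegrableOn h (Ico α x) ω) :
    ∫ t in Ico α x, h t ∂ω = ω.real {α} • h α + ∫ t in Ioo α x, h t ∂ω := by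
  have hu : Ico α x = {α} ∪ Ioo α x := by
    rw [union_comm, Ioo_union_left h1]
  rw [hu] at hh ⊢
  rw [setIntegral_union _ measurableSet_Ioo
    (hh.mono_set subset_union_left) (hh.mono_set subset_union_right), integral_singleton]
  simp

lemma solOn_iff {ω : Measure ℝ} {G : ℝ → E → E} {α β : ℝ} (hαβ : α < β) {w : ℝ → E}
    (hi : IntegrableOn (fun t => G t (w t)) (Ico α β) ω) :
    SolOn ω G α β w ↔ ∀ x ∈ Ioc α β, w x = (w α + ω.real {α} • G α (w α)) +
      ∫ t in Iio x, G t (w t) ∂(ω.restrict (Ioo α β)) := by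
  have key : ∀ x ∈ Ioc α β, ∫ t in Ico α x, G t (w t) ∂ω = ω.real {α} • G α (w α) +
      ∫ t in Iio x, G t (w t) ∂(ω.restrict (Ioo α β)) := by
    intro x hx
    have : Iio x ∩ Ioo α β = Ioo α x := by
      ext t; simp only [mem_inter_iff, mem_Iio, mem_Ioo]
      constructor
      · rintro ⟨h1, h2, h3⟩; exact ⟨h2, h1⟩
      · rintro ⟨h1, h2⟩; exact ⟨h2, h1, h2.trans_le hx.2⟩
    rw [Ico_split_left hx.1 (hi.mono_set (Ico_subset_Ico_right hx.2)),
      Measure.restrict_restrict measurableSet_Iio, this]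
  constructor
  · rintro ⟨_, h⟩ x hx
    rw [add_assoc, ← key x hx]; exact h x ⟨hx.1.le, hx.2⟩
  · intro h
    refine ⟨hi, fun x hx => ?_⟩
    rcases eq_or_lt_of_le hx.1 with he | hlt
    · simp [← he]
    · rw [key x ⟨hlt, hx.2⟩, ← add_assoc]; exact h x ⟨hlt, hx.2⟩

lemma solOn_iff' {ω : Measure ℝ} {G : ℝ → E → E} {α β : ℝ} (hαβ : α < β) {w : ℝ → E}
    (hi : IntegrableOn (fun t => G t (w t)) (Ico α β) ω) :
    SolOn ω G α β w ↔ (w β = (w α + ω.real {α} • G α (w α)) +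
      ∫ t, G t (w t) ∂(ω.restrict (Ioo α β))) ∧ ∀ x ∈ Ioc α β, w x = w β + (-1 : ℝ) •
      ∫ t in Ici x, G t (w t) ∂(ω.restrict (Ioo α β)) := by
  rw [solOn_iff hαβ hi]
  have hi' : Integrable (fun t => G t (w t)) (ω.restrict (Ioo α β)) := hi.mono_set Ioo_subset_Ico_self
  have hc : ∀ x, (∫ t in Iio x, G t (w t) ∂(ω.restrict (Ioo α β))) +
      ∫ t in Ici x, G t (w t) ∂(ω.restrict (Ioo α β)) = ∫ t, G t (w t) ∂(ω.restrict (Ioo α β)) := by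
    intro x
    rw [← compl_Iio, integral_add_compl measurableSet_Iio hi']
  have hβ : ∫ t in Ici β, G t (w t) ∂(ω.restrict (Ioo α β)) = 0 := by
    have : Ici β ∩ Ioo α β = ∅ := by
      ext t; simp only [mem_inter_iff, mem_Ici, mem_Ioo, mem_empty_iff_false, iff_false]
      rintro ⟨h1, h2, h3⟩; exact absurd h3 (not_lt.2 h1)
    rw [Measure.restrict_restrict measurableSet_Ici, this]; simp
  constructor
  · intro h
    have hb := h β ⟨hαβ, le_rfl⟩
    have hcb := hc β
    rw [hβ, add_zero] at hcb
    rw [hcb] at hb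
    refine ⟨hb, fun x hx => ?_⟩
    rw [h x hx, hb, ← hc x, neg_one_smul]; abel
  · rintro ⟨hb, h⟩ x hx
    rw [h x hx, hb, ← hc x, neg_one_smul]; abel

lemma upd {ω : Measure ℝ} {G : ℝ → E → E} {α β : ℝ} (hαβ : α < β)
    (hG : ∀ w : ℝ → E, StronglyMeasurable w → (∃ C, ∀ t, ‖w t‖ ≤ C) →
      IntegrableOn (fun t => G t (w t)) (Ico α β) ω) (w0 : ℝ → E) (p : E)
    (hw : Integrable (fun t => G t (w0 t)) (ω.restrict (Ioo α β))) :
    IntegrableOn (fun t => G t (Function.update w0 α p t)) (Ico α β) ω ∧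
    ∀ S, ∫ t in S, G t (Function.update w0 α p t) ∂(ω.restrict (Ioo α β)) =
      ∫ t in S, G t (w0 t) ∂(ω.restrict (Ioo α β)) := by
  have he : EqOn (fun t => G t (Function.update w0 α p t)) (fun t => G t (w0 t)) (Ioo α β) := by
    intro t ht
    simp [Function.update_of_ne ht.1.ne']
  constructor
  · rw [← Ioo_union_left hαβ]
    refine IntegrableOn.union ?_ ?_
    · exact (integrableOn_congr_fun he measurableSet_Ioo).2 hw
    · have h1 := (hG (fun _ => p) stronglyMeasurable_const ⟨‖p‖, fun _ => le_rfl⟩).mono_set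
        (singleton_subset_iff.2 (left_mem_Ico.2 hαβ))
      refine (integrableOn_congr_fun ?_ (measurableSet_singleton α)).2 h1
      intro t ht
      rw [mem_singleton_iff.1 ht]; simp
  · intro S
    refine integral_congr_ae (ae_restrict_of_ae ?_)
    exact (ae_restrict_iff' measurableSet_Ioo).2 (Eventually.of_forall he)

lemma wellP_local {ω : Measure ℝ} {G : ℝ → E → E} {k : ℝ → ℝ} {α β : ℝ} (hαβ : α < β)
    (hk : IntegrableOn k (Ico α β) ω)
    (hk0 : ∀ t, 0 ≤ k t) (hk1 : ∫ t in Ioo α β, k t ∂ω ≤ 1 / 2)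
    (hL : ∀ t p q, ‖G t p - G t q‖ ≤ k t * ‖p - q‖)
    (hG : ∀ w : ℝ → E, StronglyMeasurable w → (∃ C, ∀ t, ‖w t‖ ≤ C) →
      IntegrableOn (fun t => G t (w t)) (Ico α β) ω)
    (hbij : Function.Bijective (fun p => p + ω.real {α} • G α p)) : WellP ω G α β := by
  have hk' : Integrable k (ω.restrict (Ioo α β)) := hk.mono_set Ioo_subset_Ico_self
  have hG' : ∀ w : ℝ → E, StronglyMeasurable w → (∃ C, ∀ t, ‖w t‖ ≤ C) →
      Integrable (fun t => G t (w t)) (ω.restrict (Ioo α β)) := fun w h1 h2 =>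
    (hG w h1 h2).mono_set Ioo_subset_Ico_self
  have hS : ∀ᵐ t ∂(ω.restrict (Ioo α β)), t ∈ Ioc α β := by
    filter_upwards [ae_restrict_mem measurableSet_Ioo] with t ht using ⟨ht.1, ht.2.le⟩
  refine ⟨fun d => ?_, fun d => ?_, fun w w' hw hw' hor => ?_⟩
  · obtain ⟨w0, hw0, h0⟩ := core_exists (ω.restrict (Ioo α β)) G k hk' hk0 hk1 hL hG' Iio
      (fun h hh => sm_setIntegral _ hh) 1 (by simp) (d + ω.real {α} • G α d)
    obtain ⟨u1, u2⟩ := upd hαβ hG w0 d hw0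
    refine ⟨Function.update w0 α d, (solOn_iff hαβ u1).2 ?_, by simp⟩
    intro x hx
    rw [u2, Function.update_of_ne hx.1.ne', h0 x]
    simp
  · obtain ⟨w0, hw0, h0⟩ := core_exists (ω.restrict (Ioo α β)) G k hk' hk0 hk1 hL hG' Ici
      (fun h hh => sm_setIntegral' _ hh) (-1) (by simp) d
    obtain ⟨p, hp⟩ := hbij.2 (d - ∫ t, G t (w0 t) ∂(ω.restrict (Ioo α β)))
    simp only at hp
    obtain ⟨u1, u2⟩ := upd hαβ hG w0 p hw0
    have hβ : w0 β = d := by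
      have : Ici β ∩ Ioo α β = ∅ := by
        ext t; simp only [mem_inter_iff, mem_Ici, mem_Ioo, mem_empty_iff_false, iff_false]
        rintro ⟨h1, h2, h3⟩; exact absurd h3 (not_lt.2 h1)
      rw [h0 β, Measure.restrict_restrict measurableSet_Ici, this]; simp
    have u3 := u2 univ
    rw [setIntegral_univ, setIntegral_univ] at u3
    refine ⟨Function.update w0 α p, (solOn_iff' hαβ u1).2 ⟨?_, ?_⟩, by
      rw [Function.update_of_ne hαβ.ne', hβ]⟩
    · rw [u3, Function.update_of_ne hαβ.ne', Function.update_self, hp, hβ]; abel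
    · intro x hx
      rw [u2, Function.update_of_ne hx.1.ne', Function.update_of_ne hαβ.ne', hβ, h0 x]
  · have hi := hw.1
    have hi' := hw'.1
    have hj : Integrable (fun t => G t (w t)) (ω.restrict (Ioo α β)) :=
      hi.mono_set Ioo_subset_Ico_self
    have hj' : Integrable (fun t => G t (w' t)) (ω.restrict (Ioo α β)) :=
      hi'.mono_set Ioo_subset_Ico_self
    have main : (∀ x ∈ Ioc α β, w x = w' x) ∧ w α = w' α := by
      rcases hor with ho | ho
      · refine ⟨?_, ho⟩
        have e1 := (solOn_iff hαβ hi).1 hw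
        have e2 := (solOn_iff hαβ hi').1 hw'
        rw [← ho] at e2
        refine core_unique (ω.restrict (Ioo α β)) G k hk' hk0 hk1 hL Iio 1 (by simp)
          (w α + ω.real {α} • G α (w α)) (Ioc α β) hS w w' hj hj' ?_ ?_
        · simpa using e1
        · simpa using e2
      · obtain ⟨b1, e1⟩ := (solOn_iff' hαβ hi).1 hw
        obtain ⟨b2, e2⟩ := (solOn_iff' hαβ hi').1 hw'
        rw [← ho] at e2
        have heq : ∀ x ∈ Ioc α β, w x = w' x :=
          core_unique (ω.restrict (Ioo α β)) G k hk' hk0 hk1 hL Ici (-1) (by simp) _ (Ioc α β) hS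
            w w' hj hj' e1 e2
        refine ⟨heq, hbij.1 ?_⟩
        have hint : ∫ t, G t (w t) ∂(ω.restrict (Ioo α β)) =
            ∫ t, G t (w' t) ∂(ω.restrict (Ioo α β)) := by
          refine integral_congr_ae ?_
          filter_upwards [hS] with t ht
          rw [heq t ht]
        rw [ho, b2, hint] at b1
        exact (add_right_cancel b1).symm
    intro x hx
    rcases eq_or_lt_of_le hx.1 with he | hlt
    · rw [← he]; exact main.2
    · exact main.1 x ⟨hlt, hx.2⟩

lemma small_int {a b : ℝ} {ω : Measure ℝ} {k : ℝ → ℝ}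
    (hk : ∀ α ∈ Ioo a b, ∀ β ∈ Ioo a b, IntegrableOn k (Ico α β) ω)
    (hk0 : ∀ t, 0 ≤ k t) {T : ℝ} (hT : T ∈ Ioo a b) {ε : ℝ} (hε : 0 < ε) :
    ∃ δ > 0, a < T - δ ∧ T + δ < b ∧ (∀ y, T < y → y ≤ T + δ → ∫ t in Ioo T y, k t ∂ω ≤ ε) ∧
      (∀ y, T - δ ≤ y → y < T → ∫ t in Ioo y T, k t ∂ω ≤ ε) := by
  obtain ⟨η, hη, h1, h2⟩ : ∃ η > 0, a < T - η ∧ T + η < b := by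
    obtain ⟨h1, h2⟩ := hT
    refine ⟨min (T - a) (b - T) / 2, ?_, ?_, ?_⟩
    · have : 0 < min (T - a) (b - T) := lt_min (by linarith) (by linarith)
      linarith
    · have := min_le_left (T - a) (b - T); linarith
    · have := min_le_right (T - a) (b - T); linarith
  have hTη : T + η ∈ Ioo a b := ⟨by linarith, h2⟩
  have hTη' : T - η ∈ Ioo a b := ⟨h1, by linarith⟩
  have hlim : Tendsto (fun n : ℕ => η / ((n : ℝ) + 1)) atTop (nhds 0) := by
    simpa [div_eq_mul_inv] using (tendsto_one_div_add_atTop_nhds_zero_nat (𝕜 := ℝ)).const_mul η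
  have hle : ∀ n : ℕ, η / ((n : ℝ) + 1) ≤ η := fun n =>
    div_le_self hη.le (by have := n.cast_nonneg (α := ℝ); linarith)
  have hanti : ∀ m n : ℕ, m ≤ n → η / ((n : ℝ) + 1) ≤ η / ((m : ℝ) + 1) := by
    intro m n hmn
    have : (m : ℝ) ≤ n := by exact_mod_cast hmn
    gcongr
  have t1 := tendsto_setIntegral_of_antitone (μ := ω) (f := k)
    (s := fun n : ℕ => Ioo T (T + η / ((n : ℝ) + 1))) (fun _ => measurableSet_Ioo)
    (fun m n hmn => Ioo_subset_Ioo_right (by have := hanti m n hmn; linarith))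
    ⟨0, (hk T hT _ hTη).mono_set (by
      intro t ht; exact ⟨ht.1.le, ht.2.trans_le (by have := hle 0; linarith)⟩)⟩
  have t2 := tendsto_setIntegral_of_antitone (μ := ω) (f := k)
    (s := fun n : ℕ => Ioo (T - η / ((n : ℝ) + 1)) T) (fun _ => measurableSet_Ioo)
    (fun m n hmn => Ioo_subset_Ioo_left (by have := hanti m n hmn; linarith))
    ⟨0, (hk _ hTη' T hT).mono_set (by
      intro t ht; exact ⟨by have := hle 0; have := ht.1; linarith, ht.2⟩)⟩
  have e1 : (⋂ n : ℕ, Ioo T (T + η / ((n : ℝ) + 1))) = ∅ := by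
    rw [eq_empty_iff_forall_notMem]
    intro t ht
    rw [mem_iInter] at ht
    obtain ⟨n, hn⟩ := (hlim.eventually (gt_mem_nhds (sub_pos.2 (ht 0).1))).exists
    have := (ht n).2
    linarith
  have e2 : (⋂ n : ℕ, Ioo (T - η / ((n : ℝ) + 1)) T) = ∅ := by
    rw [eq_empty_iff_forall_notMem]
    intro t ht
    rw [mem_iInter] at ht
    obtain ⟨n, hn⟩ := (hlim.eventually (gt_mem_nhds (sub_pos.2 (ht 0).2))).exists
    have := (ht n).1
    linarith
  rw [e1, setIntegral_empty] at t1
  rw [e2, setIntegral_empty] at t2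
  obtain ⟨n, hn1, hn2⟩ := ((t1.eventually (gt_mem_nhds hε)).and
    (t2.eventually (gt_mem_nhds hε))).exists
  have hn := hle n
  refine ⟨η / ((n : ℝ) + 1), by positivity, by linarith, by linarith, fun y hy1 hy2 => ?_,
    fun y hy1 hy2 => ?_⟩
  · refine le_trans (setIntegral_mono_set ?_ (Eventually.of_forall hk0) ?_) hn1.le
    · exact (hk T hT _ hTη).mono_set
        (fun t ht => ⟨ht.1.le, ht.2.trans_le (by linarith)⟩)
    · exact (Ioo_subset_Ioo_right hy2).eventuallyLE
  · refine le_trans (setIntegral_mono_set ?_ (Eventually.of_forall hk0) ?_) hn2.le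
    · exact (hk _ hTη' T hT).mono_set
        (fun t ht => ⟨by have := ht.1; linarith, ht.2⟩)
    · exact (Ioo_subset_Ioo_left hy1).eventuallyLE

lemma wellP_global {a b : ℝ} {ω : Measure ℝ} {G : ℝ → E → E} {k : ℝ → ℝ}
    (hk : ∀ α ∈ Ioo a b, ∀ β ∈ Ioo a b, IntegrableOn k (Ico α β) ω)
    (hk0 : ∀ t, 0 ≤ k t)
    (hL : ∀ t p q, ‖G t p - G t q‖ ≤ k t * ‖p - q‖)
    (hG : ∀ α ∈ Ioo a b, ∀ β ∈ Ioo a b,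
      ∀ w : ℝ → E, StronglyMeasurable w → (∃ C, ∀ t, ‖w t‖ ≤ C) →
      IntegrableOn (fun t => G t (w t)) (Ico α β) ω)
    (hbij : ∀ x ∈ Ioo a b, Function.Bijective (fun p => p + ω.real {x} • G x p))
    {α β : ℝ} (hα : α ∈ Ioo a b) (hβ : β ∈ Ioo a b) (hαβ : α ≤ β) : WellP ω G α β := by
  set S : Set ℝ := {t | t ∈ Icc α β ∧ WellP ω G α t} with hS
  have hne : S.Nonempty := ⟨α, ⟨le_rfl, hαβ⟩, WellP.refl ω G α⟩
  have hbd : BddAbove S := ⟨β, fun t ht => ht.1.2⟩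
  set T := sSup S with hTd
  have hT1 : α ≤ T := le_csSup hbd ⟨⟨le_rfl, hαβ⟩, WellP.refl ω G α⟩
  have hT2 : T ≤ β := csSup_le hne fun t ht => ht.1.2
  have hT : T ∈ Ioo a b := ⟨hα.1.trans_le hT1, hT2.trans_lt hβ.2⟩
  obtain ⟨δ, hδ, d1, d2, d3, d4⟩ := small_int hk hk0 hT (ε := 1 / 2) (by norm_num)
  have hPT : WellP ω G α T := by
    obtain ⟨s, hs, hs1⟩ := exists_lt_of_lt_csSup hne (show T - δ < sSup S by linarith)
    have hs2 : s ≤ T := le_csSup hbd hs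
    have hsI : s ∈ Ioo a b := ⟨hα.1.trans_le hs.1.1, hs2.trans_lt hT.2⟩
    rcases eq_or_lt_of_le hs2 with he | hlt
    · rw [← he]; exact hs.2
    · exact hs.2.trans (wellP_local hlt (hk s hsI T hT) hk0 (d4 s hs1.le hlt) hL
        (hG s hsI T hT) (hbij s hsI)) hs.1.1 hs2
  rcases eq_or_lt_of_le hT2 with he | hlt
  · rw [← he]; exact hPT
  · exfalso
    set y := min (T + δ) β with hy
    have hy1 : T < y := lt_min (by linarith) hlt
    have hyI : y ∈ Ioo a b := ⟨hT.1.trans hy1, (min_le_right _ _).trans_lt hβ.2⟩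
    have hyS : y ∈ S := ⟨⟨hT1.trans hy1.le, min_le_right _ _⟩,
      hPT.trans (wellP_local hy1 (hk T hT y hyI) hk0 (d3 y hy1 (min_le_left _ _)) hL
        (hG T hT y hyI) (hbij T hT)) hT1 hy1.le⟩
    exact absurd (le_csSup hbd hyS) (not_le.2 hy1)

end core

/-- Right-hand side of the system as a map on `ℂ × ℂ`. -/
noncomputable def GG (σf χf ρf g : ℝ → ℂ) (z : ℂ) (t : ℝ) (p : ℂ × ℂ) : ℂ × ℂ :=
  (p.2 * σf t, p.1 * χf t - (z * p.1 + g t) * ρf t)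

/-- Lipschitz bound for `GG`. -/
noncomputable def kk (σf χf ρf : ℝ → ℂ) (z : ℂ) (t : ℝ) : ℝ :=
  ‖σf t‖ + ‖χf t‖ + ‖z‖ * ‖ρf t‖

lemma kk_nonneg (σf χf ρf : ℝ → ℂ) (z : ℂ) (t : ℝ) : 0 ≤ kk σf χf ρf z t := by
  unfold kk; positivity

lemma kk_int {a b : ℝ} {ω : Measure ℝ} {σf χf ρf : ℝ → ℂ} (z : ℂ)
    (hσ : LocInt a b ω σf) (hχ : LocInt a b ω χf) (hρ : LocInt a b ω ρf) :
    ∀ α ∈ Ioo a b, ∀ β ∈ Ioo a b, IntegrableOn (kk σf χf ρf z) (Ico α β) ω := by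
  intro α hα β hβ
  exact ((hσ α hα β hβ).norm.add (hχ α hα β hβ).norm).add ((hρ α hα β hβ).norm.const_mul ‖z‖)

lemma GG_lip (σf χf ρf g : ℝ → ℂ) (z : ℂ) (t : ℝ) (p q : ℂ × ℂ) :
    ‖GG σf χf ρf g z t p - GG σf χf ρf g z t q‖ ≤ kk σf χf ρf z t * ‖p - q‖ := by
  have h1 : ‖p.1 - q.1‖ ≤ ‖p - q‖ := norm_fst_le (p - q)
  have h2 : ‖p.2 - q.2‖ ≤ ‖p - q‖ := norm_snd_le (p - q)
  have e : GG σf χf ρf g z t p - GG σf χf ρf g z t q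
      = ((p.2 - q.2) * σf t, (p.1 - q.1) * (χf t - z * ρf t)) := by
    ext <;> simp [GG] <;> ring
  rw [e, Prod.norm_def]
  refine max_le ?_ ?_
  · simp only [norm_mul, kk]
    rw [mul_comm]
    gcongr
    have : 0 ≤ ‖χf t‖ + ‖z‖ * ‖ρf t‖ := by positivity
    linarith
  · simp only [norm_mul, kk]
    rw [mul_comm]
    gcongr
    refine (norm_sub_le _ _).trans ?_
    rw [norm_mul]
    have : 0 ≤ ‖σf t‖ := by positivity
    linarith

lemma GG_int {a b : ℝ} {ω : Measure ℝ} {σf χf ρf g : ℝ → ℂ} (z : ℂ)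
    (hσ : LocInt a b ω σf) (hχ : LocInt a b ω χf) (hρ : LocInt a b ω ρf)
    (hg : LocInt a b ω (fun t => g t * ρf t)) :
    ∀ α ∈ Ioo a b, ∀ β ∈ Ioo a b, ∀ w : ℝ → ℂ × ℂ, StronglyMeasurable w →
      (∃ C, ∀ t, ‖w t‖ ≤ C) → IntegrableOn (fun t => GG σf χf ρf g z t (w t)) (Ico α β) ω := by
  rintro α hα β hβ w hw ⟨C, hC⟩
  have m1 : StronglyMeasurable (fun t => (w t).1) := continuous_fst.comp_stronglyMeasurable hw
  have m2 : StronglyMeasurable (fun t => (w t).2) := continuous_snd.comp_stronglyMeasurable hw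
  have b1 : ∀ t, ‖(w t).1‖ ≤ C := fun t => (norm_fst_le _).trans (hC t)
  have b2 : ∀ t, ‖(w t).2‖ ≤ C := fun t => (norm_snd_le _).trans (hC t)
  have i1 := (hσ α hα β hβ).bdd_mul m2.aestronglyMeasurable (Eventually.of_forall b2)
  have i2 := (hχ α hα β hβ).bdd_mul m1.aestronglyMeasurable (Eventually.of_forall b1)
  have i3 := ((hρ α hα β hβ).bdd_mul m1.aestronglyMeasurable (Eventually.of_forall b1)).const_mul z
  have i4 := i2.sub (i3.add (hg α hα β hβ))
  refine Integrable.prodMk i1 (i4.congr (Eventually.of_forall fun t => ?_))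
  simp only [Pi.sub_apply, Pi.add_apply]
  ring

lemma GG_bij {ω : Measure ℝ} {σf χf ρf : ℝ → ℂ} (g : ℝ → ℂ) (z : ℂ) {x : ℝ}
    (h1 : ((ω {x}).toReal : ℂ) * ρf x * (((ω {x}).toReal : ℂ) * σf x) = 0)
    (h2 : ((ω {x}).toReal : ℂ) * χf x * (((ω {x}).toReal : ℂ) * σf x) ≠ 1) :
    Function.Bijective (fun p => p + ω.real {x} • GG σf χf ρf g z x p) := by
  rw [← measureReal_def] at h1 h2
  set J : ℝ := ω.real {x} with hJ
  set s : ℂ := J * σf x with hs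
  set m : ℂ := J * (χf x - z * ρf x) with hm
  set f : ℂ := J * (g x * ρf x) with hf
  have hD : 1 - s * m ≠ 0 := by
    intro h
    apply h2
    have : s * m = (J : ℂ) * χf x * (J * σf x) - z * (J * ρf x * (J * σf x)) := by
      rw [hs, hm]; ring
    rw [h1] at this
    rw [this] at h
    linear_combination -h
  have e : ∀ p : ℂ × ℂ, p + J • GG σf χf ρf g z x p = (p.1 + s * p.2, p.2 + m * p.1 - f) := by
    intro p
    ext
    · simp [GG, hs]; ring
    · simp [GG, hm, hf]; ring
  simp only [e]
  constructor
  · rintro p q hpq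
    simp only [Prod.mk.injEq] at hpq
    obtain ⟨a1, a2⟩ := hpq
    ext
    · apply mul_left_cancel₀ hD; linear_combination a1 - s * a2
    · apply mul_left_cancel₀ hD; linear_combination a2 - m * a1
  · intro q
    refine ⟨((q.1 - s * (q.2 + f)) / (1 - s * m), (q.2 + f - m * q.1) / (1 - s * m)), ?_⟩
    ext
    · simp only; field_simp; ring
    · simp only; rw [sub_eq_iff_eq_add, mul_div_assoc', ← add_div, div_eq_iff hD]; ring

lemma solIVP_iff {a b : ℝ} {ω : Measure ℝ} {σf χf ρf g : ℝ → ℂ} {z : ℂ} {c : ℝ} (hc : c ∈ Ioo a b)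
    {d₁ d₂ : ℂ} (w : ℝ → ℂ × ℂ) :
    SolIVP a b ω σf χf ρf g z c d₁ d₂ (fun t => (w t).1) (fun t => (w t).2) ↔
      (∀ α ∈ Ioo a b, ∀ β ∈ Ioo a b,
        IntegrableOn (fun t => GG σf χf ρf g z t (w t)) (Ico α β) ω) ∧
      (∀ x ∈ Ioo a b, c ≤ x →
        w x = (d₁, d₂) + ∫ t in Ico c x, GG σf χf ρf g z t (w t) ∂ω) ∧
      (∀ x ∈ Ioo a b, x < c →
        w x = (d₁, d₂) - ∫ t in Ico x c, GG σf χf ρf g z t (w t) ∂ω) := by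
  have hp : ∀ α ∈ Ioo a b, ∀ β ∈ Ioo a b,
      (IntegrableOn (fun t => GG σf χf ρf g z t (w t)) (Ico α β) ω ↔
        IntegrableOn (fun t => (w t).2 * σf t) (Ico α β) ω ∧
        IntegrableOn (fun t => (w t).1 * χf t - (z * (w t).1 + g t) * ρf t) (Ico α β) ω) := by
    intro α _ β _
    exact ⟨fun h => ⟨h.fst, h.snd⟩, fun h => Integrable.prodMk h.1 h.2⟩
  have hq : (LocInt a b ω (fun t => (w t).2 * σf t) ∧
      LocInt a b ω (fun t => (w t).1 * χf t - (z * (w t).1 + g t) * ρf t)) ↔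
      (∀ α ∈ Ioo a b, ∀ β ∈ Ioo a b,
        IntegrableOn (fun t => GG σf χf ρf g z t (w t)) (Ico α β) ω) := by
    constructor
    · rintro ⟨h1, h2⟩ α hα β hβ
      exact (hp α hα β hβ).2 ⟨h1 α hα β hβ, h2 α hα β hβ⟩
    · intro h
      exact ⟨fun α hα β hβ => ((hp α hα β hβ).1 (h α hα β hβ)).1,
        fun α hα β hβ => ((hp α hα β hβ).1 (h α hα β hβ)).2⟩
  unfold SolIVP
  rw [← and_assoc, hq]
  refine and_congr_right fun hI => ?_
  have hint : ∀ α ∈ Ioo a b, ∀ β ∈ Ioo a b,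
      ∫ t in Ico α β, GG σf χf ρf g z t (w t) ∂ω = (∫ t in Ico α β, (w t).2 * σf t ∂ω,
        ∫ t in Ico α β, (w t).1 * χf t - (z * (w t).1 + g t) * ρf t ∂ω) := by
    intro α hα β hβ
    obtain ⟨h1, h2⟩ := (hp α hα β hβ).1 (hI α hα β hβ)
    exact integral_pair h1 h2
  constructor
  · intro h
    refine ⟨fun x hx hcx => ?_, fun x hx hcx => ?_⟩
    · obtain ⟨h1, h2⟩ := h x hx
      rw [hint c hc x hx]
      simp only [mInt, if_pos hcx] at h1 h2
      exact Prod.ext h1 h2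
    · obtain ⟨h1, h2⟩ := h x hx
      rw [hint x hx c hc]
      simp only [mInt, if_neg (not_le.2 hcx), ← sub_eq_add_neg] at h1 h2
      exact Prod.ext h1 h2
  · rintro ⟨h1, h2⟩ x hx
    rcases le_or_gt c x with hcx | hcx
    · have := h1 x hx hcx
      rw [hint c hc x hx] at this
      simp only [mInt, if_pos hcx]
      exact ⟨congrArg Prod.fst this, congrArg Prod.snd this⟩
    · have := h2 x hx hcx
      rw [hint x hx c hc] at this
      simp only [mInt, if_neg (not_le.2 hcx), ← sub_eq_add_neg]
      exact ⟨congrArg Prod.fst this, congrArg Prod.snd this⟩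

lemma solIVP_iff' {a b : ℝ} {ω : Measure ℝ} {σf χf ρf g : ℝ → ℂ} {z : ℂ} {c : ℝ}
    (hc : c ∈ Ioo a b) {d₁ d₂ : ℂ} (w : ℝ → ℂ × ℂ) :
    SolIVP a b ω σf χf ρf g z c d₁ d₂ (fun t => (w t).1) (fun t => (w t).2) ↔
      w c = (d₁, d₂) ∧ (∀ x ∈ Ioo a b, c ≤ x → SolOn ω (GG σf χf ρf g z) c x w) ∧
      (∀ x ∈ Ioo a b, x ≤ c → SolOn ω (GG σf χf ρf g z) x c w) := by
  rw [solIVP_iff hc]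
  constructor
  · rintro ⟨hI, h1, h2⟩
    have hwc : w c = (d₁, d₂) := by simpa using h1 c hc le_rfl
    have h2' : ∀ x ∈ Ioo a b, x ≤ c →
        w x = (d₁, d₂) - ∫ t in Ico x c, GG σf χf ρf g z t (w t) ∂ω := by
      intro x hx hxc
      rcases eq_or_lt_of_le hxc with he | hlt
      · rw [he, hwc]; simp
      · exact h2 x hx hlt
    refine ⟨hwc, fun x hx hcx => ⟨hI c hc x hx, fun y hy => ?_⟩, fun x hx hxc =>
      ⟨hI x hx c hc, fun y hy => ?_⟩⟩
    · rw [hwc]; exact h1 y ⟨hc.1.trans_le hy.1, hy.2.trans_lt hx.2⟩ hy.1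
    · rw [h2' y ⟨hx.1.trans_le hy.1, hy.2.trans_lt hc.2⟩ hy.2, h2' x hx hxc,
        Ico_split hy.1 hy.2 (hI x hx c hc)]
      abel
  · rintro ⟨hwc, h1, h2⟩
    refine ⟨fun α hα β hβ => ?_, fun x hx hcx => ?_, fun x hx hxc => ?_⟩
    · have hm : min α c ∈ Ioo a b := ⟨lt_min hα.1 hc.1, (min_le_right _ _).trans_lt hc.2⟩
      have hM : max β c ∈ Ioo a b := ⟨hβ.1.trans_le (le_max_left _ _), max_lt hβ.2 hc.2⟩
      have i1 := (h2 _ hm (min_le_right _ _)).1.union (h1 _ hM (le_max_right _ _)).1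
      rw [Ico_union_Ico_eq_Ico (min_le_right _ _) (le_max_right _ _)] at i1
      exact i1.mono_set (Ico_subset_Ico (min_le_left _ _) (le_max_left _ _))
    · rw [← hwc]; exact (h1 x hx hcx).2 x ⟨hcx, le_rfl⟩
    · rw [← hwc, (h2 x hx hxc.le).2 c ⟨hxc.le, le_rfl⟩]; abel

lemma suff_dir {a b : ℝ} {ω : Measure ℝ} {σf χf ρf : ℝ → ℂ}
    (hσ : LocInt a b ω σf) (hχ : LocInt a b ω χf) (hρ : LocInt a b ω ρf)
    (h : ∀ x ∈ Set.Ioo a b,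
        ((ω {x}).toReal : ℂ) * ρf x * (((ω {x}).toReal : ℂ) * σf x) = 0 ∧
        ((ω {x}).toReal : ℂ) * χf x * (((ω {x}).toReal : ℂ) * σf x) ≠ 1)
    (z : ℂ) (c : ℝ) (hc : c ∈ Ioo a b) (d₁ d₂ : ℂ) (g : ℝ → ℂ)
    (hg : LocInt a b ω (fun t => g t * ρf t)) :
    (∃ u v : ℝ → ℂ, SolIVP a b ω σf χf ρf g z c d₁ d₂ u v) ∧
        (∀ u v u' v' : ℝ → ℂ, SolIVP a b ω σf χf ρf g z c d₁ d₂ u v →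
          SolIVP a b ω σf χf ρf g z c d₁ d₂ u' v' →
          ∀ x ∈ Set.Ioo a b, u x = u' x ∧ v x = v' x) := by
  have hW : ∀ α ∈ Ioo a b, ∀ β ∈ Ioo a b, α ≤ β → WellP ω (GG σf χf ρf g z) α β :=
    fun α hα β hβ hαβ => wellP_global (kk_int z hσ hχ hρ) (kk_nonneg _ _ _ _)
      (GG_lip σf χf ρf g z) (GG_int z hσ hχ hρ hg)
      (fun x hx => GG_bij g z (h x hx).1 (h x hx).2) hα hβ hαβ
  constructor
  · have hR : ∀ x : ℝ, ∃ w : ℝ → ℂ × ℂ, x ∈ Ioo a b → c ≤ x →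
        SolOn ω (GG σf χf ρf g z) c x w ∧ w c = (d₁, d₂) := by
      intro x
      by_cases hx : x ∈ Ioo a b ∧ c ≤ x
      · obtain ⟨w, hw⟩ := (hW c hc x hx.1 hx.2).1 (d₁, d₂)
        exact ⟨w, fun _ _ => hw⟩
      · exact ⟨0, fun h1 h2 => absurd ⟨h1, h2⟩ hx⟩
    have hL : ∀ x : ℝ, ∃ w : ℝ → ℂ × ℂ, x ∈ Ioo a b → x ≤ c →
        SolOn ω (GG σf χf ρf g z) x c w ∧ w c = (d₁, d₂) := by
      intro x
      by_cases hx : x ∈ Ioo a b ∧ x ≤ c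
      · obtain ⟨w, hw⟩ := (hW x hx.1 c hc hx.2).2.1 (d₁, d₂)
        exact ⟨w, fun _ _ => hw⟩
      · exact ⟨0, fun h1 h2 => absurd ⟨h1, h2⟩ hx⟩
    choose R hR using hR
    choose L hL using hL
    let w : ℝ → ℂ × ℂ := fun x => if c ≤ x then R x x else L x x
    have hwc : w c = (d₁, d₂) := by
      simp only [w, le_refl, if_true]; exact (hR c hc le_rfl).2
    refine ⟨fun t => (w t).1, fun t => (w t).2, (solIVP_iff' hc w).2 ⟨hwc, ?_, ?_⟩⟩
    · intro x hx hcx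
      obtain ⟨s1, s2⟩ := hR x hx hcx
      refine s1.congr fun y hy => ?_
      have hyI : y ∈ Ioo a b := ⟨hc.1.trans_le hy.1, hy.2.trans_lt hx.2⟩
      obtain ⟨r1, r2⟩ := hR y hyI hy.1
      simp only [w, if_pos hy.1]
      exact (hW c hc y hyI hy.1).2.2 _ _ (s1.sub le_rfl hy.2) r1 (Or.inl (s2.trans r2.symm)) y
        ⟨hy.1, le_rfl⟩
    · intro x hx hxc
      obtain ⟨s1, s2⟩ := hL x hx hxc
      refine s1.congr fun y hy => ?_
      have hyI : y ∈ Ioo a b := ⟨hx.1.trans_le hy.1, hy.2.trans_lt hc.2⟩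
      rcases eq_or_lt_of_le hy.2 with he | hlt
      · rw [he, hwc, s2]
      obtain ⟨r1, r2⟩ := hL y hyI hy.2
      simp only [w, if_neg (not_le.2 hlt)]
      exact (hW y hyI c hc hy.2).2.2 _ _ (s1.sub hy.1 le_rfl) r1 (Or.inr (s2.trans r2.symm)) y
        ⟨le_rfl, hy.2⟩
  · intro u v u' v' h1 h2 x hx
    obtain ⟨a1, a2, a3⟩ := (solIVP_iff' hc (fun t => (u t, v t))).1 h1
    obtain ⟨b1, b2, b3⟩ := (solIVP_iff' hc (fun t => (u' t, v' t))).1 h2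
    have key : (fun t => (u t, v t)) x = (fun t => (u' t, v' t)) x := by
      rcases le_total c x with hcx | hcx
      · exact (hW c hc x hx hcx).2.2 _ _ (a2 x hx hcx) (b2 x hx hcx) (Or.inl (a1.trans b1.symm)) x
          ⟨hcx, le_rfl⟩
      · exact (hW x hx c hc hcx).2.2 _ _ (a3 x hx hcx) (b3 x hx hcx) (Or.inr (a1.trans b1.symm)) x
          ⟨le_rfl, hcx⟩
    exact ⟨congrArg Prod.fst key, congrArg Prod.snd key⟩

lemma nec_dir {a b : ℝ} {ω : Measure ℝ} {σf χf ρf : ℝ → ℂ}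
    (hσ : LocInt a b ω σf) (hχ : LocInt a b ω χf) (hρ : LocInt a b ω ρf) (z : ℂ)
    {x : ℝ} (hx : x ∈ Ioo a b)
    (hz : ((ω.real {x} : ℝ) : ℂ) * (χf x - z * ρf x) * ((ω.real {x} : ℝ) * σf x) = 1)
    (hex : ∀ c ∈ Ioo a b, ∃ u v : ℝ → ℂ, SolIVP a b ω σf χf ρf (fun _ => 0) z c 0 1 u v) :
    False := by
  set J : ℝ := ω.real {x} with hJ
  set s : ℂ := J * σf x with hs
  set m : ℂ := J * (χf x - z * ρf x) with hm
  set G := GG σf χf ρf (fun _ => 0) z with hG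
  set k := kk σf χf ρf z with hk
  have hkn : ∀ t, 0 ≤ k t := kk_nonneg _ _ _ _
  set ε : ℝ := 1 / (4 * (‖m‖ + 1)) with hε
  have hm0 : 0 ≤ ‖m‖ := norm_nonneg m
  have hε0 : 0 < ε := by positivity
  have hε1 : ε * (‖m‖ + 1) = 1 / 4 := by rw [hε]; field_simp
  have hε2 : ε ≤ 1 / 4 := by nlinarith
  obtain ⟨δ, hδ, _, d2, d3, _⟩ := small_int (kk_int z hσ hχ hρ) hkn hx hε0
  set c := x + δ with hcd
  have hxc : x < c := by linarith
  have hc : c ∈ Ioo a b := ⟨hx.1.trans hxc, d2⟩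
  obtain ⟨u, v, huv⟩ := hex c hc
  obtain ⟨w1, _, w3⟩ := (solIVP_iff' hc (fun t => (u t, v t))).1 huv
  set w : ℝ → ℂ × ℂ := fun t => (u t, v t) with hw
  replace w1 : w c = (0, 1) := w1
  have hsol : SolOn ω G x c w := w3 x hx hxc.le
  obtain ⟨e1, e2⟩ := (solOn_iff' hxc hsol.1).1 hsol
  set ν := ω.restrict (Ioo x c) with hν
  have hI : Integrable (fun t => G t (w t)) ν := hsol.1.mono_set Ioo_subset_Ico_self
  have hkI : Integrable k ν :=
    (kk_int z hσ hχ hρ x hx c hc).mono_set Ioo_subset_Ico_self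
  have hkε : ∫ t, k t ∂ν ≤ ε := d3 c hxc le_rfl
  set A := ∫ t, ‖G t (w t)‖ ∂ν with hA
  have hA0 : 0 ≤ A := integral_nonneg fun _ => norm_nonneg _
  have hd : ‖w c‖ = 1 := by rw [w1]; simp [Prod.norm_def]
  have hb : ∀ t ∈ Ioc x c, ‖w t‖ ≤ 1 + A := by
    intro t ht
    rw [e2 t ht, neg_one_smul, ← sub_eq_add_neg]
    refine (norm_sub_le _ _).trans ?_
    rw [hd]
    gcongr
    exact (norm_integral_le_integral_norm _).trans
      (setIntegral_le_integral hI.norm (Eventually.of_forall fun _ => norm_nonneg _))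
  have hG0 : ∀ t p, ‖G t p‖ ≤ k t * ‖p‖ := by
    intro t p
    have := GG_lip σf χf ρf (fun _ => 0) z t p 0
    have h0 : GG σf χf ρf (fun _ => 0) z t 0 = 0 := by simp [GG]
    rwa [h0, sub_zero, sub_zero] at this
  have hA1 : A ≤ ε * (1 + A) := by
    calc A ≤ ∫ t, k t * (1 + A) ∂ν := by
          refine integral_mono_ae hI.norm (hkI.mul_const _) ?_
          filter_upwards [ae_restrict_mem measurableSet_Ioo] with t ht
          exact (hG0 t _).trans (mul_le_mul_of_nonneg_left (hb t ⟨ht.1, ht.2.le⟩) (hkn t))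
      _ = (∫ t, k t ∂ν) * (1 + A) := integral_mul_const _ _
      _ ≤ ε * (1 + A) := by gcongr
  have hA2 : A ≤ 2 * ε := by nlinarith
  set I := ∫ t, G t (w t) ∂ν with hIdef
  have hIn : ‖I‖ ≤ 2 * ε := (norm_integral_le_integral_norm _).trans hA2
  have hI1 : ‖I.1‖ ≤ 2 * ε := (norm_fst_le I).trans hIn
  have hI2 : ‖I.2‖ ≤ 2 * ε := (norm_snd_le I).trans hIn
  rw [w1] at e1
  have f1 : (0 : ℂ) = u x + s * v x + I.1 := by
    have := congrArg Prod.fst e1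
    simp only [Prod.fst_add, Prod.smul_fst, hG, GG, hw, Complex.real_smul] at this
    rw [this, hs]; ring
  have f2 : (1 : ℂ) = v x + m * u x + I.2 := by
    have := congrArg Prod.snd e1
    simp only [Prod.snd_add, Prod.smul_snd, hG, GG, hw, Complex.real_smul] at this
    rw [this, hm]; ring
  have f3 : (1 : ℂ) = I.2 - m * I.1 := by
    linear_combination f2 - m * f1 - v x * hz
  have : (1 : ℝ) ≤ 2 * ε + ‖m‖ * (2 * ε) := by
    calc (1 : ℝ) = ‖(1 : ℂ)‖ := by simp
      _ = ‖I.2 - m * I.1‖ := by rw [← f3]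
      _ ≤ ‖I.2‖ + ‖m * I.1‖ := norm_sub_le _ _
      _ = ‖I.2‖ + ‖m‖ * ‖I.1‖ := by rw [norm_mul]
      _ ≤ _ := by gcongr
  nlinarith

/-- Existence and uniqueness for the initial value problem `(τ-z)u = g`,
`u(c) = d₁`, `u^{[1]}(c) = d₂` holds for all data if and only if
`ϱ{x}·ς{x} = 0` and `χ{x}·ς{x} ≠ 1` for all `x ∈ (a,b)`. -/
theorem stmt6 (a b : ℝ) (hab : a < b) (ω : Measure ℝ) (σf χf ρf : ℝ → ℂ)
    (hσ : LocInt a b ω σf) (hχ : LocInt a b ω χf) (hρ : LocInt a b ω ρf)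
    (hsupp : SuppFull a b ω σf) :
    ((∀ z : ℂ, ∀ c ∈ Set.Ioo a b, ∀ d₁ d₂ : ℂ, ∀ g : ℝ → ℂ,
        LocInt a b ω (fun t => g t * ρf t) →
        (∃ u v : ℝ → ℂ, SolIVP a b ω σf χf ρf g z c d₁ d₂ u v) ∧
        (∀ u v u' v' : ℝ → ℂ, SolIVP a b ω σf χf ρf g z c d₁ d₂ u v →
          SolIVP a b ω σf χf ρf g z c d₁ d₂ u' v' →
          ∀ x ∈ Set.Ioo a b, u x = u' x ∧ v x = v' x)) ↔
      (∀ x ∈ Set.Ioo a b,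
        ((ω {x}).toReal : ℂ) * ρf x * (((ω {x}).toReal : ℂ) * σf x) = 0 ∧
        ((ω {x}).toReal : ℂ) * χf x * (((ω {x}).toReal : ℂ) * σf x) ≠ 1)) := by
  constructor
  · intro H
    have H' : ∀ z : ℂ, ∀ c ∈ Set.Ioo a b,
        ∃ u v : ℝ → ℂ, SolIVP a b ω σf χf ρf (fun _ => 0) z c 0 1 u v := fun z c hc =>
      (H z c hc 0 1 (fun _ => 0) (by intro α _ β _; simp)).1
    intro x hx
    have key : ((ω {x}).toReal : ℂ) * ρf x * (((ω {x}).toReal : ℂ) * σf x) = 0 := by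
      by_contra hne
      set q := ((ω {x}).toReal : ℂ) * ρf x * (((ω {x}).toReal : ℂ) * σf x) with hq
      refine nec_dir hσ hχ hρ
        ((((ω {x}).toReal : ℂ) * χf x * (((ω {x}).toReal : ℂ) * σf x) - 1) / q) hx ?_ (H' _)
      rw [measureReal_def]
      have := div_mul_cancel₀
        (((ω {x}).toReal : ℂ) * χf x * (((ω {x}).toReal : ℂ) * σf x) - 1) hne
      linear_combination -this - (((ω {x}).toReal : ℂ) * χf x * (((ω {x}).toReal : ℂ) * σf x) - 1) / q * hq
    refine ⟨key, fun h1 => ?_⟩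
    refine nec_dir hσ hχ hρ 0 hx ?_ (H' _)
    rw [measureReal_def]
    linear_combination h1
  · intro h z c hc d₁ d₂ g hg
    exact suff_dir hσ hχ hρ h z c hc d₁ d₂ g hg
end

section
/- Under the full Hypothesis, the multi-valued part of the maximal relation $T_{loc} = \{(f,\tau f) : f \in \mathfrak{D}_\tau\}$ (as a relation in $L^1_{loc}((a,b);\varrho)$) is $\mathrm{mul}(T_{loc}) = \mathrm{span}\{\mathbb{1}_{\{\alpha_\varrho\}}, \mathbb{1}_{\{\beta_\varrho\}}\}$. In particular $T_{loc}$ is an operator if and only if $\varrho(\{\alpha_\varrho\}) = \varrho(\{\beta_\varrho\}) = 0$. -/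
open MeasureTheory Set Filter

theorem pow_bound (ν : Measure ℝ) [IsFiniteMeasure ν] (n : ℕ) :
    ((n : ENNReal) + 1) * ∫⁻ s, ν (Iio s) ^ n ∂ν ≤ ν univ ^ (n+1) := by
  classical
  let P : Measure (Fin (n+1) → ℝ) := Measure.pi (fun _ => ν)
  let B : Set (ℝ × (Fin n → ℝ)) := {z | ∀ j, z.2 j < z.1}
  have hB : MeasurableSet B := by
    have : B = ⋂ j, {z : ℝ × (Fin n → ℝ) | z.2 j < z.1} := by ext; simp [B]
    rw [this]
    exact MeasurableSet.iInter fun j => measurableSet_lt (by fun_prop) (by fun_prop)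
  let A : Fin (n+1) → Set (Fin (n+1) → ℝ) := fun i =>
    (MeasurableEquiv.piFinSuccAbove (fun _ => ℝ) i) ⁻¹' B
  have hAm : ∀ i, MeasurableSet (A i) := fun i =>
    (MeasurableEquiv.piFinSuccAbove (fun _ => ℝ) i).measurable hB
  have hA : ∀ i, P (A i) = ∫⁻ s, ν (Iio s) ^ n ∂ν := by
    intro i
    have h := measurePreserving_piFinSuccAbove (fun _ : Fin (n+1) => ν) i
    rw [h.measure_preimage hB.nullMeasurableSet, Measure.prod_apply hB]
    congr 1; ext s
    have : Prod.mk s ⁻¹' B = Set.pi univ (fun _ : Fin n => Iio s) := by ext; simp [B]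
    rw [this, Measure.pi_pi]; simp
  have hdisj : Pairwise (Function.onFun Disjoint A) := by
    intro i j hij
    rw [Function.onFun, Set.disjoint_left]
    intro t hi hj
    have h1 : t j < t i := by
      obtain ⟨k, rfl⟩ := Fin.exists_succAbove_eq hij.symm
      exact hi k
    have h2 : t i < t j := by
      obtain ⟨k, rfl⟩ := Fin.exists_succAbove_eq hij
      exact hj k
    exact lt_asymm h1 h2
  have hU := measure_iUnion (μ := P) hdisj hAm
  have hle : P (⋃ i, A i) ≤ P univ := measure_mono (subset_univ _)
  rw [hU, tsum_fintype] at hle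
  simp only [hA] at hle
  simpa [P, Measure.pi_univ] using hle

theorem pow_bound' (μ : Measure ℝ) (h : ℝ → ENNReal) (x : ℝ)
    (hm : AEMeasurable h (μ.restrict (Iio x))) (hfin : ∫⁻ t in Iio x, h t ∂μ ≠ ⊤) (n : ℕ) :
    ((n : ENNReal) + 1) * ∫⁻ s in Iio x, h s * (∫⁻ t in Iio s, h t ∂μ) ^ n ∂μ ≤
      (∫⁻ t in Iio x, h t ∂μ) ^ (n+1) := by
  let ν := (μ.restrict (Iio x)).withDensity h
  have : IsFiniteMeasure ν := isFiniteMeasure_withDensity hfin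
  have key := pow_bound ν n
  have e1 : ν univ = ∫⁻ t in Iio x, h t ∂μ := by
    simp [ν, withDensity_apply]
  have hmeas : Measurable (fun s => ν (Iio s) ^ n) := by
    apply Measurable.pow_const
    apply Monotone.measurable
    intro a b hab
    exact measure_mono (Iio_subset_Iio hab)
  rw [e1, lintegral_withDensity_eq_lintegral_mul₀ hm hmeas.aemeasurable] at key
  refine le_trans (le_of_eq ?_) key
  congr 1
  apply setLIntegral_congr_fun measurableSet_Iio
  intro s hs
  simp only [Pi.mul_apply]
  congr 2
  simp only [ν]
  rw [withDensity_apply _ measurableSet_Iio, Measure.restrict_restrict measurableSet_Iio,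
    Iio_inter_Iio, min_eq_left (le_of_lt hs)]

theorem meas_prim_real (μ : Measure ℝ) (r : ℝ → ℝ) (hr : Integrable r μ) :
    Measurable (fun x => ∫ t in Iio x, r t ∂μ) := by
  have h1 : Measurable (fun x => ∫ t in Iio x, |r t| ∂μ) := by
    apply Monotone.measurable
    intro x y hxy
    exact setIntegral_mono_set hr.abs.integrableOn (ae_of_all _ fun t => abs_nonneg _)
      (Iio_subset_Iio hxy).eventuallyLE
  have h2 : Measurable (fun x => ∫ t in Iio x, (r t + |r t|) ∂μ) := by
    apply Monotone.measurable
    intro x y hxy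
    exact setIntegral_mono_set (hr.add hr.abs).integrableOn
      (ae_of_all _ fun t => by simp only [Pi.zero_apply]; linarith [neg_abs_le (r t)])
      (Iio_subset_Iio hxy).eventuallyLE
  have : (fun x => ∫ t in Iio x, r t ∂μ) =
      fun x => (∫ t in Iio x, (r t + |r t|) ∂μ) - ∫ t in Iio x, |r t| ∂μ := by
    ext x
    rw [integral_add hr.integrableOn hr.abs.integrableOn]; ring
  rw [this]; exact h2.sub h1

theorem meas_prim (μ : Measure ℝ) (h : ℝ → ℂ) (hh : Integrable h μ) :
    Measurable (fun x => ∫ t in Iio x, h t ∂μ) := by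
  have : (fun x => ∫ t in Iio x, h t ∂μ) =
      fun x => ((∫ t in Iio x, (h t).re ∂μ : ℝ) : ℂ) +
        ((∫ t in Iio x, (h t).im ∂μ : ℝ) : ℂ) * Complex.I := by
    ext x
    exact (integral_re_add_im (hh.integrableOn (s := Iio x))).symm
  rw [this]
  have h1 := meas_prim_real μ _ hh.re
  have h2 := meas_prim_real μ _ hh.im
  simp only [RCLike.re_to_complex, RCLike.im_to_complex] at h1 h2
  fun_prop

theorem meas_prim' (μ : Measure ℝ) (h : ℝ → ℂ) (x : ℝ) (hh : IntegrableOn h (Iio x) μ) :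
    AEStronglyMeasurable (fun x => ∫ t in Iio x, h t ∂μ) (μ.restrict (Iio x)) := by
  have := (meas_prim (μ.restrict (Iio x)) h hh).aestronglyMeasurable (μ := μ.restrict (Iio x))
  refine this.congr ?_
  filter_upwards [ae_restrict_mem measurableSet_Iio] with s hs
  rw [Measure.restrict_restrict measurableSet_Iio, Iio_inter_Iio, min_eq_left (le_of_lt hs)]

/-- sums of primitives vanish -/
theorem ae_zero_of_prim (μ : Measure ℝ) (h : ℝ → ℂ) (hh : Integrable h μ)
    (h0 : ∀ x, ∫ t in Iio x, h t ∂μ = 0) (hu : ∫ t, h t ∂μ = 0) : h =ᵐ[μ] 0 := by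
  apply Integrable.ae_eq_zero_of_forall_setIntegral_eq_zero hh
  intro s hs hfin
  clear hfin
  induction s, hs using MeasurableSpace.induction_on_inter
    ((borel_eq_generateFrom_Iio ℝ ▸ (BorelSpace.measurable_eq (α := ℝ)))) (isPiSystem_Iio) with
  | empty => simp
  | basic t ht => obtain ⟨x, rfl⟩ := ht; exact h0 x
  | compl t ht ih =>
    have := integral_add_compl ht hh
    simp_all
  | iUnion f hd hm ih =>
    rw [integral_iUnion hm hd hh.integrableOn]
    simp_all

theorem ae_zero_Ioo {ω : Measure ℝ} {h : ℝ → ℂ} {p q : ℝ}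
    (hh : ∀ s ∈ Ioo p q, ∀ t ∈ Ioo p q, IntegrableOn h (Ico s t) ω)
    (h0 : ∀ s ∈ Ioo p q, ∀ t ∈ Ioo p q, s ≤ t → ∫ u in Ico s t, h u ∂ω = 0) :
    ∀ᵐ t ∂ω, t ∈ Ioo p q → h t = 0 := by
  have key : ∀ s ∈ Ioo p q, ∀ t ∈ Ioo p q, ∀ᵐ u ∂ω, u ∈ Ico s t → h u = 0 := by
    intro s hs t ht
    rw [← ae_restrict_iff' measurableSet_Ico]
    rcases le_total t s with hts | hst
    · simp [Ico_eq_empty (not_lt.2 hts)]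
    apply ae_zero_of_prim _ _ (hh s hs t ht)
    · intro x
      rw [Measure.restrict_restrict measurableSet_Iio]
      have e : Iio x ∩ Ico s t = Ico s (min x t) := by
        ext u; simp; tauto
      rw [e]
      rcases le_total (min x t) s with hl | hl
      · simp [Ico_eq_empty (not_lt.2 hl)]
      · exact h0 s hs _ ⟨lt_of_lt_of_le hs.1 hl, lt_of_le_of_lt (min_le_right _ _) ht.2⟩ hl
    · exact h0 s hs t ht hst
  have : ∀ᵐ u ∂ω, ∀ r s : ℚ, (r:ℝ) ∈ Ioo p q → (s:ℝ) ∈ Ioo p q → u ∈ Ico (r:ℝ) s → h u = 0 := by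
    rw [ae_all_iff]; intro r
    rw [ae_all_iff]; intro s
    by_cases hr : (r:ℝ) ∈ Ioo p q
    · by_cases hs : (s:ℝ) ∈ Ioo p q
      · filter_upwards [key r hr s hs] with u hu _ _ using hu
      · simp only [hs]; simp
    · simp only [hr]; simp
  filter_upwards [this] with u hu hupq
  obtain ⟨r, hr1, hr2⟩ := exists_rat_btwn hupq.1
  obtain ⟨s, hs1, hs2⟩ := exists_rat_btwn hupq.2
  exact hu r s ⟨hr1, by linarith [hupq.2]⟩ ⟨by linarith [hupq.1], hs2⟩ ⟨hr2.le, hs1⟩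

/-- left limit -/
theorem tendsto_left {ω : Measure ℝ} {H h : ℝ → ℂ} {p x : ℝ} (hp : p < x)
    (hh : IntegrableOn h (Ico p x) ω)
    (hH : ∀ s ∈ Ioo p x, H x = H s + ∫ t in Ico s x, h t ∂ω) :
    Tendsto H (nhdsWithin x (Iio x)) (nhds (H x)) := by
  have key : Tendsto (fun s => ∫ t, (Ico s x).indicator h t ∂(ω.restrict (Ico p x)))
      (nhdsWithin x (Iio x)) (nhds (∫ t, (0:ℂ) ∂(ω.restrict (Ico p x)))) := by
    apply tendsto_integral_filter_of_dominated_convergence (fun t => ‖h t‖)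
    · exact Eventually.of_forall fun s => hh.aestronglyMeasurable.indicator measurableSet_Ico
    · exact Eventually.of_forall fun s => ae_of_all _ fun t => norm_indicator_le_norm_self _ _
    · exact hh.norm
    · filter_upwards [ae_restrict_mem measurableSet_Ico] with t ht
      apply tendsto_const_nhds.congr'
      filter_upwards [Ioo_mem_nhdsLT ht.2] with s hs
      rw [indicator_of_notMem]
      simp [hs.1]
  have : Tendsto (fun s => H x - ∫ t, (Ico s x).indicator h t ∂(ω.restrict (Ico p x)))
      (nhdsWithin x (Iio x)) (nhds (H x - 0)) := by
    simpa using tendsto_const_nhds.sub key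
  rw [sub_zero] at this
  apply this.congr'
  filter_upwards [Ioo_mem_nhdsLT hp] with s hs
  rw [integral_indicator measurableSet_Ico, Measure.restrict_restrict measurableSet_Ico,
    inter_eq_left.2 (Ico_subset_Ico_left hs.1.le), hH s hs]
  ring

theorem tendsto_right {ω : Measure ℝ} {H h : ℝ → ℂ} {x q : ℝ} (hq : x < q)
    (hh : IntegrableOn h (Ico x q) ω)
    (hH : ∀ s ∈ Ioo x q, H s = H x + ∫ t in Ico x s, h t ∂ω) :
    Tendsto H (nhdsWithin x (Ioi x)) (nhds (H x + ((ω {x}).toReal : ℂ) * h x)) := by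
  have key : Tendsto (fun s => ∫ t, (Ico x s).indicator h t ∂(ω.restrict (Ico x q)))
      (nhdsWithin x (Ioi x)) (nhds (∫ t, ({x} : Set ℝ).indicator h t ∂(ω.restrict (Ico x q)))) := by
    apply tendsto_integral_filter_of_dominated_convergence (fun t => ‖h t‖)
    · exact Eventually.of_forall fun s => hh.aestronglyMeasurable.indicator measurableSet_Ico
    · exact Eventually.of_forall fun s => ae_of_all _ fun t => norm_indicator_le_norm_self _ _
    · exact hh.norm
    · filter_upwards [ae_restrict_mem measurableSet_Ico] with t ht
      apply tendsto_const_nhds.congr'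
      rcases eq_or_lt_of_le ht.1 with rfl | hlt
      · filter_upwards [Ioo_mem_nhdsGT hq] with s hs
        rw [indicator_of_mem (by simp), indicator_of_mem (by simp [hs.1])]
      · filter_upwards [Ioo_mem_nhdsGT hlt] with s hs
        rw [indicator_of_notMem (by simp [hlt.ne']), indicator_of_notMem (by simp [hs.2.le])]
  have e : ∫ t, ({x} : Set ℝ).indicator h t ∂(ω.restrict (Ico x q)) =
      ((ω {x}).toReal : ℂ) * h x := by
    rw [integral_indicator (measurableSet_singleton x),
      Measure.restrict_restrict (measurableSet_singleton x), inter_eq_left.2 (by simp [hq]),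
      integral_singleton]
    simp [Measure.real]
  rw [e] at key
  apply (tendsto_const_nhds.add key).congr'
  filter_upwards [Ioo_mem_nhdsGT hq] with s hs
  rw [integral_indicator measurableSet_Ico, Measure.restrict_restrict measurableSet_Ico,
    inter_eq_left.2 (Ico_subset_Ico_right hs.2.le), hH s hs]

/-- Picard iterates -/
noncomputable def picSeq (μ : Measure ℝ) (p q : ℝ → ℂ) (u0 v0 : ℂ) : ℕ → (ℝ → ℂ) × (ℝ → ℂ)
  | 0 => (fun _ => u0, fun _ => v0)
  | n+1 => (fun x => ∫ t in Iio x, (picSeq μ p q u0 v0 n).2 t * p t ∂μ,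
            fun x => ∫ t in Iio x, (picSeq μ p q u0 v0 n).1 t * q t ∂μ)

theorem pic_core (μ : Measure ℝ) (b : ℝ) (p q : ℝ → ℂ)
    (hp : ∀ x < b, IntegrableOn p (Iio x) μ) (hq : ∀ x < b, IntegrableOn q (Iio x) μ)
    (u0 v0 : ℂ) : ∃ u v : ℝ → ℂ, ∀ x < b,
      IntegrableOn (fun t => v t * p t) (Iio x) μ ∧ IntegrableOn (fun t => u t * q t) (Iio x) μ ∧
      u x = u0 + ∫ t in Iio x, v t * p t ∂μ ∧ v x = v0 + ∫ t in Iio x, u t * q t ∂μ := by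
  set S := picSeq μ p q u0 v0 with hS
  set k : ℝ → ENNReal := fun t => ‖p t‖ₑ + ‖q t‖ₑ with hk
  set G : ℝ → ENNReal := fun x => ∫⁻ t in Iio x, k t ∂μ with hG
  set M : ENNReal := ‖u0‖ₑ + ‖v0‖ₑ with hM
  have hMfin : M ≠ ⊤ := by simp [hM]
  have hkm : ∀ x < b, AEMeasurable k (μ.restrict (Iio x)) := fun x hx =>
    (hp x hx).aestronglyMeasurable.enorm.add (hq x hx).aestronglyMeasurable.enorm
  have hGfin : ∀ x < b, G x ≠ ⊤ := by
    intro x hx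
    have h1 := (hp x hx).2
    have h2 := (hq x hx).2
    simp only [HasFiniteIntegral] at h1 h2
    simp only [hG, hk]
    rw [lintegral_add_left' (hp x hx).aestronglyMeasurable.enorm]
    exact (ENNReal.add_lt_top.2 ⟨h1, h2⟩).ne
  have hGmono : Monotone G := fun x y hxy => lintegral_mono_set (Iio_subset_Iio hxy)
  -- bounds
  have hbd : ∀ n, ∀ x < b, ‖(S n).1 x‖ₑ ≤ M * (G x ^ n / (n.factorial : ENNReal)) ∧
      ‖(S n).2 x‖ₑ ≤ M * (G x ^ n / (n.factorial : ENNReal)) := by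
    intro n
    induction n with
    | zero => intro x hx; simp [hS, picSeq, hM]
    | succ n ih =>
      intro x hx
      have main : ∀ w r : ℝ → ℂ, (∀ t < b, ‖w t‖ₑ ≤ M * (G t ^ n / (n.factorial : ENNReal))) →
          (∀ t, ‖r t‖ₑ ≤ k t) → ‖∫ t in Iio x, w t * r t ∂μ‖ₑ ≤
            M * (G x ^ (n+1) / ((n+1).factorial : ENNReal)) := by
        intro w r hw hr
        calc ‖∫ t in Iio x, w t * r t ∂μ‖ₑ ≤ ∫⁻ t in Iio x, ‖w t * r t‖ₑ ∂μ :=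
              enorm_integral_le_lintegral_enorm _
          _ ≤ ∫⁻ t in Iio x, (M * (n.factorial : ENNReal)⁻¹) * (k t * G t ^ n) ∂μ := by
              apply setLIntegral_mono' measurableSet_Iio
              intro t ht
              rw [enorm_mul]
              calc ‖w t‖ₑ * ‖r t‖ₑ ≤ (M * (G t ^ n / (n.factorial : ENNReal))) * k t :=
                    mul_le_mul' (hw t (lt_trans ht hx)) (hr t)
                _ = _ := by rw [div_eq_mul_inv]; ring
          _ = (M * (n.factorial : ENNReal)⁻¹) * ∫⁻ t in Iio x, k t * G t ^ n ∂μ := by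
              apply lintegral_const_mul'
              refine ENNReal.mul_ne_top hMfin ?_
              simp [Nat.factorial_ne_zero]
          _ ≤ (M * (n.factorial : ENNReal)⁻¹) * (G x ^ (n+1) / ((n:ENNReal) + 1)) := by
              gcongr
              rw [ENNReal.le_div_iff_mul_le (by simp) (by simp), mul_comm]
              exact pow_bound' μ k x (hkm x hx) (hGfin x hx) n
          _ = _ := by
              rw [Nat.factorial_succ, Nat.cast_mul, div_eq_mul_inv, div_eq_mul_inv,
                ENNReal.mul_inv (by simp) (by simp)]
              push_cast
              ring
      constructor
      · exact main _ _ (fun t ht => (ih t ht).2) (fun t => by simp [hk])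
      · exact main _ _ (fun t ht => (ih t ht).1) (fun t => by simp [hk])
  -- real bounds
  set B : ℝ → ℕ → ℝ := fun x n => M.toReal * ((G x).toReal ^ n / (n.factorial : ℝ)) with hB
  have hBsum : ∀ x, Summable (B x) := fun x =>
    (Real.summable_pow_div_factorial (G x).toReal).mul_left _
  have hBmono : ∀ n, ∀ x < b, ∀ t ≤ x, B t n ≤ B x n := by
    intro n x hx t ht
    simp only [hB]
    have := ENNReal.toReal_mono (hGfin x hx) (hGmono ht)
    gcongr
  have conv : ∀ n, ∀ x < b, ∀ z : ℂ, ‖z‖ₑ ≤ M * (G x ^ n / (n.factorial : ENNReal)) →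
      ‖z‖ ≤ B x n := by
    intro n x hx z hz
    have h := ENNReal.toReal_mono (ENNReal.mul_ne_top hMfin
      (ENNReal.div_ne_top (ENNReal.pow_ne_top (hGfin x hx)) (by simp [Nat.factorial_ne_zero]))) hz
    simpa [hB] using h
  have hb1 : ∀ n, ∀ x < b, ‖(S n).1 x‖ ≤ B x n := fun n x hx => conv n x hx _ (hbd n x hx).1
  have hb2 : ∀ n, ∀ x < b, ‖(S n).2 x‖ ≤ B x n := fun n x hx => conv n x hx _ (hbd n x hx).2
  -- generic integrability
  have hint : ∀ w r : ℝ → ℂ, ∀ x < b, ∀ C : ℝ, AEStronglyMeasurable w (μ.restrict (Iio x)) →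
      (∀ t < x, ‖w t‖ ≤ C) → IntegrableOn r (Iio x) μ →
      IntegrableOn (fun t => w t * r t) (Iio x) μ := by
    intro w r x hx C hw hC hr
    apply Integrable.bdd_mul (c := C) hr hw
    filter_upwards [ae_restrict_mem measurableSet_Iio] with t ht using hC t ht
  have hmeas : ∀ n, ∀ x < b, AEStronglyMeasurable (S n).1 (μ.restrict (Iio x)) ∧
      AEStronglyMeasurable (S n).2 (μ.restrict (Iio x)) := by
    intro n
    induction n with
    | zero => intro x hx; exact ⟨aestronglyMeasurable_const, aestronglyMeasurable_const⟩
    | succ n ih =>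
      intro x hx
      exact ⟨meas_prim' μ _ x (hint _ _ x hx (B x n) (ih x hx).2 (fun t ht =>
          (hb2 n t (lt_trans ht hx)).trans (hBmono n x hx t ht.le)) (hp x hx)),
        meas_prim' μ _ x (hint _ _ x hx (B x n) (ih x hx).1 (fun t ht =>
          (hb1 n t (lt_trans ht hx)).trans (hBmono n x hx t ht.le)) (hq x hx))⟩
  -- generic summation
  have gen : ∀ (W : ℕ → ℝ → ℂ) (r : ℝ → ℂ), (∀ n, ∀ x < b, ‖W n x‖ ≤ B x n) →
      (∀ n, ∀ x < b, AEStronglyMeasurable (W n) (μ.restrict (Iio x))) →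
      (∀ x < b, IntegrableOn r (Iio x) μ) → ∀ x < b,
      IntegrableOn (fun t => (∑' n, W n t) * r t) (Iio x) μ ∧
      HasSum (fun n => ∫ t in Iio x, W n t * r t ∂μ) (∫ t in Iio x, (∑' n, W n t) * r t ∂μ) := by
    intro W r hW hWm hr x hx
    have hsumW : ∀ t < b, Summable (fun n => W n t) := fun t ht =>
      Summable.of_norm_bounded (hBsum t) (fun n => hW n t ht)
    have hWx : ∀ n, ∀ t < x, ‖W n t‖ ≤ B x n := fun n t ht =>
      (hW n t (lt_trans ht hx)).trans (hBmono n x hx t ht.le)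
    constructor
    · refine hint _ _ x hx (∑' n, B x n) ?_ ?_ (hr x hx)
      · apply aestronglyMeasurable_of_tendsto_ae atTop
          (f := fun N t => ∑ n ∈ Finset.range N, W n t)
        · intro N
          exact Finset.aestronglyMeasurable_fun_sum _ fun n _ => hWm n x hx
        · filter_upwards [ae_restrict_mem measurableSet_Iio] with t ht
          exact (hsumW t (lt_trans ht hx)).hasSum.tendsto_sum_nat
      · intro t ht
        exact tsum_of_norm_bounded (hBsum x).hasSum (fun n => hWx n t ht)
    · have hi : ∀ n, IntegrableOn (fun t => W n t * r t) (Iio x) μ := fun n =>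
        hint _ _ x hx (B x n) (hWm n x hx) (hWx n) (hr x hx)
      have hs := hasSum_integral_of_summable_integral_norm (μ := μ.restrict (Iio x))
        (F := fun n t => W n t * r t) hi ?_
      · simpa only [tsum_mul_right] using hs
      · apply Summable.of_nonneg_of_le (fun n => integral_nonneg fun t => norm_nonneg _) _
          ((hBsum x).mul_right (∫ t in Iio x, ‖r t‖ ∂μ))
        intro n
        rw [← integral_const_mul]
        apply setIntegral_mono_on (hi n).norm ((hr x hx).norm.const_mul _) measurableSet_Iio
        intro t ht
        rw [norm_mul]
        exact mul_le_mul_of_nonneg_right (hWx n t ht) (norm_nonneg _)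
  refine ⟨fun x => ∑' n, (S n).1 x, fun x => ∑' n, (S n).2 x, fun x hx => ?_⟩
  obtain ⟨i1, s1⟩ := gen (fun n => (S n).2) p hb2 (fun n x hx => (hmeas n x hx).2) hp x hx
  obtain ⟨i2, s2⟩ := gen (fun n => (S n).1) q hb1 (fun n x hx => (hmeas n x hx).1) hq x hx
  refine ⟨i1, i2, ?_, ?_⟩
  · have hs : Summable (fun n => (S n).1 x) :=
      Summable.of_norm_bounded (hBsum x) (fun n => hb1 n x hx)
    beta_reduce
    rw [hs.tsum_eq_zero_add, ← s1.tsum_eq]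
    rfl
  · have hs : Summable (fun n => (S n).2 x) :=
      Summable.of_norm_bounded (hBsum x) (fun n => hb2 n x hx)
    beta_reduce
    rw [hs.tsum_eq_zero_add, ← s2.tsum_eq]
    rfl

theorem ivp_right (ω : Measure ℝ) (c b : ℝ) (p q : ℝ → ℂ)
    (hp : ∀ x < b, IntegrableOn p (Ioo c x) ω) (hq : ∀ x < b, IntegrableOn q (Ioo c x) ω)
    (v0 : ℂ) : ∃ u v : ℝ → ℂ, ∀ x < b,
      IntegrableOn (fun t => v t * p t) (Ioo c x) ω ∧ IntegrableOn (fun t => u t * q t) (Ioo c x) ω ∧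
      u x = ∫ t in Ioo c x, v t * p t ∂ω ∧ v x = v0 + ∫ t in Ioo c x, u t * q t ∂ω := by
  have e : ∀ x, (ω.restrict (Ioi c)).restrict (Iio x) = ω.restrict (Ioo c x) := by
    intro x
    rw [Measure.restrict_restrict measurableSet_Iio, Iio_inter_Ioi]
  have := pic_core (ω.restrict (Ioi c)) b p q (fun x hx => by
    rw [IntegrableOn, e]; exact hp x hx) (fun x hx => by
    rw [IntegrableOn, e]; exact hq x hx) 0 v0
  simpa only [IntegrableOn, e, zero_add] using this

theorem ivp_left (ω : Measure ℝ) (a c : ℝ) (p q : ℝ → ℂ)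
    (hp : ∀ x > a, IntegrableOn p (Ioo x c) ω) (hq : ∀ x > a, IntegrableOn q (Ioo x c) ω)
    (v0 : ℂ) : ∃ u v : ℝ → ℂ, ∀ x > a,
      IntegrableOn (fun t => v t * p t) (Ioo x c) ω ∧ IntegrableOn (fun t => u t * q t) (Ioo x c) ω ∧
      u x = - ∫ t in Ioo x c, v t * p t ∂ω ∧ v x = v0 - ∫ t in Ioo x c, u t * q t ∂ω := by
  have hE : MeasurableEmbedding (fun x : ℝ => -x) := (MeasurableEquiv.neg ℝ).measurableEmbedding
  set μ := (ω.restrict (Iio c)).map (fun x : ℝ => -x) with hμ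
  have e : ∀ x, (ω.restrict (Iio c)).restrict ((fun x : ℝ => -x) ⁻¹' Iio x) =
      ω.restrict (Ioo (-x) c) := by
    intro x
    rw [Measure.restrict_restrict (measurable_neg measurableSet_Iio)]
    congr 1
    ext t; simp
  have hI : ∀ (h : ℝ → ℂ) x, IntegrableOn h (Iio x) μ ↔ IntegrableOn (fun t => h (-t)) (Ioo (-x) c) ω := by
    intro h x
    rw [hμ, hE.integrableOn_map_iff, IntegrableOn, e]
    rfl
  have hJ : ∀ (h : ℝ → ℂ) x, ∫ t in Iio x, h t ∂μ = ∫ t in Ioo (-x) c, h (-t) ∂ω := by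
    intro h x
    rw [hμ, hE.setIntegral_map, e]
  obtain ⟨u, v, huv⟩ := pic_core μ (-a) (fun t => - p (-t)) (fun t => - q (-t)) (fun x hx => by
    rw [hI]; simpa using (hp (-x) (by linarith)).neg) (fun x hx => by
    rw [hI]; simpa using (hq (-x) (by linarith)).neg) 0 v0
  refine ⟨fun x => u (-x), fun x => v (-x), fun x hx => ?_⟩
  obtain ⟨h1, h2, h3, h4⟩ := huv (-x) (by linarith)
  rw [hI] at h1 h2
  rw [hJ] at h3 h4
  simp only [neg_neg, mul_neg, integral_neg, zero_add] at h1 h2 h3 h4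
  refine ⟨by simpa using h1.neg, by simpa using h2.neg, h3, ?_⟩
  beta_reduce
  rw [h4]; ring

theorem LocInt.congr' {a b : ℝ} {ω : Measure ℝ} {h k : ℝ → ℂ} (hh : LocInt a b ω h)
    (e : ∀ᵐ t ∂ω, t ∈ Ioo a b → h t = k t) : LocInt a b ω k := by
  intro s hs t ht
  refine (hh s hs t ht).congr ?_
  filter_upwards [ae_restrict_mem measurableSet_Ico, ae_restrict_of_ae e] with u hu he
  exact he ⟨lt_of_lt_of_le hs.1 hu.1, lt_trans hu.2 ht.2⟩

theorem setInt_congr' {a b : ℝ} {ω : Measure ℝ} {h k : ℝ → ℂ}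
    (e : ∀ᵐ t ∂ω, t ∈ Ioo a b → h t = k t) {s t : ℝ} (hs : s ∈ Ioo a b) (ht : t ∈ Ioo a b) :
    ∫ u in Ico s t, h u ∂ω = ∫ u in Ico s t, k u ∂ω := by
  apply integral_congr_ae
  filter_upwards [ae_restrict_mem measurableSet_Ico, ae_restrict_of_ae e] with u hu he
  exact he ⟨lt_of_lt_of_le hs.1 hu.1, lt_trans hu.2 ht.2⟩

theorem InDom.congr_g {a b : ℝ} {ω : Measure ℝ} {σf χf ρf f f1 g g' : ℝ → ℂ}
    (h : InDom a b ω σf χf ρf f f1 g)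
    (e : ∀ᵐ t ∂ω, t ∈ Ioo a b → g t * ρf t = g' t * ρf t) : InDom a b ω σf χf ρf f f1 g' := by
  have e' : ∀ᵐ t ∂ω, t ∈ Ioo a b → f t * χf t - g t * ρf t = f t * χf t - g' t * ρf t := by
    filter_upwards [e] with t ht h2
    rw [ht h2]
  refine ⟨h.1, h.2.1.congr' e', fun s hs t ht hst => ⟨(h.2.2 s hs t ht hst).1, ?_⟩⟩
  rw [← setInt_congr' e' hs ht]
  exact (h.2.2 s hs t ht hst).2

theorem InDom.add' {a b : ℝ} {ω : Measure ℝ} {σf χf ρf f f1 g k k1 l : ℝ → ℂ}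
    (h : InDom a b ω σf χf ρf f f1 g) (h' : InDom a b ω σf χf ρf k k1 l) :
    InDom a b ω σf χf ρf (fun t => f t + k t) (fun t => f1 t + k1 t) (fun t => g t + l t) := by
  have e1 : (fun t => (f1 t + k1 t) * σf t) = fun t => f1 t * σf t + k1 t * σf t := by
    ext t; ring
  have e2 : (fun t => (f t + k t) * χf t - (g t + l t) * ρf t) =
      fun t => (f t * χf t - g t * ρf t) + (k t * χf t - l t * ρf t) := by
    ext t; ring
  unfold InDom
  rw [e1, e2]
  refine ⟨fun s hs t ht => (h.1 s hs t ht).add (h'.1 s hs t ht),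
    fun s hs t ht => (h.2.1 s hs t ht).add (h'.2.1 s hs t ht), fun s hs t ht hst => ⟨?_, ?_⟩⟩
  · beta_reduce
    rw [integral_add (h.1 s hs t ht) (h'.1 s hs t ht), (h.2.2 s hs t ht hst).1,
      (h'.2.2 s hs t ht hst).1]
    ring
  · beta_reduce
    rw [integral_add (h.2.1 s hs t ht) (h'.2.1 s hs t ht), (h.2.2 s hs t ht hst).2,
      (h'.2.2 s hs t ht hst).2]
    ring

theorem InDom.mk' {a b : ℝ} {ω : Measure ℝ} {σf χf ρf f f1 g h1 h2 : ℝ → ℂ}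
    (i1 : LocInt a b ω h1) (i2 : LocInt a b ω h2)
    (e1 : ∀ t ∈ Ioo a b, h1 t = f1 t * σf t)
    (e2 : ∀ t ∈ Ioo a b, h2 t = f t * χf t - g t * ρf t)
    (d1 : ∀ s ∈ Ioo a b, ∀ t ∈ Ioo a b, s ≤ t → f t = f s + ∫ u in Ico s t, h1 u ∂ω)
    (d2 : ∀ s ∈ Ioo a b, ∀ t ∈ Ioo a b, s ≤ t → f1 t = f1 s + ∫ u in Ico s t, h2 u ∂ω) :
    InDom a b ω σf χf ρf f f1 g := by
  have e1' : ∀ᵐ t ∂ω, t ∈ Ioo a b → h1 t = f1 t * σf t := ae_of_all _ e1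
  have e2' : ∀ᵐ t ∂ω, t ∈ Ioo a b → h2 t = f t * χf t - g t * ρf t := ae_of_all _ e2
  refine ⟨i1.congr' e1', i2.congr' e2', fun s hs t ht hst => ⟨?_, ?_⟩⟩
  · rw [← setInt_congr' e1' hs ht]; exact d1 s hs t ht hst
  · rw [← setInt_congr' e2' hs ht]; exact d2 s hs t ht hst

theorem LocInt.Ioo' {a b : ℝ} {ω : Measure ℝ} {h : ℝ → ℂ} (hh : LocInt a b ω h) {s t : ℝ}
    (hs : a < s) (ht : t < b) : IntegrableOn h (Ioo s t) ω := by
  rcases le_or_gt t s with hts | hst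
  · simp [Ioo_eq_empty (not_lt.2 hts)]
  · exact (hh s ⟨hs, hst.trans ht⟩ t ⟨hs.trans hst, ht⟩).mono_set Ioo_subset_Ico_self

theorem LocInt.sing {a b : ℝ} {ω : Measure ℝ} {h : ℝ → ℂ} (hh : LocInt a b ω h) {c : ℝ}
    (hc : c ∈ Ioo a b) : IntegrableOn h {c} ω := by
  obtain ⟨d, hd1, hd2⟩ := exists_between hc.2
  exact (hh c hc d ⟨hc.1.trans hd1, hd2⟩).mono_set (by simp [hd1])

theorem int_sing (ω : Measure ℝ) (h : ℝ → ℂ) (c : ℝ) :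
    ∫ t in {c}, h t ∂ω = ((ω {c}).toReal : ℂ) * h c := by
  rw [integral_singleton]; simp [Measure.real]

theorem indInt {ω : Measure ℝ} {h : ℝ → ℂ} {S T : Set ℝ} (hS : MeasurableSet S)
    (h0 : IntegrableOn h (T ∩ S) ω) : IntegrableOn (S.indicator h) T ω := by
  rw [IntegrableOn, integrable_indicator_iff hS, IntegrableOn, Measure.restrict_restrict hS,
    inter_comm]
  exact h0

theorem dom_right {a b : ℝ} {ω : Measure ℝ} {σf χf ρf : ℝ → ℂ}
    (hσ : LocInt a b ω σf) (hχ : LocInt a b ω χf) (hρ : LocInt a b ω ρf)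
    {c : ℝ} (hc : c ∈ Ioo a b) (k : ℂ) :
    ∃ f f1 : ℝ → ℂ, InDom a b ω σf χf ρf f f1 (fun t => k * ({c} : Set ℝ).indicator 1 t) ∧
      ∀ t ≤ c, f t = 0 := by
  obtain ⟨F, F1, hF⟩ := ivp_right ω c b σf χf (fun x hx => hσ.Ioo' hc.1 hx)
    (fun x hx => hχ.Ioo' hc.1 hx) (-(((ω {c}).toReal : ℂ) * (k * ρf c)))
  set h1 : ℝ → ℂ := (Ioi c).indicator (fun t => F1 t * σf t) with hh1
  set h3 : ℝ → ℂ := (Ioi c).indicator (fun t => F t * χf t) with hh3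
  set h4 : ℝ → ℂ := ({c} : Set ℝ).indicator (fun t => -(k * ρf t)) with hh4
  have i1 : ∀ x < b, IntegrableOn h1 (Iio x) ω := fun x hx =>
    indInt measurableSet_Ioi (by rw [Iio_inter_Ioi]; exact (hF x hx).1)
  have i3 : ∀ x < b, IntegrableOn h3 (Iio x) ω := fun x hx =>
    indInt measurableSet_Ioi (by rw [Iio_inter_Ioi]; exact (hF x hx).2.1)
  have iρ : IntegrableOn (fun t => -(k * ρf t)) {c} ω := ((hρ.sing hc).const_mul k).neg
  have i4 : ∀ x < b, IntegrableOn h4 (Iio x) ω := fun x hx =>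
    indInt (measurableSet_singleton c) (iρ.mono_set inter_subset_right)
  have i2 : ∀ x < b, IntegrableOn (fun t => h3 t + h4 t) (Iio x) ω := fun x hx =>
    (i3 x hx).add (i4 x hx)
  have loc : ∀ h : ℝ → ℂ, (∀ x < b, IntegrableOn h (Iio x) ω) → LocInt a b ω h :=
    fun h hi s hs t ht => (hi t ht.2).mono_set (fun u hu => hu.2)
  have dd : ∀ h : ℝ → ℂ, (∀ x < b, IntegrableOn h (Iio x) ω) → ∀ s ∈ Ioo a b, ∀ t ∈ Ioo a b,
      s ≤ t → ∫ u in Iio t, h u ∂ω = (∫ u in Iio s, h u ∂ω) + ∫ u in Ico s t, h u ∂ω := by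
    intro h hi s hs t ht hst
    rw [← setIntegral_union _ measurableSet_Ico (hi s hs.2) (loc h hi s hs t ht),
      Iio_union_Ico_eq_Iio hst]
    rw [Set.disjoint_left]
    intro u hu hu'
    exact absurd hu (not_lt.2 hu'.1)
  have v1 : ∀ x < b, ∫ u in Iio x, h1 u ∂ω = F x := by
    intro x hx
    rw [setIntegral_indicator measurableSet_Ioi, Iio_inter_Ioi, ← (hF x hx).2.2.1]
  have z1 : ∀ x ≤ c, ∫ u in Iio x, h1 u ∂ω = 0 := by
    intro x hx
    rw [setIntegral_indicator measurableSet_Ioi, Iio_inter_Ioi, Ioo_eq_empty (not_lt.2 hx)]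
    simp
  have v2 : ∀ x < b, c < x → ∫ u in Iio x, (h3 u + h4 u) ∂ω = F1 x := by
    intro x hx hcx
    rw [integral_add (i3 x hx) (i4 x hx), setIntegral_indicator measurableSet_Ioi, Iio_inter_Ioi,
      setIntegral_indicator (measurableSet_singleton c), inter_eq_right.2 (by simpa using hcx),
      int_sing, (hF x hx).2.2.2]
    ring
  have z2 : ∀ x ≤ c, ∫ u in Iio x, (h3 u + h4 u) ∂ω = 0 := by
    intro x hx
    have hxb := lt_of_le_of_lt hx hc.2
    have em : Iio x ∩ {c} = ∅ := by ext u; simp; rintro hu rfl; linarith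
    rw [integral_add (i3 x hxb) (i4 x hxb), setIntegral_indicator measurableSet_Ioi, Iio_inter_Ioi,
      setIntegral_indicator (measurableSet_singleton c), em, Ioo_eq_empty (not_lt.2 hx)]
    simp
  refine ⟨fun x => ∫ u in Iio x, h1 u ∂ω, fun x => ∫ u in Iio x, (h3 u + h4 u) ∂ω,
    InDom.mk' (loc _ i1) (loc _ i2) ?_ ?_ (dd _ i1) (dd _ i2), z1⟩
  · intro t ht
    rcases le_or_gt t c with h | h
    · rw [z2 t h, hh1, indicator_of_notMem (by simpa using h)]; simp
    · rw [v2 t ht.2 h, hh1, indicator_of_mem (by simpa using h)]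
  · intro t ht
    rcases lt_trichotomy t c with h | h | h
    · rw [z1 t h.le, hh3, hh4, indicator_of_notMem (by simpa using h.le),
        indicator_of_notMem (by simpa using h.ne), indicator_of_notMem (by simpa using h.ne)]; simp
    · subst h
      rw [z1 t le_rfl, hh3, hh4]; simp
    · rw [v1 t ht.2, hh3, hh4, indicator_of_mem (by simpa using h),
        indicator_of_notMem (by simpa using h.ne'), indicator_of_notMem (by simpa using h.ne')]; simp

theorem dom_left {a b : ℝ} {ω : Measure ℝ} {σf χf ρf : ℝ → ℂ}
    (hσ : LocInt a b ω σf) (hχ : LocInt a b ω χf) (hρ : LocInt a b ω ρf)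
    (hatoms : NoCommonAtoms a b ω σf χf ρf)
    {c : ℝ} (hc : c ∈ Ioo a b) (k : ℂ) :
    ∃ f f1 : ℝ → ℂ, InDom a b ω σf χf ρf f f1 (fun t => k * ({c} : Set ℝ).indicator 1 t) ∧
      ∀ t ≥ c, f t = 0 := by
  obtain ⟨F, F1, hF⟩ := ivp_left ω a c σf χf (fun x hx => hσ.Ioo' hx hc.2)
    (fun x hx => hχ.Ioo' hx hc.2) (((ω {c}).toReal : ℂ) * (k * ρf c))
  set h1 : ℝ → ℂ := (Iio c).indicator (fun t => F1 t * σf t) with hh1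
  set h3 : ℝ → ℂ := (Iio c).indicator (fun t => F t * χf t) with hh3
  set h4 : ℝ → ℂ := ({c} : Set ℝ).indicator (fun t => -(k * ρf t)) with hh4
  have toIco : ∀ h : ℝ → ℂ, (∀ x > a, IntegrableOn h (Ioo x c) ω) →
      ∀ x > a, IntegrableOn h (Ico x c) ω := by
    intro h hi x hx
    obtain ⟨d, hd1, hd2⟩ := exists_between hx
    exact (hi d hd1).mono_set fun u hu => ⟨lt_of_lt_of_le hd2 hu.1, hu.2⟩
  have j1 := toIco _ (fun x hx => (hF x hx).1)
  have j3 := toIco _ (fun x hx => (hF x hx).2.1)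
  have i1 : ∀ x > a, IntegrableOn h1 (Ici x) ω := fun x hx =>
    indInt measurableSet_Iio (by rw [Ici_inter_Iio]; exact j1 x hx)
  have i3 : ∀ x > a, IntegrableOn h3 (Ici x) ω := fun x hx =>
    indInt measurableSet_Iio (by rw [Ici_inter_Iio]; exact j3 x hx)
  have iρ : IntegrableOn (fun t => -(k * ρf t)) {c} ω := ((hρ.sing hc).const_mul k).neg
  have i4 : ∀ x > a, IntegrableOn h4 (Ici x) ω := fun x hx =>
    indInt (measurableSet_singleton c) (iρ.mono_set inter_subset_right)
  have i2 : ∀ x > a, IntegrableOn (fun t => h3 t + h4 t) (Ici x) ω := fun x hx =>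
    (i3 x hx).add (i4 x hx)
  have loc : ∀ h : ℝ → ℂ, (∀ x > a, IntegrableOn h (Ici x) ω) → LocInt a b ω h :=
    fun h hi s hs t ht => (hi s hs.1).mono_set (fun u hu => hu.1)
  have dd : ∀ h : ℝ → ℂ, (∀ x > a, IntegrableOn h (Ici x) ω) → ∀ s ∈ Ioo a b, ∀ t ∈ Ioo a b,
      s ≤ t → -∫ u in Ici t, h u ∂ω = (-∫ u in Ici s, h u ∂ω) + ∫ u in Ico s t, h u ∂ω := by
    intro h hi s hs t ht hst
    rw [← Ico_union_Ici_eq_Ici hst,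
      setIntegral_union _ measurableSet_Ici (loc h hi s hs t ht) (hi t ht.1)]
    · ring
    rw [Set.disjoint_left]
    intro u hu hu'
    exact absurd hu.2 (not_lt.2 hu')
  have split : ∀ h : ℝ → ℂ, (∀ x > a, IntegrableOn h (Ico x c) ω) → ∀ x > a, x < c →
      ∫ u in Ico x c, h u ∂ω = ((ω {x}).toReal : ℂ) * h x + ∫ u in Ioo x c, h u ∂ω := by
    intro h hi x hx hxc
    rw [← Ioo_insert_left hxc, Set.insert_eq, setIntegral_union (by simp) measurableSet_Ioo
      ((hi x hx).mono_set (by simpa using hxc)) ((hi x hx).mono_set Ioo_subset_Ico_self), int_sing]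
  have v1 : ∀ x > a, x < c → -∫ u in Ici x, h1 u ∂ω =
      F x - ((ω {x}).toReal : ℂ) * (F1 x * σf x) := by
    intro x hx hxc
    rw [setIntegral_indicator measurableSet_Iio, Ici_inter_Iio, split _ j1 x hx hxc,
      (hF x hx).2.2.1]
    ring
  have z1 : ∀ x ≥ c, -∫ u in Ici x, h1 u ∂ω = 0 := by
    intro x hx
    rw [setIntegral_indicator measurableSet_Iio, Ici_inter_Iio, Ico_eq_empty (not_lt.2 hx)]
    simp
  have v2 : ∀ x > a, x < c → -∫ u in Ici x, (h3 u + h4 u) ∂ω =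
      F1 x - ((ω {x}).toReal : ℂ) * (F x * χf x) := by
    intro x hx hxc
    rw [integral_add (i3 x hx) (i4 x hx), setIntegral_indicator measurableSet_Iio, Ici_inter_Iio,
      setIntegral_indicator (measurableSet_singleton c), inter_eq_right.2 (by simpa using hxc.le),
      int_sing, split _ j3 x hx hxc, (hF x hx).2.2.2]
    ring
  have c2 : -∫ u in Ici c, (h3 u + h4 u) ∂ω = ((ω {c}).toReal : ℂ) * (k * ρf c) := by
    rw [integral_add (i3 c hc.1) (i4 c hc.1), setIntegral_indicator measurableSet_Iio,
      Ici_inter_Iio, setIntegral_indicator (measurableSet_singleton c),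
      inter_eq_right.2 (by simp), int_sing]
    simp
  have z2 : ∀ x > c, -∫ u in Ici x, (h3 u + h4 u) ∂ω = 0 := by
    intro x hx
    have hxb := lt_trans hc.1 hx
    have em : Ici x ∩ {c} = ∅ := by ext u; simp; rintro hu rfl; linarith
    rw [integral_add (i3 x hxb) (i4 x hxb), setIntegral_indicator measurableSet_Iio, Ici_inter_Iio,
      setIntegral_indicator (measurableSet_singleton c), em, Ico_eq_empty (not_lt.2 hx.le)]
    simp
  have at1 : ∀ t ∈ Ioo a b, ((ω {t}).toReal : ℂ) * σf t * χf t = 0 := by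
    intro t ht
    have := (hatoms t ht).2
    simp only [mul_eq_zero] at this ⊢
    tauto
  have at2 : ∀ t ∈ Ioo a b, ((ω {t}).toReal : ℂ) * σf t * ρf t = 0 := by
    intro t ht
    have := (hatoms t ht).1
    simp only [mul_eq_zero] at this ⊢
    tauto
  refine ⟨fun x => -∫ u in Ici x, h1 u ∂ω, fun x => -∫ u in Ici x, (h3 u + h4 u) ∂ω,
    InDom.mk' (loc _ i1) (loc _ i2) ?_ ?_ (dd _ i1) (dd _ i2), z1⟩
  · intro t ht
    rcases lt_trichotomy t c with h | h | h
    · rw [v2 t ht.1 h, hh1, indicator_of_mem (by simpa using h)]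
      linear_combination F t * at1 t ht
    · subst h
      rw [c2, hh1, indicator_of_notMem (by simp)]
      linear_combination -k * at2 t ht
    · rw [z2 t h, hh1, indicator_of_notMem (by simpa using h.le)]; simp
  · intro t ht
    rcases lt_trichotomy t c with h | h | h
    · rw [v1 t ht.1 h, hh3, hh4, indicator_of_mem (by simpa using h),
        indicator_of_notMem (by simpa using h.ne), indicator_of_notMem (by simpa using h.ne)]
      linear_combination F1 t * at1 t ht
    · subst h
      rw [z1 t le_rfl, hh3, hh4]; simp
    · rw [z1 t h.le, hh3, hh4, indicator_of_notMem (by simpa using h.le),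
        indicator_of_notMem (by simpa using h.ne'), indicator_of_notMem (by simpa using h.ne')]; simp

/-- the weight vanishes almost everywhere on an open interval -/
def Nul (ω : Measure ℝ) (ρf : ℝ → ℂ) (s t : ℝ) : Prop := ∀ᵐ u ∂ω, u ∈ Ioo s t → ρf u = 0

theorem Nul.mono {ω : Measure ℝ} {ρf : ℝ → ℂ} {s t s' t' : ℝ} (h : Nul ω ρf s t)
    (hs : s ≤ s') (ht : t' ≤ t) : Nul ω ρf s' t' := by
  filter_upwards [h] with u hu hu'
  exact hu ⟨lt_of_le_of_lt hs hu'.1, lt_of_lt_of_le hu'.2 ht⟩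

theorem nul_of_gt {ω : Measure ℝ} {ρf : ℝ → ℂ} {s t : ℝ} (h : ∀ r > s, Nul ω ρf r t) :
    Nul ω ρf s t := by
  have : ∀ᵐ u ∂ω, ∀ r : ℚ, s < r → u ∈ Ioo (r:ℝ) t → ρf u = 0 := by
    rw [ae_all_iff]; intro r
    by_cases hr : s < r
    · filter_upwards [h r hr] with u hu _ using hu
    · simp [hr]
  filter_upwards [this] with u hu hu'
  obtain ⟨r, hr1, hr2⟩ := exists_rat_btwn hu'.1
  exact hu r hr1 ⟨hr2, hu'.2⟩

theorem nul_of_lt {ω : Measure ℝ} {ρf : ℝ → ℂ} {s t : ℝ} (h : ∀ r < t, Nul ω ρf s r) :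
    Nul ω ρf s t := by
  have : ∀ᵐ u ∂ω, ∀ r : ℚ, (r:ℝ) < t → u ∈ Ioo s (r:ℝ) → ρf u = 0 := by
    rw [ae_all_iff]; intro r
    by_cases hr : (r:ℝ) < t
    · filter_upwards [h r hr] with u hu _ using hu
    · simp [hr]
  filter_upwards [this] with u hu hu'
  obtain ⟨r, hr1, hr2⟩ := exists_rat_btwn hu'.2
  exact hu r hr2 ⟨hu'.1, hr1⟩

theorem supp_not_nul {a b : ℝ} {ω : Measure ℝ} {ρf : ℝ → ℂ} {x s t : ℝ}
    (hx : InSuppRho a b ω ρf x) (hs : s < x ∨ (s = x ∧ x ≤ a)) (ht : x < t ∨ (t = x ∧ b ≤ x)) :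
    ¬ Nul ω ρf s t := by
  intro h
  have h1 : ∃ e > 0, ∀ u, x - e < u → a < u → s < u := by
    rcases hs with hs | ⟨rfl, hs⟩
    · exact ⟨x - s, by linarith, fun u hu _ => by linarith⟩
    · exact ⟨1, one_pos, fun u _ hu => by linarith⟩
  have h2 : ∃ e > 0, ∀ u, u < x + e → u < b → u < t := by
    rcases ht with ht | ⟨rfl, ht⟩
    · exact ⟨t - x, by linarith, fun u hu _ => by linarith⟩
    · exact ⟨1, one_pos, fun u _ hu => by linarith⟩
  obtain ⟨e, he, h1⟩ := h1
  obtain ⟨d, hd, h2⟩ := h2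
  apply hx (min e d) (lt_min he hd)
  filter_upwards [h] with u hu hu'
  have := min_le_left e d
  have := min_le_right e d
  exact hu ⟨h1 u (by linarith [hu'.1.1]) hu'.2.1, h2 u (by linarith [hu'.1.2]) hu'.2.2⟩

theorem supp_cases {a b : ℝ} {ω : Measure ℝ} {ρf : ℝ → ℂ} {x : ℝ}
    (hx : InSuppRho a b ω ρf x) : (∀ s < x, ¬ Nul ω ρf s x) ∨ (∀ t > x, ¬ Nul ω ρf x t) ∨
      ¬ (∀ᵐ u ∂ω, u = x → ρf u = 0) := by
  by_contra! hcon
  obtain ⟨⟨s, hs, hs'⟩, ⟨t, ht, ht'⟩, h0⟩ := hcon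
  refine supp_not_nul hx (Or.inl hs) (Or.inl ht) ?_
  filter_upwards [hs', ht', h0] with u h1 h2 h3 hu
  rcases lt_trichotomy u x with h | h | h
  · exact h1 ⟨hu.1, h⟩
  · exact h3 h
  · exact h2 ⟨h, hu.2⟩

theorem nul_of_not_supp {a b : ℝ} {ω : Measure ℝ} {ρf : ℝ → ℂ}
    (hout : ∀ t, t ∉ Ioo a b → ρf t = 0) {x : ℝ}
    (hx : ¬ InSuppRho a b ω ρf x) : ∃ e > 0, Nul ω ρf (x - e) (x + e) := by
  unfold InSuppRho at hx
  push Not at hx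
  obtain ⟨e, he, h⟩ := hx
  refine ⟨e, he, ?_⟩
  filter_upwards [h] with u hu hu'
  by_cases hab : u ∈ Ioo a b
  · exact hu ⟨hu', hab⟩
  · exact hout u hab

theorem fwd {a b : ℝ} {ω : Measure ℝ} {σf χf ρf : ℝ → ℂ}
    (hσ : LocInt a b ω σf)
    (hsupp : SuppFull a b ω σf)
    (hatoms : NoCommonAtoms a b ω σf χf ρf)
    (hgapcond : GapCondition a b ω σf χf ρf)
    (hout : ∀ t, t ∉ Set.Ioo a b → ρf t = 0)
    {αϱ βϱ : ℝ} (hord : a ≤ αϱ ∧ αϱ < βϱ ∧ βϱ ≤ b)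
    (hαin : InSuppRho a b ω ρf αϱ) (hβin : InSuppRho a b ω ρf βϱ)
    {f f1 g : ℝ → ℂ} (hd : InDom a b ω σf χf ρf f f1 g)
    (hf : ∀ᵐ t ∂ω, t ∈ Set.Ioo a b → (ρf t = 0 ∨ f t = 0)) :
    ∀ᵐ t ∂ω, t ∈ Ioo αϱ βϱ → g t * ρf t = 0 := by
  obtain ⟨ha, hαβ, hb⟩ := hord
  have sub : ∀ x ∈ Ioo αϱ βϱ, x ∈ Ioo a b := fun x hx =>
    ⟨lt_of_le_of_lt ha hx.1, lt_of_lt_of_le hx.2 hb⟩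
  have left : ∀ x ∈ Ioo a b, Tendsto f (nhdsWithin x (Iio x)) (nhds (f x)) ∧
      Tendsto f1 (nhdsWithin x (Iio x)) (nhds (f1 x)) := by
    intro x hx
    obtain ⟨p, hp1, hp2⟩ := exists_between hx.1
    have hp : p ∈ Ioo a b := ⟨hp1, hp2.trans hx.2⟩
    have hs : ∀ s ∈ Ioo p x, s ∈ Ioo a b := fun s hs => ⟨hp1.trans hs.1, hs.2.trans hx.2⟩
    exact ⟨tendsto_left hp2 (hd.1 p hp x hx) fun s h => (hd.2.2 s (hs s h) x hx h.2.le).1,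
      tendsto_left hp2 (hd.2.1 p hp x hx) fun s h => (hd.2.2 s (hs s h) x hx h.2.le).2⟩
  have right : ∀ x ∈ Ioo a b, Tendsto f (nhdsWithin x (Ioi x))
      (nhds (f x + ((ω {x}).toReal : ℂ) * (f1 x * σf x))) := by
    intro x hx
    obtain ⟨p, hp1, hp2⟩ := exists_between hx.2
    have hp : p ∈ Ioo a b := ⟨hx.1.trans hp1, hp2⟩
    have hs : ∀ s ∈ Ioo x p, s ∈ Ioo a b := fun s hs => ⟨hx.1.trans hs.1, hs.2.trans hp2⟩
    exact tendsto_right hp1 (hd.1 x hx p hp) fun s h => (hd.2.2 x hx s (hs s h) h.1.le).1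
  have nulf : ∀ s t, (∀ u ∈ Ioo s t, f u ≠ 0) → Nul ω ρf s t := by
    intro s t h
    filter_upwards [hf] with u hu hu'
    by_cases hab : u ∈ Ioo a b
    · exact (hu hab).resolve_right (h u hu')
    · exact hout u hab
  have leftacc : ∀ x ∈ Ioo a b, (∀ s < x, ¬ Nul ω ρf s x) → f x = 0 := by
    intro x hx hacc
    by_contra hne
    have hev := (left x hx).1.eventually_ne hne
    obtain ⟨l, hl, hl'⟩ := (mem_nhdsLT_iff_exists_Ioo_subset).1 hev
    exact hacc l hl (nulf l x fun u hu => hl' hu)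
  have rightacc : ∀ x ∈ Ioo a b, (∀ t > x, ¬ Nul ω ρf x t) →
      f x + ((ω {x}).toReal : ℂ) * (f1 x * σf x) = 0 := by
    intro x hx hacc
    by_contra hne
    have hev := (right x hx).eventually_ne hne
    obtain ⟨l, hl, hl'⟩ := (mem_nhdsGT_iff_exists_Ioo_subset).1 hev
    exact hacc l hl (nulf x l fun u hu => hl' hu)
  have atom : ∀ x ∈ Ioo a b, ¬ (∀ᵐ u ∂ω, u = x → ρf u = 0) →
      f x = 0 ∧ ((ω {x}).toReal : ℂ) * (f1 x * σf x) = 0 := by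
    intro x hx hn
    have h1 : f x = 0 := by
      by_contra hne
      apply hn
      filter_upwards [hf] with u hu hux
      subst hux
      exact (hu hx).resolve_right hne
    have h2 : ρf x ≠ 0 := fun h => hn (ae_of_all _ fun u hu => hu ▸ h)
    refine ⟨h1, ?_⟩
    have := (hatoms x hx).1
    simp only [mul_eq_zero] at this ⊢
    tauto
  have gap : ∀ γ ∈ Ioo a b, ∀ δ ∈ Ioo a b, γ < δ → Nul ω ρf γ δ → InSuppRho a b ω ρf γ →
      InSuppRho a b ω ρf δ → ∀ x ∈ Ioc γ δ, f x = 0 := by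
    intro γ hγ δ hδ hγδ hn sγ sδ
    have e1 : f γ = 0 := by
      rcases supp_cases sγ with h | h | h
      · exact leftacc γ hγ h
      · exact absurd hn (h δ hγδ)
      · exact (atom γ hγ h).1
    have e2 : f δ + ((ω {δ}).toReal : ℂ) * (f1 δ * σf δ) = 0 := by
      rcases supp_cases sδ with h | h | h
      · exact absurd hn (h γ hγδ)
      · exact rightacc δ hδ h
      · rw [(atom δ hδ h).1, (atom δ hδ h).2, add_zero]
    have t1 := (left γ hγ).1
    have t2 := right δ hδ
    rw [e1] at t1
    rw [e2] at t2
    have hz := hgapcond γ hγ δ hδ hγδ hn sγ sδ f f1 g hd t1 t2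
    intro x hx
    rcases eq_or_lt_of_le hx.2 with rfl | hlt
    · refine tendsto_nhds_unique (left x hδ).1 (tendsto_const_nhds.congr' ?_)
      filter_upwards [Ioo_mem_nhdsLT hγδ] with u hu
      exact (hz u hu).symm
    · exact hz x ⟨hx.1, hlt⟩
  -- f vanishes on the hull of the support
  have f0 : ∀ x ∈ Ioo αϱ βϱ, f x = 0 := by
    intro x hx
    have hxab := sub x hx
    by_cases hacc : ∀ s < x, ¬ Nul ω ρf s x
    · exact leftacc x hxab hacc
    push Not at hacc
    obtain ⟨s0, hs0, hs0'⟩ := hacc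
    set A : Set ℝ := {s | s < x ∧ Nul ω ρf s x} with hA
    have hAlow : ∀ s ∈ A, αϱ ≤ s := by
      intro s hs
      by_contra hlt
      exact supp_not_nul hαin (Or.inl (not_le.1 hlt)) (Or.inl hx.1) hs.2
    have hAne : A.Nonempty := ⟨s0, hs0, hs0'⟩
    have hAbdd : BddBelow A := ⟨αϱ, hAlow⟩
    set γ := sInf A with hγ
    have hγx : γ < x := lt_of_le_of_lt (csInf_le hAbdd ⟨hs0, hs0'⟩) hs0
    have hαγ : αϱ ≤ γ := le_csInf hAne hAlow
    have nγ : Nul ω ρf γ x := by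
      apply nul_of_gt
      intro r hr
      obtain ⟨s, hs, hsr⟩ := exists_lt_of_csInf_lt hAne hr
      exact hs.2.mono hsr.le le_rfl
    have sγ : InSuppRho a b ω ρf γ := by
      by_contra hns
      obtain ⟨e, he, hne⟩ := nul_of_not_supp hout hns
      have : γ - e ∈ A := by
        refine ⟨by linarith, ?_⟩
        filter_upwards [hne, nγ] with u h1 h2 hu
        rcases lt_or_ge u (γ + e) with h | h
        · exact h1 ⟨hu.1, h⟩
        · exact h2 ⟨by linarith, hu.2⟩
      have := csInf_le hAbdd this
      linarith
    have haγ : a < γ := by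
      rcases lt_or_eq_of_le (ha.trans hαγ) with h | h
      · exact h
      · exact absurd nγ (supp_not_nul sγ (Or.inr ⟨rfl, h.symm.le⟩) (Or.inl hγx))
    set B : Set ℝ := {t | γ < t ∧ Nul ω ρf γ t} with hB
    have hBup : ∀ t ∈ B, t ≤ βϱ := by
      intro t ht
      by_contra hlt
      exact supp_not_nul hβin (Or.inl (hγx.trans hx.2)) (Or.inl (not_le.1 hlt)) ht.2
    have hxB : x ∈ B := ⟨hγx, nγ⟩
    have hBbdd : BddAbove B := ⟨βϱ, hBup⟩
    set δ := sSup B with hδ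
    have hxδ : x ≤ δ := le_csSup hBbdd hxB
    have hδβ : δ ≤ βϱ := csSup_le ⟨x, hxB⟩ hBup
    have hγδ : γ < δ := lt_of_lt_of_le hγx hxδ
    have nδ : Nul ω ρf γ δ := by
      apply nul_of_lt
      intro r hr
      obtain ⟨t, ht, hrt⟩ := exists_lt_of_lt_csSup ⟨x, hxB⟩ hr
      exact ht.2.mono le_rfl hrt.le
    have sδ : InSuppRho a b ω ρf δ := by
      by_contra hns
      obtain ⟨e, he, hne⟩ := nul_of_not_supp hout hns
      have : δ + e ∈ B := by
        refine ⟨by linarith, ?_⟩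
        filter_upwards [hne, nδ] with u h1 h2 hu
        rcases lt_or_ge (δ - e) u with h | h
        · exact h1 ⟨h, hu.2⟩
        · exact h2 ⟨hu.1, by linarith⟩
      have := le_csSup hBbdd this
      linarith
    have hδb : δ < b := by
      rcases lt_or_eq_of_le (hδβ.trans hb) with h | h
      · exact h
      · exact absurd nδ (supp_not_nul sδ (Or.inl hγδ) (Or.inr ⟨rfl, h.symm.le⟩))
    exact gap γ ⟨haγ, hγδ.trans hδb⟩ δ ⟨haγ.trans hγδ, hδb⟩ hγδ nδ sγ sδ x ⟨hγx, hxδ⟩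
  have z1 : ∀ᵐ t ∂ω, t ∈ Ioo αϱ βϱ → f1 t * σf t = 0 := by
    apply ae_zero_Ioo (fun s hs t ht => hd.1 s (sub s hs) t (sub t ht))
    intro s hs t ht hst
    have := (hd.2.2 s (sub s hs) t (sub t ht) hst).1
    rw [f0 s hs, f0 t ht, zero_add] at this
    exact this.symm
  have f10 : ∀ x ∈ Ioo αϱ βϱ, f1 x = 0 := by
    intro x hx
    by_contra hne
    have hev := (left x (sub x hx)).2.eventually_ne hne
    have hev2 : ∀ᶠ u in nhdsWithin x (Iio x), u ∈ Ioo αϱ x := Ioo_mem_nhdsLT hx.1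
    obtain ⟨l, hl, hl'⟩ := (mem_nhdsLT_iff_exists_Ioo_subset).1 (hev.and hev2)
    obtain ⟨m, hm1, hm2⟩ := exists_between (show l < x from hl)
    have hm : m ∈ Ioo αϱ βϱ := ⟨(hl' ⟨hm1, hm2⟩).2.1, hm2.trans hx.2⟩
    apply hsupp m (sub m hm) x (sub x hx) hm2
    apply integral_eq_zero_of_ae
    filter_upwards [ae_restrict_mem measurableSet_Ico, ae_restrict_of_ae z1] with u hu hz
    have hu' := hl' (show u ∈ Ioo l x from ⟨lt_of_lt_of_le hm1 hu.1, hu.2⟩)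
    have := hz ⟨hu'.2.1, hu.2.trans hx.2⟩
    simpa using (mul_eq_zero.1 this).resolve_left hu'.1
  have z2 : ∀ᵐ t ∂ω, t ∈ Ioo αϱ βϱ → f t * χf t - g t * ρf t = 0 := by
    apply ae_zero_Ioo (fun s hs t ht => hd.2.1 s (sub s hs) t (sub t ht))
    intro s hs t ht hst
    have := (hd.2.2 s (sub s hs) t (sub t ht) hst).2
    rw [f10 s hs, f10 t ht, zero_add] at this
    exact this.symm
  filter_upwards [z2] with t ht htm
  have := ht htm
  rw [f0 t htm] at this
  simpa using this

theorem inDom_zero {a b : ℝ} {ω : Measure ℝ} {σf χf ρf : ℝ → ℂ} :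
    InDom a b ω σf χf ρf (fun _ => 0) (fun _ => 0) (fun _ => 0) := by
  refine ⟨?_, ?_, ?_⟩
  · intro s _ t _; simp
  · intro s _ t _; simp
  · intro s _ t _ _; simp

/-- Under the full Hypothesis, the multi-valued part of
`T_loc = {(f, τ f) : f ∈ 𝔇_τ}` (as a relation in `L¹_loc((a,b);ϱ)`, i.e. modulo
`ϱ`-null functions) is the span of the indicators of `{αϱ}` and `{βϱ}`, where
`αϱ = inf supp ϱ`, `βϱ = sup supp ϱ`; in particular `T_loc` is an operator iff
`ϱ` has no mass at `αϱ` nor at `βϱ`. -/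
theorem stmt11 (a b : ℝ) (hab : a < b) (ω : Measure ℝ) (σf χf ρf : ℝ → ℂ)
    (hσ : LocInt a b ω σf) (hχ : LocInt a b ω χf) (hρ : LocInt a b ω ρf)
    (hreal : RealCoeffs σf χf ρf)
    (hsupp : SuppFull a b ω σf)
    (hatoms : NoCommonAtoms a b ω σf χf ρf)
    (hgapcond : GapCondition a b ω σf χf ρf)
    (htwo : SuppRhoTwoPoints a b ω ρf)
    (hout : ∀ t, t ∉ Set.Ioo a b → σf t = 0 ∧ χf t = 0 ∧ ρf t = 0)
    (αϱ βϱ : ℝ) (hord : a ≤ αϱ ∧ αϱ < βϱ ∧ βϱ ≤ b)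
    (hnulla : ∀ᵐ t ∂ω, t ∈ Set.Ioo a αϱ → ρf t = 0)
    (hnullb : ∀ᵐ t ∂ω, t ∈ Set.Ioo βϱ b → ρf t = 0)
    (hαin : InSuppRho a b ω ρf αϱ) (hβin : InSuppRho a b ω ρf βϱ) :
    (∀ g : ℝ → ℂ, LocInt a b ω (fun t => g t * ρf t) →
      ((∃ f f1 : ℝ → ℂ, InDom a b ω σf χf ρf f f1 g ∧
          (∀ᵐ t ∂ω, t ∈ Set.Ioo a b → (ρf t = 0 ∨ f t = 0))) ↔
        (∃ ca cb : ℂ, ∀ᵐ t ∂ω, t ∈ Set.Ioo a b →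
          (ρf t = 0 ∨ g t = ca * ({αϱ} : Set ℝ).indicator 1 t +
            cb * ({βϱ} : Set ℝ).indicator 1 t)))) ∧
    ((∀ g f f1 : ℝ → ℂ, LocInt a b ω (fun t => g t * ρf t) →
        InDom a b ω σf χf ρf f f1 g →
        (∀ᵐ t ∂ω, t ∈ Set.Ioo a b → (ρf t = 0 ∨ f t = 0)) →
        (∀ᵐ t ∂ω, t ∈ Set.Ioo a b → (ρf t = 0 ∨ g t = 0))) ↔
      ((ω {αϱ}).toReal * (ρf αϱ).re = 0 ∧ (ω {βϱ}).toReal * (ρf βϱ).re = 0)) := by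
  obtain ⟨ha, hαβ, hb⟩ := hord
  have houtρ : ∀ t, t ∉ Set.Ioo a b → ρf t = 0 := fun t ht => (hout t ht).2.2
  have exL : ∀ k : ℂ, ∃ f f1 : ℝ → ℂ,
      InDom a b ω σf χf ρf f f1 (fun t => k * ({αϱ} : Set ℝ).indicator 1 t) ∧
      ∀ t ∈ Ioo a b, αϱ ≤ t → f t = 0 := by
    intro k
    by_cases hc : αϱ ∈ Ioo a b
    · obtain ⟨f, f1, h1, h2⟩ := dom_left hσ hχ hρ hatoms hc k
      exact ⟨f, f1, h1, fun t _ ht => h2 t ht⟩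
    · refine ⟨_, _, inDom_zero.congr_g (ae_of_all _ fun t ht => ?_), fun t _ _ => rfl⟩
      rw [indicator_of_notMem]
      · simp
      · rintro rfl; exact hc ht
  have exR : ∀ k : ℂ, ∃ f f1 : ℝ → ℂ,
      InDom a b ω σf χf ρf f f1 (fun t => k * ({βϱ} : Set ℝ).indicator 1 t) ∧
      ∀ t ∈ Ioo a b, t ≤ βϱ → f t = 0 := by
    intro k
    by_cases hc : βϱ ∈ Ioo a b
    · obtain ⟨f, f1, h1, h2⟩ := dom_right hσ hχ hρ hc k
      exact ⟨f, f1, h1, fun t _ ht => h2 t ht⟩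
    · refine ⟨_, _, inDom_zero.congr_g (ae_of_all _ fun t ht => ?_), fun t _ _ => rfl⟩
      rw [indicator_of_notMem]
      · simp
      · rintro rfl; exact hc ht
  have part1 : ∀ g : ℝ → ℂ,
      ((∃ f f1 : ℝ → ℂ, InDom a b ω σf χf ρf f f1 g ∧
          (∀ᵐ t ∂ω, t ∈ Set.Ioo a b → (ρf t = 0 ∨ f t = 0))) ↔
        (∃ ca cb : ℂ, ∀ᵐ t ∂ω, t ∈ Set.Ioo a b →
          (ρf t = 0 ∨ g t = ca * ({αϱ} : Set ℝ).indicator 1 t +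
            cb * ({βϱ} : Set ℝ).indicator 1 t))) := by
    intro g
    constructor
    · rintro ⟨f, f1, hd, hf⟩
      refine ⟨g αϱ, g βϱ, ?_⟩
      filter_upwards [fwd hσ hsupp hatoms hgapcond houtρ ⟨ha, hαβ, hb⟩ hαin hβin hd hf,
        hnulla, hnullb] with t h1 h2 h3 ht
      rcases lt_trichotomy t αϱ with h | h | h
      · exact Or.inl (h2 ⟨ht.1, h⟩)
      · right; subst h; simp [hαβ.ne]
      rcases lt_trichotomy t βϱ with h' | h' | h'
      · rcases mul_eq_zero.1 (h1 ⟨h, h'⟩) with h0 | h0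
        · right; simp [h0, h.ne', h'.ne]
        · exact Or.inl h0
      · right; subst h'; simp [hαβ.ne']
      · exact Or.inl (h3 ⟨h', ht.2⟩)
    · rintro ⟨ca, cb, hg⟩
      obtain ⟨f, f1, hd, hz⟩ := exL ca
      obtain ⟨k, k1, hd', hz'⟩ := exR cb
      refine ⟨_, _, (hd.add' hd').congr_g ?_, ?_⟩
      · filter_upwards [hg] with t h ht
        rcases h ht with h0 | h0
        · simp [h0]
        · rw [h0]
      · filter_upwards [hnulla, hnullb] with t h2 h3 ht
        rcases lt_or_ge t αϱ with h | h
        · exact Or.inl (h2 ⟨ht.1, h⟩)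
        rcases le_or_gt t βϱ with h' | h'
        · right; simp [hz t ht h, hz' t ht h']
        · exact Or.inl (h3 ⟨h', ht.2⟩)
  refine ⟨fun g _ => part1 g, ?_⟩
  -- atoms of the weight
  have hatom : ∀ c : ℝ, (ω {c}).toReal * (ρf c).re = 0 ↔ ∀ᵐ t ∂ω, t = c → ρf t = 0 := by
    intro c
    constructor
    · intro h
      have h0 : ρf c = 0 ∨ ω {c} = 0 := by
        rcases mul_eq_zero.1 h with h | h
        · rcases (ENNReal.toReal_eq_zero_iff _).1 h with h | h
          · exact Or.inr h
          · left
            by_cases hc : c ∈ Ioo a b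
            · have := hρ.sing hc
              rw [integrableOn_singleton_iff] at this
              rcases this with h' | h'
              · simpa using h'
              · exact absurd h h'.ne
            · exact houtρ c hc
        · left
          exact Complex.ext h (hreal.2.2 c).1
      rcases h0 with h0 | h0
      · exact ae_of_all _ fun t ht => ht ▸ h0
      · have : ∀ᵐ t ∂ω, t ∉ ({c} : Set ℝ) := measure_eq_zero_iff_ae_notMem.1 h0
        filter_upwards [this] with t ht htc
        exact absurd htc ht
    · intro h
      by_cases h0 : ρf c = 0
      · simp [h0]
      · have : ω {c} = 0 := by
          rw [measure_eq_zero_iff_ae_notMem]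
          filter_upwards [h] with t ht htc
          rw [mem_singleton_iff] at htc
          exact h0 (htc ▸ ht htc)
        simp [this]
  rw [hatom, hatom]
  constructor
  · intro H
    have key : ∀ ca cb : ℂ, ∀ᵐ t ∂ω, t ∈ Set.Ioo a b → (ρf t = 0 ∨
        ca * ({αϱ} : Set ℝ).indicator 1 t + cb * ({βϱ} : Set ℝ).indicator 1 t = 0) := by
      intro ca cb
      obtain ⟨f, f1, hd, hf⟩ := (part1 (fun t => ca * ({αϱ} : Set ℝ).indicator 1 t +
        cb * ({βϱ} : Set ℝ).indicator 1 t)).2 ⟨ca, cb, ae_of_all _ fun t _ => Or.inr rfl⟩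
      refine H _ f f1 ?_ hd hf
      have e : (fun t => (ca * ({αϱ} : Set ℝ).indicator 1 t +
          cb * ({βϱ} : Set ℝ).indicator 1 t) * ρf t) = fun t =>
          ({αϱ} : Set ℝ).indicator (fun t => ca * ρf t) t +
          ({βϱ} : Set ℝ).indicator (fun t => cb * ρf t) t := by
        ext t
        simp only [indicator]
        split_ifs <;> simp <;> ring
      rw [e]
      intro s hs t ht
      exact (((hρ s hs t ht).const_mul ca).indicator (measurableSet_singleton _)).add
        (((hρ s hs t ht).const_mul cb).indicator (measurableSet_singleton _))
    constructor
    · filter_upwards [key 1 0] with t ht htc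
      by_cases hab : t ∈ Ioo a b
      · rcases ht hab with h | h
        · exact h
        · subst htc; simp at h
      · exact houtρ t hab
    · filter_upwards [key 0 1] with t ht htc
      by_cases hab : t ∈ Ioo a b
      · rcases ht hab with h | h
        · exact h
        · subst htc; simp at h
      · exact houtρ t hab
  · rintro ⟨h1, h2⟩ g f f1 _ hd hf
    obtain ⟨ca, cb, hg⟩ := (part1 g).1 ⟨f, f1, hd, hf⟩
    filter_upwards [hg, h1, h2] with t hg h1 h2 ht
    by_cases e1 : t = αϱ
    · exact Or.inl (h1 e1)
    by_cases e2 : t = βϱ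
    · exact Or.inl (h2 e2)
    rcases hg ht with h | h
    · exact Or.inl h
    · right; rw [h]; simp [e1, e2]
end

section
/- (Weyl's alternative, key lemma) If there exists $z_0 \in \mathbb{C}$ such that all solutions of $(\tau - z_0)u = 0$ lie in $L^2((a,b);\varrho)$ near $a$ (i.e., are square integrable over $(a,c)$ for each $c$), then for every $z \in \mathbb{C}$ all solutions of $(\tau - z)u = 0$ lie in $L^2((a,b);\varrho)$ near $a$. -/
open MeasureTheory Set Filter

/-- `u` lies in `L²((a,b);ϱ)` near the endpoint `a`. -/
def L2NearA (a b : ℝ) (ω : Measure ℝ) (ρf : ℝ → ℂ) (u : ℝ → ℂ) : Prop :=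
  ∀ c ∈ Set.Ioo a b,
    MeasureTheory.IntegrableOn (fun t => ‖u t‖ ^ 2 * (ρf t).re) (Set.Ioo a c) ω


section Helpers

open scoped ENNReal

lemma setInt_restrict_aux {E : Type*} [NormedAddCommGroup E] [NormedSpace ℝ E]
    {ν : Measure ℝ} {G : ℝ → E} (hG : Integrable G ν) {T : Set ℝ} (hT : MeasurableSet T)
    (hsub : hG.aefinStronglyMeasurable.sigmaFiniteSet ⊆ T) {s : Set ℝ} (hs : MeasurableSet s) :
    ∫ t in s, G t ∂ν = ∫ t in s, G t ∂(ν.restrict T) := by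
  rw [Measure.restrict_restrict hs]
  have hz := hG.aefinStronglyMeasurable.ae_eq_zero_compl
  have hz' := (ae_restrict_iff' hG.aefinStronglyMeasurable.measurableSet.compl).1 hz
  refine setIntegral_eq_of_subset_of_ae_sdiff_eq_zero hs.nullMeasurableSet inter_subset_left ?_
  filter_upwards [hz'] with t ht h
  exact ht (fun h' => h.2 ⟨h.1, hsub h'⟩)

lemma param_meas {E : Type*} [NormedAddCommGroup E] [NormedSpace ℝ E]
    {ν : Measure ℝ} {G : ℝ → E} (hG : Integrable G ν) (r : ℝ → ℝ → Prop)
    (hr : MeasurableSet {p : ℝ × ℝ | r p.1 p.2}) :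
    StronglyMeasurable (fun y => ∫ t in {t | r t y}, G t ∂ν) := by
  have hm : ∀ y, MeasurableSet {t | r t y} := fun y =>
    (measurable_id.prodMk measurable_const : Measurable (fun t : ℝ => (t, y))) hr
  set T := hG.aefinStronglyMeasurable.sigmaFiniteSet
  have hTm : MeasurableSet T := hG.aefinStronglyMeasurable.measurableSet
  have : SigmaFinite (ν.restrict T) := hG.aefinStronglyMeasurable.sigmaFinite_restrict
  have hG' : AEStronglyMeasurable G (ν.restrict T) := hG.1.mono_measure Measure.restrict_le_self
  have key : (fun y => ∫ t in {t | r t y}, G t ∂ν) =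
      fun y => ∫ t, {p : ℝ × ℝ | r p.2 p.1}.indicator (fun p => hG'.mk G p.2) (y, t)
        ∂(ν.restrict T) := by
    funext y
    rw [setInt_restrict_aux hG hTm subset_rfl (hm y), ← integral_indicator (hm y)]
    refine integral_congr_ae ?_
    filter_upwards [hG'.ae_eq_mk] with t ht
    by_cases h : r t y
    · simp [indicator, h, ht]
    · simp [indicator, h]
  rw [key]
  refine StronglyMeasurable.integral_prod_right
    (f := fun y t => {p : ℝ × ℝ | r p.2 p.1}.indicator (fun p => hG'.mk G p.2) (y, t)) ?_
  have : MeasurableSet {p : ℝ × ℝ | r p.2 p.1} := measurable_swap hr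
  exact (hG'.stronglyMeasurable_mk.comp_measurable measurable_snd).indicator this

/-- iterated integrals -/
noncomputable def Jit (μ : Measure ℝ) (r : ℝ → ℝ → Prop) : ℕ → ℝ → ℝ≥0∞
  | 0 => fun _ => 1
  | n + 1 => fun x => ∫⁻ t in {t | r t x}, Jit μ r n t ∂μ

lemma Jit_meas (μ : Measure ℝ) [IsFiniteMeasure μ] (r : ℝ → ℝ → Prop)
    (hr : MeasurableSet {p : ℝ × ℝ | r p.1 p.2}) (n : ℕ) : Measurable (Jit μ r n) := by
  have hm : ∀ y, MeasurableSet {t | r t y} := fun y =>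
    (measurable_id.prodMk measurable_const : Measurable (fun t : ℝ => (t, y))) hr
  have hr' : MeasurableSet {p : ℝ × ℝ | r p.2 p.1} := measurable_swap hr
  induction n with
  | zero => exact measurable_const
  | succ n ih =>
    have : Jit μ r (n+1) = fun x => ∫⁻ t,
        {p : ℝ × ℝ | r p.2 p.1}.indicator (fun p => Jit μ r n p.2) (x, t) ∂μ := by
      funext x
      simp only [Jit]
      rw [← lintegral_indicator (hm x)]
      rfl
    rw [this]
    exact Measurable.lintegral_prod_right' ((ih.comp measurable_snd).indicator hr')

lemma Jit_succ_le (μ : Measure ℝ) [IsFiniteMeasure μ] (r : ℝ → ℝ → Prop)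
    (hr : MeasurableSet {p : ℝ × ℝ | r p.1 p.2})
    (htr : ∀ s t x, r s t → r t x → r s x) (has : ∀ s t, r s t → ¬ r t s) (n : ℕ) :
    ∀ x, (n + 1 : ℕ) * Jit μ r (n + 1) x ≤ μ {t | r t x} * Jit μ r n x := by
  have hm : ∀ y, MeasurableSet {t | r t y} := fun y =>
    (measurable_id.prodMk measurable_const : Measurable (fun t : ℝ => (t, y))) hr
  have hm' : ∀ y, MeasurableSet {t | r y t} := fun y =>
    (measurable_const.prodMk measurable_id : Measurable (fun t : ℝ => (y, t))) hr
  have hJ := Jit_meas μ r hr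
  induction n with
  | zero => intro x; simp [Jit]
  | succ n ih =>
    intro x
    -- the Tonelli swap
    have swap : ∫⁻ t in {t | r t x}, μ {s | r t s ∧ r s x} * Jit μ r n t ∂μ
        = Jit μ r (n + 2) x := by
      have e1 : Jit μ r (n + 2) x = ∫⁻ s in {s | r s x}, ∫⁻ t in {t | r t x},
          {p : ℝ × ℝ | r p.1 p.2}.indicator (fun p => Jit μ r n p.1) (t, s) ∂μ ∂μ := by
        rw [Jit]
        refine setLIntegral_congr_fun (hm x) ?_
        intro s hs
        simp only [Jit]
        have : ∀ t, {p : ℝ × ℝ | r p.1 p.2}.indicator (fun p => Jit μ r n p.1) (t, s)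
          = {t | r t s}.indicator (Jit μ r n) t := fun t => rfl
        simp only [this]
        rw [lintegral_indicator (hm s), Measure.restrict_restrict (hm s)]
        congr 2
        ext t
        simp only [mem_ofPred_eq, mem_inter_iff]
        exact ⟨fun h => ⟨h, htr _ _ _ h hs⟩, fun h => h.1⟩
      rw [e1, lintegral_lintegral_swap]
      · refine setLIntegral_congr_fun (hm x) ?_
        intro t ht
        have : ∀ s, {p : ℝ × ℝ | r p.1 p.2}.indicator (fun p => Jit μ r n p.1) (t, s)
          = {s | r t s}.indicator (fun _ => Jit μ r n t) s := fun t => rfl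
        simp only [this]
        rw [lintegral_indicator (hm' t), Measure.restrict_restrict (hm' t)]
        simp only [lintegral_const, MeasurableSet.univ, Measure.restrict_apply, univ_inter]
        rw [mul_comm]; rfl
      · refine Measurable.aemeasurable ?_
        have hsw : MeasurableSet {p : ℝ × ℝ | r p.2 p.1} := measurable_swap hr
        exact ((hJ n).comp measurable_snd).indicator hsw
    have e2 : μ {t | r t x} * Jit μ r (n + 1) x
        = ∫⁻ t in {t | r t x}, μ {t | r t x} * Jit μ r n t ∂μ := by
      rw [lintegral_const_mul _ (hJ n)]; rfl
    have e3 : ∫⁻ t in {t | r t x}, ((n + 1 : ℕ) * Jit μ r (n + 1) t +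
        μ {s | r t s ∧ r s x} * Jit μ r n t) ∂μ ≤
        ∫⁻ t in {t | r t x}, μ {t | r t x} * Jit μ r n t ∂μ := by
      refine setLIntegral_mono ((hJ n).const_mul _) ?_
      intro t ht
      refine (add_le_add_left (ih t) _).trans ?_
      rw [← add_mul]
      gcongr
      rw [← measure_union]
      · refine measure_mono ?_
        rintro s (hs | hs)
        · exact htr _ _ _ hs ht
        · exact hs.2
      · rw [Set.disjoint_left]
        intro s hs hs'
        exact has _ _ hs hs'.1
      · exact (hm' t).inter (hm x)
    rw [lintegral_add_left ((hJ (n+1)).const_mul _), swap, lintegral_const_mul _ (hJ (n+1))] at e3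
    rw [e2]
    refine le_trans (le_of_eq ?_) e3
    have : ∫⁻ t in {t | r t x}, Jit μ r (n+1) t ∂μ = Jit μ r (n+2) x := rfl
    rw [this]
    push_cast
    ring

lemma Jit_le (μ : Measure ℝ) [IsFiniteMeasure μ] (r : ℝ → ℝ → Prop)
    (hr : MeasurableSet {p : ℝ × ℝ | r p.1 p.2})
    (htr : ∀ s t x, r s t → r t x → r s x) (has : ∀ s t, r s t → ¬ r t s) (n : ℕ) (x : ℝ) :
    Jit μ r n x ≤ ENNReal.ofReal ((μ.real univ) ^ n / n.factorial) := by
  have h1 : ∀ n, (n.factorial : ℝ≥0∞) * Jit μ r n x ≤ (μ univ) ^ n := by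
    intro n
    induction n with
    | zero => simp [Jit]
    | succ n ih =>
      calc ((n+1).factorial : ℝ≥0∞) * Jit μ r (n+1) x
          = n.factorial * ((n + 1 : ℕ) * Jit μ r (n+1) x) := by
            rw [Nat.factorial_succ]; push_cast; ring
        _ ≤ n.factorial * (μ {t | r t x} * Jit μ r n x) := by
            exact mul_le_mul' le_rfl (Jit_succ_le μ r hr htr has n x)
        _ ≤ n.factorial * (μ univ * Jit μ r n x) := by
            gcongr; exact subset_univ _
        _ = μ univ * (n.factorial * Jit μ r n x) := by ring
        _ ≤ μ univ * (μ univ) ^ n := by gcongr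
        _ = _ := by ring
  rw [ENNReal.ofReal_div_of_pos (by positivity), ENNReal.ofReal_pow (by positivity),
    ENNReal.le_div_iff_mul_le (by simp [Nat.factorial_ne_zero]) (by simp), mul_comm]
  simpa [Measure.real] using h1 n

/-- Picard iterates -/
noncomputable def Vit {E : Type*} [NormedAddCommGroup E] [NormedSpace ℝ E] (ω : Measure ℝ)
    (r : ℝ → ℝ → Prop) (A : ℝ → E →L[ℝ] E) (s : ℝ → ℝ) (w0 : E) : ℕ → ℝ → E
  | 0 => fun _ => w0
  | n + 1 => fun x => s x • ∫ t in {t | r t x}, A t (Vit ω r A s w0 n t) ∂ω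

lemma Vit_main {E : Type*} [NormedAddCommGroup E] [NormedSpace ℝ E] (ω : Measure ℝ)
    (r : ℝ → ℝ → Prop) (hr : MeasurableSet {p : ℝ × ℝ | r p.1 p.2})
    (htr : ∀ s t x, r s t → r t x → r s x) (has : ∀ s t, r s t → ¬ r t s)
    (A : ℝ → E →L[ℝ] E) (s : ℝ → ℝ) (hs : Measurable s) (hs1 : ∀ x, |s x| ≤ 1) (w0 : E)
    (x0 : ℝ) (hA : IntegrableOn A {t | r t x0} ω) :
    ∃ M : ℝ, 0 ≤ M ∧ ∀ n,
      AEStronglyMeasurable (Vit ω r A s w0 n) (ω.restrict {t | r t x0}) ∧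
      IntegrableOn (fun t => A t (Vit ω r A s w0 n t)) {t | r t x0} ω ∧
      ∫ t in {t | r t x0}, ‖A t (Vit ω r A s w0 n t)‖ ∂ω ≤
        ‖w0‖ * (M ^ (n + 1) / (n + 1).factorial) ∧
      ∀ x, (x = x0 ∨ r x x0) → ‖Vit ω r A s w0 n x‖ ≤ ‖w0‖ * (M ^ n / n.factorial) := by
  have hm : ∀ y, MeasurableSet {t | r t y} := fun y =>
    (measurable_id.prodMk measurable_const : Measurable (fun t : ℝ => (t, y))) hr
  set ν := ω.restrict {t | r t x0} with hν
  have hAm : AEMeasurable (fun t => ‖A t‖ₑ) ν := hA.1.enorm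
  set μ := ν.withDensity (fun t => ‖A t‖ₑ) with hμ
  have : IsFiniteMeasure μ := isFiniteMeasure_withDensity hA.2.ne
  have hJ := Jit_meas μ r hr
  have hJle := Jit_le μ r hr htr has
  have hsub : ∀ x, (x = x0 ∨ r x x0) → {t | r t x} ⊆ {t | r t x0} := by
    rintro x (rfl | hx)
    · exact subset_rfl
    · intro t ht; exact htr _ _ _ ht hx
  have hνr : ∀ x, (x = x0 ∨ r x x0) → ν.restrict {t | r t x} = ω.restrict {t | r t x} := by
    intro x hx
    rw [hν, Measure.restrict_restrict (hm x), inter_eq_self_of_subset_left (hsub x hx)]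
  -- lintegral bound
  have hlin : ∀ n, (∀ x, (x = x0 ∨ r x x0) → ‖Vit ω r A s w0 n x‖ₑ ≤ ‖w0‖ₑ * Jit μ r n x) →
      ∀ x, (x = x0 ∨ r x x0) →
      ∫⁻ t in {t | r t x}, ‖A t (Vit ω r A s w0 n t)‖ₑ ∂ω ≤ ‖w0‖ₑ * Jit μ r (n + 1) x := by
    intro n hn x hx
    have e : Jit μ r (n + 1) x = ∫⁻ t in {t | r t x}, ‖A t‖ₑ * Jit μ r n t ∂ω := by
      simp only [Jit]
      rw [hμ, restrict_withDensity (hm x),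
        lintegral_withDensity_eq_lintegral_mul₀ (hAm.mono_measure Measure.restrict_le_self)
          (hJ n).aemeasurable, hνr x hx]
      rfl
    rw [e, ← lintegral_const_mul' _ _ (by simp)]
    refine setLIntegral_mono' (hm x) ?_
    intro t ht
    have ht' : r t x0 := hsub x hx ht
    calc ‖A t (Vit ω r A s w0 n t)‖ₑ ≤ ‖A t‖ₑ * ‖Vit ω r A s w0 n t‖ₑ := (A t).le_opENorm _
      _ ≤ ‖A t‖ₑ * (‖w0‖ₑ * Jit μ r n t) := by gcongr; exact hn t (Or.inr ht')
      _ = _ := by ring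
  have hfin : ∀ n x, ‖w0‖ₑ * Jit μ r n x < ∞ := fun n x =>
    ENNReal.mul_lt_top (by simp) ((hJle n x).trans_lt ENNReal.ofReal_lt_top)
  have hreal : ∀ n x (y : ℝ), ENNReal.ofReal y ≤ ‖w0‖ₑ * Jit μ r n x →
      y ≤ ‖w0‖ * ((μ.real univ) ^ n / n.factorial) := by
    intro n x y hy
    have h1 := hy.trans (mul_le_mul' le_rfl (hJle n x))
    rw [← ofReal_norm, ← ENNReal.ofReal_mul (norm_nonneg _)] at h1
    exact (ENNReal.ofReal_le_ofReal_iff (by positivity)).1 h1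
  have hmeas : ∀ n, AEStronglyMeasurable (Vit ω r A s w0 n) ν →
      AEStronglyMeasurable (fun t => A t (Vit ω r A s w0 n t)) ν := fun n hn =>
    isBoundedBilinearMap_apply.continuous.comp_aestronglyMeasurable (hA.1.prodMk hn)
  have main : ∀ n, AEStronglyMeasurable (Vit ω r A s w0 n) ν ∧
      ∀ x, (x = x0 ∨ r x x0) → ‖Vit ω r A s w0 n x‖ₑ ≤ ‖w0‖ₑ * Jit μ r n x := by
    intro n
    induction n with
    | zero =>
      refine ⟨aestronglyMeasurable_const, fun x _ => ?_⟩
      simp [Vit, Jit]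
    | succ n ih =>
      have hint : Integrable (fun t => A t (Vit ω r A s w0 n t)) ν :=
        ⟨hmeas n ih.1, (hlin n ih.2 x0 (Or.inl rfl)).trans_lt (hfin _ _)⟩
      constructor
      · have h1 := hs.stronglyMeasurable.smul (param_meas hint r hr)
        refine h1.aestronglyMeasurable.congr ?_
        rw [hν]
        filter_upwards [ae_restrict_mem (hm x0)] with y hy
        simp only [Vit]
        rw [← hν, Pi.smul_apply', hνr y (Or.inr hy)]
      · intro x hx
        refine le_trans ?_ (hlin n ih.2 x hx)
        simp only [Vit]
        rw [enorm_smul]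
        have : ‖s x‖ₑ ≤ 1 := by
          rw [← ofReal_norm, Real.norm_eq_abs]
          simpa using hs1 x
        calc _ ≤ 1 * ‖∫ t in {t | r t x}, A t (Vit ω r A s w0 n t) ∂ω‖ₑ := by gcongr
          _ ≤ _ := by rw [one_mul]; exact enorm_integral_le_lintegral_enorm _
  refine ⟨μ.real univ, by positivity, fun n => ?_⟩
  have hint : Integrable (fun t => A t (Vit ω r A s w0 n t)) ν :=
    ⟨hmeas n (main n).1, (hlin n (main n).2 x0 (Or.inl rfl)).trans_lt (hfin _ _)⟩
  refine ⟨(main n).1, hint, ?_, fun x hx => ?_⟩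
  · refine hreal (n + 1) x0 _ ?_
    rw [ofReal_integral_norm_eq_lintegral_enorm hint]
    exact hlin n (main n).2 x0 (Or.inl rfl)
  · refine hreal n x _ ?_
    rw [ofReal_norm]
    exact (main n).2 x hx

lemma volterra {E : Type*} [NormedAddCommGroup E] [NormedSpace ℝ E] [CompleteSpace E]
    (ω : Measure ℝ)
    (r : ℝ → ℝ → Prop) (hr : MeasurableSet {p : ℝ × ℝ | r p.1 p.2})
    (htr : ∀ s t x, r s t → r t x → r s x) (has : ∀ s t, r s t → ¬ r t s)
    (D : Set ℝ)
    (A : ℝ → E →L[ℝ] E) (hA : ∀ x ∈ D, IntegrableOn A {t | r t x} ω)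
    (s : ℝ → ℝ) (hs : Measurable s) (hs1 : ∀ x, |s x| ≤ 1) (w0 : E) :
    ∃ W : ℝ → E, ∀ x ∈ D, IntegrableOn (fun t => A t (W t)) {t | r t x} ω ∧
      W x = w0 + s x • ∫ t in {t | r t x}, A t (W t) ∂ω := by
  have hm : ∀ y, MeasurableSet {t | r t y} := fun y =>
    (measurable_id.prodMk measurable_const : Measurable (fun t : ℝ => (t, y))) hr
  refine ⟨fun x => ∑' n, Vit ω r A s w0 n x, fun x hx => ?_⟩
  obtain ⟨M, hM, h⟩ := Vit_main ω r hr htr has A s hs hs1 w0 x (hA x hx)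
  have hexp := (Real.summable_pow_div_factorial M).mul_left ‖w0‖
  have hexp1 := (summable_nat_add_iff 1).2 hexp
  have hsum : ∀ y, (y = x ∨ r y x) → Summable (fun n => Vit ω r A s w0 n y) := fun y hy =>
    Summable.of_norm_bounded hexp (fun n => (h n).2.2.2 y hy)
  have hsI : Summable fun n => ∫ t in {t | r t x}, ‖A t (Vit ω r A s w0 n t)‖ ∂ω :=
    Summable.of_nonneg_of_le (fun n => integral_nonneg fun _ => norm_nonneg _)
      (fun n => (h n).2.2.1) hexp1
  have hHS := hasSum_integral_of_summable_integral_norm (fun n => (h n).2.1) hsI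
  have hmap : ∀ t ∈ {t | r t x}, ∑' n, A t (Vit ω r A s w0 n t)
      = A t (∑' n, Vit ω r A s w0 n t) := fun t ht =>
    ((A t).map_tsum (hsum t (Or.inr ht))).symm
  rw [setIntegral_congr_fun (hm x) hmap] at hHS
  constructor
  · have hWm : AEStronglyMeasurable (fun t => ∑' n, Vit ω r A s w0 n t)
        (ω.restrict {t | r t x}) := by
      refine aestronglyMeasurable_of_tendsto_ae atTop
        (f := fun N t => ∑ n ∈ Finset.range N, Vit ω r A s w0 n t) (fun N => ?_) ?_
      · exact Finset.aestronglyMeasurable_fun_sum _ (fun n _ => (h n).1)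
      · filter_upwards [ae_restrict_mem (hm x)] with t ht
        exact (hsum t (Or.inr ht)).hasSum.tendsto_sum_nat
    refine Integrable.mono' ((hA x hx).norm.mul_const (∑' n, ‖w0‖ * (M ^ n / n.factorial)))
      (isBoundedBilinearMap_apply.continuous.comp_aestronglyMeasurable ((hA x hx).1.prodMk hWm)) ?_
    filter_upwards [ae_restrict_mem (hm x)] with t ht
    refine ((A t).le_opNorm _).trans ?_
    gcongr
    exact tsum_of_norm_bounded hexp.hasSum (fun n => (h n).2.2.2 t (Or.inr ht))
  · show ∑' n, Vit ω r A s w0 n x = _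
    rw [(hsum x (Or.inl rfl)).tsum_eq_zero_add]
    congr 1
    exact (hHS.const_smul (s x)).tsum_eq

/-- `(p, q) ↦ (q, 0)` -/
noncomputable def N1 : (ℂ × ℂ) →L[ℝ] (ℂ × ℂ) :=
  (ContinuousLinearMap.inl ℝ ℂ ℂ).comp (ContinuousLinearMap.snd ℝ ℂ ℂ)

/-- `(p, q) ↦ (0, p)` -/
noncomputable def N2 : (ℂ × ℂ) →L[ℝ] (ℂ × ℂ) :=
  (ContinuousLinearMap.inr ℝ ℂ ℂ).comp (ContinuousLinearMap.fst ℝ ℂ ℂ)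

lemma exists_sol (a b : ℝ) (ω : Measure ℝ) (σf χf ρf : ℝ → ℂ)
    (hσ : LocInt a b ω σf) (hχ : LocInt a b ω χf) (hρ : LocInt a b ω ρf)
    (hatoms : NoCommonAtoms a b ω σf χf ρf) (z : ℂ) (c : ℝ) (hc : c ∈ Ioo a b) (p q : ℂ) :
    ∃ u v : ℝ → ℂ, InDom a b ω σf χf ρf u v (fun t => z * u t) ∧ u c = p ∧ v c = q := by
  set κ : ℝ → ℂ := fun t => χf t - z * ρf t with hκ
  set A : ℝ → (ℂ × ℂ) →L[ℝ] (ℂ × ℂ) := fun t => σf t • N1 + κ t • N2 with hAdef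
  have hAap : ∀ t w, A t w = (σf t * w.2, κ t * w.1) := by
    intro t w
    simp [hAdef, N1, N2]
  have hAint : ∀ α ∈ Ioo a b, ∀ β ∈ Ioo a b, IntegrableOn A (Ico α β) ω := by
    intro α hα β hβ
    exact ((hσ α hα β hβ).smul_const N1).add
      (((hχ α hα β hβ).sub ((hρ α hα β hβ).const_mul z)).smul_const N2)
  set r : ℝ → ℝ → Prop := fun t x => (c ≤ t ∧ t < x) ∨ (x < t ∧ t < c) with hrdef
  have hr : MeasurableSet {p : ℝ × ℝ | r p.1 p.2} := by
    refine MeasurableSet.union ?_ ?_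
    · exact (measurableSet_le measurable_const measurable_fst).inter
        (measurableSet_lt measurable_fst measurable_snd)
    · exact (measurableSet_lt measurable_snd measurable_fst).inter
        (measurableSet_lt measurable_fst measurable_const)
  have hSr : ∀ x, c ≤ x → {t | r t x} = Ico c x := by
    intro x hx; ext t
    simp only [hrdef, mem_ofPred_eq, mem_Ico]
    constructor
    · rintro (h | h)
      · exact h
      · linarith [h.1, h.2]
    · exact Or.inl
  have hSl : ∀ x, x < c → {t | r t x} = Ioo x c := by
    intro x hx; ext t
    simp only [hrdef, mem_ofPred_eq, mem_Ioo]
    constructor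
    · rintro (h | h)
      · linarith [h.1, h.2]
      · exact h
    · exact Or.inr
  obtain ⟨W, hW⟩ := volterra ω r hr
    (by
      rintro s t x (h | h) (h' | h')
      · exact Or.inl ⟨h.1, h.2.trans h'.2⟩
      · linarith [h.1, h.2, h'.1, h'.2]
      · linarith [h.1, h.2, h'.1, h'.2]
      · exact Or.inr ⟨h'.1.trans h.1, h.2⟩)
    (by
      rintro s t (h | h) (h' | h') <;> linarith [h.1, h.2, h'.1, h'.2])
    (Ioo a b) A
    (by
      intro x hx
      rcases le_or_gt c x with h | h
      · rw [hSr x h]; exact hAint c hc x hx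
      · rw [hSl x h]; exact (hAint x hx c hc).mono_set Ioo_subset_Ico_self)
    (fun x => if c ≤ x then 1 else -1)
    (Measurable.ite measurableSet_Ici measurable_const measurable_const)
    (by intro x; split_ifs <;> simp) (p, q)
  set U : ℝ → ℂ × ℂ := fun x => if c ≤ x then W x else W x - ω.real {x} • A x (W x) with hU
  have hAA : ∀ x ∈ Ioo a b, A x (U x) = A x (W x) := by
    intro x hx
    simp only [hU]
    split_ifs with h
    · rfl
    · rw [map_sub, map_smul, sub_eq_self]
      have h1 := hatoms x hx
      change ((ω.real {x} : ℝ) : ℂ) * _ * (((ω.real {x} : ℝ) : ℂ) * _) = 0 ∧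
        ((ω.real {x} : ℝ) : ℂ) * _ * (((ω.real {x} : ℝ) : ℂ) * _) = 0 at h1
      set m : ℂ := ((ω.real {x} : ℝ) : ℂ) with hmdef
      have h3 : m * (σf x * κ x) = 0 := by
        by_cases hm : m = 0
        · simp [hm]
        · have : m * (m * (σf x * κ x)) = 0 := by
            simp only [hκ]; linear_combination h1.2 - z * h1.1
          exact (mul_eq_zero.1 this).resolve_left hm
      rw [hAap, hAap]
      ext1
      · simp only [Prod.smul_fst, Complex.real_smul, Prod.fst_zero]
        linear_combination (W x).1 * h3
      · simp only [Prod.smul_snd, Complex.real_smul, Prod.snd_zero]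
        linear_combination (W x).2 * h3
  set F : ℝ → ℂ × ℂ := fun t => A t (U t) with hF
  have hAWs : ∀ s ⊆ Ioo a b, MeasurableSet s → IntegrableOn (fun t => A t (W t)) s ω →
      IntegrableOn F s ω ∧ ∫ t in s, A t (W t) ∂ω = ∫ t in s, F t ∂ω := by
    intro s hs hsm hi
    exact ⟨hi.congr_fun (fun t ht => (hAA t (hs ht)).symm) hsm,
      setIntegral_congr_fun hsm (fun t ht => (hAA t (hs ht)).symm)⟩
  have hright : ∀ x ∈ Ioo a b, c ≤ x → IntegrableOn F (Ico c x) ω ∧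
      U x = (p, q) + ∫ t in Ico c x, F t ∂ω := by
    intro x hx hcx
    have h1 := hW x hx
    rw [hSr x hcx] at h1
    obtain ⟨h2, h3⟩ := hAWs (Ico c x) (fun t ht => ⟨hc.1.trans_le ht.1, ht.2.trans hx.2⟩)
      measurableSet_Ico h1.1
    refine ⟨h2, ?_⟩
    rw [← h3]
    simp only [hU, if_pos hcx]
    simpa [hcx] using h1.2
  have hleft : ∀ x ∈ Ioo a b, x < c → IntegrableOn F (Ico x c) ω ∧
      U x = (p, q) - ∫ t in Ico x c, F t ∂ω := by
    intro x hx hcx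
    have h1 := hW x hx
    rw [hSl x hcx] at h1
    obtain ⟨h2, h3⟩ := hAWs (Ioo x c) (fun t ht => ⟨hx.1.trans ht.1, ht.2.trans hc.2⟩)
      measurableSet_Ioo h1.1
    have hun : Ico x c = {x} ∪ Ioo x c := by
      rw [union_comm, Ioo_union_left hcx]
    have hsing : IntegrableOn F {x} ω := by
      have := (hAint x hx c hc).mono_set (singleton_subset_iff.2 (left_mem_Ico.2 hcx))
      have this' := (integrableOn_singleton_iff (f := fun t => ‖A t‖) (by simp)).1 this.norm
      rw [integrableOn_singleton_iff]
      rcases this' with h | h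
      · left
        have h0 : A x = 0 := norm_eq_zero.1 (enorm_eq_zero.1 h)
        simp [hF, h0]
      · exact Or.inr h
    refine ⟨by rw [hun]; exact hsing.union h2, ?_⟩
    rw [hun, setIntegral_union (by simp) measurableSet_Ioo hsing h2, integral_singleton, ← h3]
    have hFx : F x = A x (W x) := hAA x hx
    rw [hFx]
    simp only [hU, if_neg (not_le.2 hcx)]
    have h4 := h1.2
    simp only [if_neg (not_le.2 hcx)] at h4
    nth_rewrite 1 [h4]
    rw [neg_smul, one_smul]
    abel
  have hFint : ∀ α ∈ Ioo a b, ∀ β ∈ Ioo a b, IntegrableOn F (Ico α β) ω := by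
    intro α hα β hβ
    have h1 : IntegrableOn F (Ico α c) ω := by
      rcases le_or_gt c α with h | h
      · simp [Ico_eq_empty (not_lt.2 h)]
      · exact (hleft α hα h).1
    have h2 : IntegrableOn F (Ico c β) ω := by
      rcases le_or_gt c β with h | h
      · exact (hright β hβ h).1
      · simp [Ico_eq_empty (not_lt.2 h.le)]
    refine (h1.union h2).mono_set ?_
    intro t ht
    rcases le_or_gt c t with h | h
    · exact Or.inr ⟨h, ht.2⟩
    · exact Or.inl ⟨ht.1, h⟩
  have hsplit : ∀ α ∈ Ioo a b, ∀ β ∈ Ioo a b, ∀ γ ∈ Ioo a b, α ≤ β → β ≤ γ →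
      ∫ t in Ico α γ, F t ∂ω = ∫ t in Ico α β, F t ∂ω + ∫ t in Ico β γ, F t ∂ω := by
    intro α hα β hβ γ hγ h1 h2
    rw [← Ico_union_Ico_eq_Ico h1 h2, setIntegral_union _ measurableSet_Ico
      (hFint α hα β hβ) (hFint β hβ γ hγ)]
    rw [Set.disjoint_left]
    intro t ht ht'
    exact absurd ht.2 (not_lt.2 ht'.1)
  have hstep : ∀ α ∈ Ioo a b, ∀ β ∈ Ioo a b, α ≤ β → U β = U α + ∫ t in Ico α β, F t ∂ω := by
    intro α hα β hβ hαβ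
    rcases le_or_gt c α with h | h
    · rw [(hright α hα h).2, (hright β hβ (h.trans hαβ)).2, hsplit c hc α hα β hβ h hαβ]
      abel
    · rcases le_or_gt c β with h' | h'
      · rw [(hleft α hα h).2, (hright β hβ h').2, hsplit α hα c hc β hβ h.le h']
        abel
      · rw [(hleft α hα h).2, (hleft β hβ h').2, hsplit α hα β hβ c hc hαβ h'.le]
        abel
  have hF1 : ∀ t, (F t).1 = (U t).2 * σf t := by
    intro t; simp only [hF, hAap]; ring
  have hF2 : ∀ t, (F t).2 = (U t).1 * χf t - z * (U t).1 * ρf t := by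
    intro t; simp only [hF, hAap, hκ]; ring
  refine ⟨fun t => (U t).1, fun t => (U t).2, ⟨?_, ?_, ?_⟩, ?_, ?_⟩
  · intro α hα β hβ
    have := (hFint α hα β hβ).fst
    unfold IntegrableOn
    simpa only [hF1] using this
  · intro α hα β hβ
    have := (hFint α hα β hβ).snd
    unfold IntegrableOn
    simpa only [hF2] using this
  · intro α hα β hβ hαβ
    have h1 := hstep α hα β hβ hαβ
    have h2 := fst_integral (hFint α hα β hβ)
    have h3 := snd_integral (hFint α hα β hβ)
    simp only [hF1] at h2
    simp only [hF2] at h3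
    constructor
    · rw [← h2]; simp [h1]
    · rw [← h3]; simp [h1]
  · have := (hright c hc le_rfl).2
    simp at this
    simp [this]
  · have := (hright c hc le_rfl).2
    simp at this
    simp [this]

lemma prod_sfin {ν : Measure ℝ} [SFinite ν] {F G : ℝ → ℂ} (hF : Integrable F ν)
    (hG : Integrable G ν) (hd : ∀ t, (ν.real {t} : ℂ) * (F t * G t) = 0) :
    (∫ t, F t ∂ν) * ∫ t, G t ∂ν =
      ∫ t, (∫ s in Iio t, F s ∂ν) * G t ∂ν + ∫ t, (∫ s in Iio t, G s ∂ν) * F t ∂ν := by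
  have hFG : Integrable (fun p : ℝ × ℝ => F p.1 * G p.2) (ν.prod ν) := hF.mul_prod hG
  have hlt : MeasurableSet {p : ℝ × ℝ | p.1 < p.2} := measurableSet_lt measurable_fst measurable_snd
  have hgt : MeasurableSet {p : ℝ × ℝ | p.2 < p.1} := measurableSet_lt measurable_snd measurable_fst
  have heq : MeasurableSet {p : ℝ × ℝ | p.1 = p.2} :=
    measurableSet_eq_fun measurable_fst measurable_snd
  rw [← integral_prod_mul]
  set f : ℝ × ℝ → ℂ := fun p => F p.1 * G p.2 with hf
  have hsplit : f = fun p => ({p : ℝ × ℝ | p.1 < p.2}.indicator f p +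
      {p : ℝ × ℝ | p.2 < p.1}.indicator f p) + {p : ℝ × ℝ | p.1 = p.2}.indicator f p := by
    funext p
    rcases lt_trichotomy p.1 p.2 with h | h | h
    · simp [indicator, h, h.ne, h.not_gt]
    · simp [indicator, h]
    · simp [indicator, h, h.ne', h.not_gt]
  have i1 := hFG.indicator hlt
  have i2 := hFG.indicator hgt
  have i3 := hFG.indicator heq
  have t1 : ∫ p, {p : ℝ × ℝ | p.1 < p.2}.indicator f p ∂(ν.prod ν) =
      ∫ t, (∫ s in Iio t, F s ∂ν) * G t ∂ν := by
    rw [integral_prod_symm _ i1]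
    refine integral_congr_ae (Eventually.of_forall fun t => ?_)
    simp only
    have : ∀ s, {p : ℝ × ℝ | p.1 < p.2}.indicator f (s, t) =
      (Iio t).indicator (fun s => F s * G t) s := fun s => rfl
    simp only [this]
    rw [integral_indicator measurableSet_Iio, integral_mul_const]
  have t2 : ∫ p, {p : ℝ × ℝ | p.2 < p.1}.indicator f p ∂(ν.prod ν) =
      ∫ t, (∫ s in Iio t, G s ∂ν) * F t ∂ν := by
    rw [integral_prod _ i2]
    refine integral_congr_ae (Eventually.of_forall fun t => ?_)
    simp only
    have : ∀ s, {p : ℝ × ℝ | p.2 < p.1}.indicator f (t, s) =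
      (Iio t).indicator (fun s => F t * G s) s := fun s => rfl
    simp only [this]
    rw [integral_indicator measurableSet_Iio, integral_const_mul, mul_comm]
  have t3 : ∫ p, {p : ℝ × ℝ | p.1 = p.2}.indicator f p ∂(ν.prod ν) = 0 := by
    rw [integral_prod _ i3]
    refine integral_eq_zero_of_ae (Eventually.of_forall fun t => ?_)
    simp only [Pi.zero_apply]
    have : ∀ s, {p : ℝ × ℝ | p.1 = p.2}.indicator f (t, s) =
        ({t} : Set ℝ).indicator (fun s => F t * G s) s := by
      intro s
      by_cases h : t = s
      · simp [indicator, h, hf]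
      · simp [indicator, h, Ne.symm h]
    simp only [this]
    rw [integral_indicator (measurableSet_singleton t), integral_singleton, Complex.real_smul]
    exact hd t
  have i12 : Integrable (fun p => {p : ℝ × ℝ | p.1 < p.2}.indicator f p +
      {p : ℝ × ℝ | p.2 < p.1}.indicator f p) (ν.prod ν) := i1.add i2
  rw [hsplit, integral_add i12 i3, integral_add i1 i2, t1, t2, t3, add_zero]

lemma prod_gen {ν : Measure ℝ} {F G : ℝ → ℂ} (hF : Integrable F ν)
    (hG : Integrable G ν) (hd : ∀ t, (ν.real {t} : ℂ) * (F t * G t) = 0) :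
    (∫ t, F t ∂ν) * ∫ t, G t ∂ν =
      ∫ t, (∫ s in Iio t, F s ∂ν) * G t ∂ν + ∫ t, (∫ s in Iio t, G s ∂ν) * F t ∂ν := by
  set TF := hF.aefinStronglyMeasurable.sigmaFiniteSet
  set TG := hG.aefinStronglyMeasurable.sigmaFiniteSet
  have hTF : MeasurableSet TF := hF.aefinStronglyMeasurable.measurableSet
  have hTG : MeasurableSet TG := hG.aefinStronglyMeasurable.measurableSet
  have : SigmaFinite (ν.restrict TF) := hF.aefinStronglyMeasurable.sigmaFinite_restrict
  have : SigmaFinite (ν.restrict TG) := hG.aefinStronglyMeasurable.sigmaFinite_restrict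
  have hT : MeasurableSet (TF ∪ TG) := hTF.union hTG
  have eF := fun (s : Set ℝ) (hs : MeasurableSet s) =>
    setInt_restrict_aux hF hT subset_union_left hs
  have eG := fun (s : Set ℝ) (hs : MeasurableSet s) =>
    setInt_restrict_aux hG hT subset_union_right hs
  have key := prod_sfin (ν := ν.restrict (TF ∪ TG)) hF.restrict hG.restrict (by
    intro t
    by_cases h : t ∈ TF ∪ TG
    · rw [measureReal_restrict_apply (measurableSet_singleton t),
        inter_eq_self_of_subset_left (singleton_subset_iff.2 h)]
      exact hd t
    · rw [measureReal_restrict_apply (measurableSet_singleton t),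
        singleton_inter_eq_empty.2 h]
      simp)
  have hzF := (ae_restrict_iff' hTF.compl).1 hF.aefinStronglyMeasurable.ae_eq_zero_compl
  have hzG := (ae_restrict_iff' hTG.compl).1 hG.aefinStronglyMeasurable.ae_eq_zero_compl
  have e1 : ∫ t, F t ∂ν = ∫ t, F t ∂(ν.restrict (TF ∪ TG)) := by
    simpa using eF univ MeasurableSet.univ
  have e2 : ∫ t, G t ∂ν = ∫ t, G t ∂(ν.restrict (TF ∪ TG)) := by
    simpa using eG univ MeasurableSet.univ
  rw [e1, e2, key]
  simp only [← eF _ measurableSet_Iio, ← eG _ measurableSet_Iio]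
  congr 1
  · refine setIntegral_eq_integral_of_ae_compl_eq_zero ?_
    filter_upwards [hzG] with t ht h
    rw [show G t = 0 from ht (fun h' => h (Or.inr h')), mul_zero]
  · refine setIntegral_eq_integral_of_ae_compl_eq_zero ?_
    filter_upwards [hzF] with t ht h
    rw [show F t = 0 from ht (fun h' => h (Or.inl h')), mul_zero]

/-- primitives are measurable and bounded -/
lemma prim_props {ω : Measure ℝ} {α β : ℝ} {f F : ℝ → ℂ} (hF : IntegrableOn F (Ico α β) ω)
    (hf : ∀ x ∈ Icc α β, f x = f α + ∫ t in Ico α x, F t ∂ω) :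
    AEStronglyMeasurable f (ω.restrict (Ico α β)) ∧ ∃ C, ∀ x ∈ Ico α β, ‖f x‖ ≤ C := by
  constructor
  · have h := param_meas hF (fun t x => t < x) (measurableSet_lt measurable_fst measurable_snd)
    refine ((stronglyMeasurable_const (b := f α)).add h).aestronglyMeasurable.congr ?_
    filter_upwards [ae_restrict_mem measurableSet_Ico] with x hx
    rw [hf x ⟨hx.1, hx.2.le⟩, Pi.add_apply]
    change f α + ∫ t in Iio x, F t ∂(ω.restrict (Ico α β)) = _
    rw [Measure.restrict_restrict measurableSet_Iio]
    congr 3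
    ext t
    simp only [mem_inter_iff, mem_Iio, mem_Ico]
    exact ⟨fun h => ⟨h.2.1, h.1⟩, fun h => ⟨h.2, h.1, h.2.trans hx.2⟩⟩
  · refine ⟨‖f α‖ + ∫ t in Ico α β, ‖F t‖ ∂ω, fun x hx => ?_⟩
    rw [hf x ⟨hx.1, hx.2.le⟩]
    refine (norm_add_le _ _).trans ?_
    gcongr
    refine (norm_integral_le_integral_norm _).trans ?_
    exact setIntegral_mono_set hF.norm (Eventually.of_forall fun _ => norm_nonneg _)
      (Ico_subset_Ico_right hx.2.le).eventuallyLE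

lemma bdd_mul_int {ω : Measure ℝ} {α β : ℝ} {f G : ℝ → ℂ}
    (hf : AEStronglyMeasurable f (ω.restrict (Ico α β)) ∧ ∃ C, ∀ x ∈ Ico α β, ‖f x‖ ≤ C)
    (hG : IntegrableOn G (Ico α β) ω) : IntegrableOn (fun t => f t * G t) (Ico α β) ω := by
  obtain ⟨hm, C, hC⟩ := hf
  refine Integrable.bdd_mul (c := C) hG hm ?_
  filter_upwards [ae_restrict_mem measurableSet_Ico] with x hx using hC x hx

lemma prod_rule {ω : Measure ℝ} {α β : ℝ} (hαβ : α ≤ β) {f g F G : ℝ → ℂ}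
    (hF : IntegrableOn F (Ico α β) ω) (hG : IntegrableOn G (Ico α β) ω)
    (hf : ∀ x ∈ Icc α β, f x = f α + ∫ t in Ico α x, F t ∂ω)
    (hg : ∀ x ∈ Icc α β, g x = g α + ∫ t in Ico α x, G t ∂ω)
    (hd : ∀ t ∈ Ico α β, (ω.real {t} : ℂ) * (F t * G t) = 0) :
    f β * g β - f α * g α = ∫ t in Ico α β, (f t * G t + g t * F t) ∂ω := by
  have key := prod_gen hF hG (by
    intro t
    rw [measureReal_restrict_apply (measurableSet_singleton t)]
    by_cases h : t ∈ Ico α β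
    · rw [inter_eq_self_of_subset_left (singleton_subset_iff.2 h)]
      exact hd t h
    · rw [singleton_inter_eq_empty.2 h]
      simp)
  have hr : ∀ (H : ℝ → ℂ), ∀ t ∈ Ico α β,
      ∫ s in Iio t, H s ∂(ω.restrict (Ico α β)) = ∫ s in Ico α t, H s ∂ω := by
    intro H t ht
    rw [Measure.restrict_restrict measurableSet_Iio]
    congr 2
    ext s
    simp only [mem_inter_iff, mem_Iio, mem_Ico]
    exact ⟨fun h => ⟨h.2.1, h.1⟩, fun h => ⟨h.2, h.1, h.2.trans ht.2⟩⟩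
  have e1 : ∫ t in Ico α β, (∫ s in Iio t, F s ∂(ω.restrict (Ico α β))) * G t ∂ω =
      ∫ t in Ico α β, f t * G t ∂ω - f α * ∫ t in Ico α β, G t ∂ω := by
    rw [← integral_const_mul, ← integral_sub (bdd_mul_int (prim_props hF hf) hG)
      (hG.const_mul _)]
    refine setIntegral_congr_fun measurableSet_Ico fun t ht => ?_
    rw [hr F t ht, hf t ⟨ht.1, ht.2.le⟩]; ring
  have e2 : ∫ t in Ico α β, (∫ s in Iio t, G s ∂(ω.restrict (Ico α β))) * F t ∂ω =
      ∫ t in Ico α β, g t * F t ∂ω - g α * ∫ t in Ico α β, F t ∂ω := by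
    rw [← integral_const_mul, ← integral_sub (bdd_mul_int (prim_props hG hg) hF)
      (hF.const_mul _)]
    refine setIntegral_congr_fun measurableSet_Ico fun t ht => ?_
    rw [hr G t ht, hg t ⟨ht.1, ht.2.le⟩]; ring
  rw [e1, e2] at key
  rw [integral_add (bdd_mul_int (prim_props hF hf) hG) (bdd_mul_int (prim_props hG hg) hF),
    hf β ⟨hαβ, le_rfl⟩, hg β ⟨hαβ, le_rfl⟩]
  linear_combination key

lemma indom_props {a b : ℝ} {ω : Measure ℝ} {σf χf ρf f f1 fτ : ℝ → ℂ}
    (h : InDom a b ω σf χf ρf f f1 fτ) {α β : ℝ} (hα : α ∈ Ioo a b) (hβ : β ∈ Ioo a b) :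
    (∀ x ∈ Icc α β, f x = f α + ∫ t in Ico α x, f1 t * σf t ∂ω) ∧
    (∀ x ∈ Icc α β, f1 x = f1 α + ∫ t in Ico α x, (f t * χf t - fτ t * ρf t) ∂ω) := by
  have hx' : ∀ x ∈ Icc α β, x ∈ Ioo a b := fun x hx =>
    ⟨hα.1.trans_le hx.1, hx.2.trans_lt hβ.2⟩
  exact ⟨fun x hx => (h.2.2 α hα x (hx' x hx) hx.1).1,
    fun x hx => (h.2.2 α hα x (hx' x hx) hx.1).2⟩

lemma lagrange {a b : ℝ} {ω : Measure ℝ} {σf χf ρf : ℝ → ℂ}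
    (hatoms : NoCommonAtoms a b ω σf χf ρf) {z z0 : ℂ} {u u' g g' : ℝ → ℂ}
    (hu : InDom a b ω σf χf ρf u u' (fun t => z * u t))
    (hg : InDom a b ω σf χf ρf g g' (fun t => z0 * g t))
    {α β : ℝ} (hα : α ∈ Ioo a b) (hβ : β ∈ Ioo a b) (hαβ : α ≤ β) :
    (u β * g' β - u' β * g β) - (u α * g' α - u' α * g α) =
      (z - z0) * ∫ t in Ico α β, u t * (g t * ρf t) ∂ω := by
  obtain ⟨pu, pu'⟩ := indom_props hu hα hβ
  obtain ⟨pg, pg'⟩ := indom_props hg hα hβ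
  have hd : ∀ t ∈ Ico α β, ∀ A B w : ℂ,
      (ω.real {t} : ℂ) * ((A * σf t) * (B * χf t - w * B * ρf t)) = 0 := by
    intro t ht A B w
    have h1 := hatoms t ⟨hα.1.trans_le ht.1, ht.2.trans hβ.2⟩
    change ((ω.real {t} : ℝ) : ℂ) * _ * (((ω.real {t} : ℝ) : ℂ) * _) = 0 ∧
      ((ω.real {t} : ℝ) : ℂ) * _ * (((ω.real {t} : ℝ) : ℂ) * _) = 0 at h1
    set m : ℂ := ((ω.real {t} : ℝ) : ℂ)
    by_cases hm : m = 0
    · simp [hm]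
    · have : m * (m * ((A * σf t) * (B * χf t - w * B * ρf t))) = 0 := by
        linear_combination A * B * h1.2 - A * B * w * h1.1
      exact (mul_eq_zero.1 this).resolve_left hm
  have e1 := prod_rule hαβ (hu.1 α hα β hβ) (hg.2.1 α hα β hβ) pu pg'
    (fun t ht => hd t ht _ _ _)
  have e2 := prod_rule hαβ (hg.1 α hα β hβ) (hu.2.1 α hα β hβ) pg pu'
    (fun t ht => hd t ht _ _ _)
  have b1 := prim_props (hu.1 α hα β hβ) pu
  have b2 := prim_props (hu.2.1 α hα β hβ) pu'
  have b3 := prim_props (hg.1 α hα β hβ) pg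
  have b4 := prim_props (hg.2.1 α hα β hβ) pg'
  have i1 := (bdd_mul_int b1 (hg.2.1 α hα β hβ)).add (bdd_mul_int b4 (hu.1 α hα β hβ))
  have i2 := (bdd_mul_int b3 (hu.2.1 α hα β hβ)).add (bdd_mul_int b2 (hg.1 α hα β hβ))
  have e3 := integral_sub i1 i2
  simp only [Pi.add_apply] at e3
  rw [← e1, ← e2] at e3
  rw [← integral_const_mul]
  calc _ = (u β * g' β - u α * g' α) - (g β * u' β - g α * u' α) := by ring
    _ = _ := e3.symm
    _ = _ := by
      congr 1
      funext t
      ring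

lemma glob_meas {a b : ℝ} (hab : a < b) {ω : Measure ℝ} {f : ℝ → ℂ}
    (h : ∀ α ∈ Ioo a b, ∀ β ∈ Ioo a b, AEStronglyMeasurable f (ω.restrict (Ico α β))) :
    AEStronglyMeasurable f (ω.restrict (Ioo a b)) := by
  obtain ⟨x, -, hx, hxt⟩ := exists_seq_strictAnti_tendsto' hab
  obtain ⟨y, -, hy, hyt⟩ := exists_seq_strictMono_tendsto' hab
  have h1 : AEStronglyMeasurable f (ω.restrict (⋃ n, Ico (x n) (y n))) :=
    aestronglyMeasurable_iUnion_iff.2 fun n => h _ (hx n) _ (hy n)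
  refine h1.mono_measure (Measure.restrict_mono ?_ le_rfl)
  intro t ht
  obtain ⟨n, hn1, hn2⟩ := ((hxt.eventually_lt_const ht.1).and
    (hyt.eventually_const_lt ht.2)).exists
  exact mem_iUnion.2 ⟨n, hn1.le, hn2⟩

lemma stmt12_aux (a b : ℝ) (hab : a < b) (ω : Measure ℝ) (σf χf ρf : ℝ → ℂ)
    (hσ : LocInt a b ω σf) (hχ : LocInt a b ω χf) (hρ : LocInt a b ω ρf)
    (hreal : RealCoeffs σf χf ρf)
    (hatoms : NoCommonAtoms a b ω σf χf ρf) (z₀ : ℂ)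
    (h : ∀ u v : ℝ → ℂ,
      InDom a b ω σf χf ρf u v (fun t => z₀ * u t) → L2NearA a b ω ρf u)
    (z : ℂ) (u v : ℝ → ℂ)
    (hu : InDom a b ω σf χf ρf u v (fun t => z * u t)) : L2NearA a b ω ρf u := by
  have hρn : ∀ t, ‖ρf t‖ = (ρf t).re := by
    intro t
    obtain ⟨h1, h2⟩ := hreal.2.2 t
    have : ρf t = ((ρf t).re : ℂ) := Complex.ext (by simp) (by simp [h1])
    rw [this, Complex.norm_real, Complex.ofReal_re, Real.norm_of_nonneg h2]
  have hρ0 : ∀ t, 0 ≤ (ρf t).re := fun t => (hreal.2.2 t).2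
  have hmeas : ∀ {w : ℂ} {f g : ℝ → ℂ}, InDom a b ω σf χf ρf f g (fun t => w * f t) →
      AEStronglyMeasurable f (ω.restrict (Ioo a b)) := by
    intro w f g hf
    exact glob_meas hab fun α hα β hβ => (prim_props (hf.1 α hα β hβ) (indom_props hf hα hβ).1).1
  have hρm : AEStronglyMeasurable ρf (ω.restrict (Ioo a b)) :=
    glob_meas hab fun α hα β hβ => (hρ α hα β hβ).1
  have hint : ∀ {w w' : ℂ} {f f' g g' : ℝ → ℂ}, InDom a b ω σf χf ρf f f' (fun t => w * f t) →
      InDom a b ω σf χf ρf g g' (fun t => w' * g t) → ∀ α ∈ Ioo a b, ∀ β ∈ Ioo a b,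
      IntegrableOn (fun t => f t * (g t * ρf t)) (Ico α β) ω := by
    intro w w' f f' g g' hf hg α hα β hβ
    exact bdd_mul_int (prim_props (hf.1 α hα β hβ) (indom_props hf hα hβ).1)
      (bdd_mul_int (prim_props (hg.1 α hα β hβ) (indom_props hg hα hβ).1) (hρ α hα β hβ))
  obtain ⟨c0, hc0⟩ := exists_between hab
  have hc0 : c0 ∈ Ioo a b := hc0
  obtain ⟨u1, v1, hu1, h10, h11⟩ := exists_sol a b ω σf χf ρf hσ hχ hρ hatoms z₀ c0 hc0 1 0
  obtain ⟨u2, v2, hu2, h20, h21⟩ := exists_sol a b ω σf χf ρf hσ hχ hρ hatoms z₀ c0 hc0 0 1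
  have hW : ∀ x ∈ Ioo a b, u1 x * v2 x - v1 x * u2 x = 1 := by
    intro x hx
    rcases le_total x c0 with hle | hle
    · have := lagrange hatoms hu1 hu2 hx hc0 hle
      rw [h10, h11, h20, h21] at this
      linear_combination -this
    · have := lagrange hatoms hu1 hu2 hc0 hx hle
      rw [h10, h11, h20, h21] at this
      linear_combination this
  set G : ℝ → ℝ := fun t => ‖u1 t‖ + ‖u2 t‖ with hG
  have hG0 : ∀ t, 0 ≤ G t := fun t => by positivity
  set k : ℝ → ℝ := fun t => G t ^ 2 * (ρf t).re with hk
  have hk0 : ∀ t, 0 ≤ k t := fun t => mul_nonneg (sq_nonneg _) (hρ0 t)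
  have hkm : AEStronglyMeasurable k (ω.restrict (Ioo a b)) :=
    (((hmeas hu1).norm.add (hmeas hu2).norm).pow 2).mul
      (Complex.continuous_re.comp_aestronglyMeasurable hρm)
  have hkint : ∀ c ∈ Ioo a b, IntegrableOn k (Ioo a c) ω := by
    intro c hc
    refine Integrable.mono' (((h u1 v1 hu1 c hc).const_mul 2).add
      ((h u2 v2 hu2 c hc).const_mul 2))
      (hkm.mono_measure (Measure.restrict_mono (Ioo_subset_Ioo_right hc.2.le) le_rfl)) ?_
    refine Eventually.of_forall fun t => ?_
    rw [Real.norm_of_nonneg (hk0 t)]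
    simp only [hk, hG, Pi.add_apply]
    have := mul_nonneg (sq_nonneg (‖u1 t‖ - ‖u2 t‖)) (hρ0 t)
    nlinarith
  -- choose d
  obtain ⟨d, hd, hdk⟩ : ∃ d ∈ Ioo a b, ‖z - z₀‖ * ∫ t in Ioo a d, k t ∂ω < 1 / 2 := by
    obtain ⟨x, hxa, hx, hxt⟩ := exists_seq_strictAnti_tendsto' hab
    have ht := tendsto_setIntegral_of_antitone (μ := ω) (f := k) (s := fun n => Ioo a (x n))
      (fun n => measurableSet_Ioo) (fun m n hmn => Ioo_subset_Ioo_right (hxa.antitone hmn))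
      ⟨0, hkint _ (hx 0)⟩
    have hemp : ⋂ n, Ioo a (x n) = ∅ := by
      rw [eq_empty_iff_forall_notMem]
      intro t ht
      have ht' := mem_iInter.1 ht
      obtain ⟨n, hn⟩ := (hxt.eventually_lt_const (ht' 0).1).exists
      exact absurd (ht' n).2 (not_lt.2 hn.le)
    rw [hemp, setIntegral_empty] at ht
    have ht2 := ht.const_mul ‖z - z₀‖
    rw [mul_zero] at ht2
    obtain ⟨n, hn⟩ := (ht2.eventually_lt_const (by norm_num : (0:ℝ) < 1 / 2)).exists
    exact ⟨x n, hx n, hn⟩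
  set ε := ∫ t in Ioo a d, k t ∂ω with hε
  have hε0 : 0 ≤ ε := integral_nonneg hk0
  set C := ‖z - z₀‖ with hC
  have hC0 : 0 ≤ C := norm_nonneg _
  set K := ‖u d * v2 d - v d * u2 d‖ + ‖u d * v1 d - v d * u1 d‖ with hK
  have hK0 : 0 ≤ K := by positivity
  set q : ℝ → ℝ := fun x => ∫ t in Ico x d, ‖u t‖ * G t * (ρf t).re ∂ω with hq
  have hlt : ∀ {x t}, x ∈ Ioo a d → t ∈ Ico x d → t ∈ Ioo a d := fun hx ht =>
    ⟨hx.1.trans_le ht.1, ht.2⟩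
  have hdb : ∀ {x}, x ∈ Ioo a d → x ∈ Ioo a b := fun hx => ⟨hx.1, hx.2.trans hd.2⟩
  have hnn : ∀ t, 0 ≤ ‖u t‖ * G t * (ρf t).re := fun t =>
    mul_nonneg (mul_nonneg (norm_nonneg _) (hG0 t)) (hρ0 t)
  have hqi : ∀ x ∈ Ioo a d, IntegrableOn (fun t => ‖u t‖ * G t * (ρf t).re) (Ico x d) ω := by
    intro x hx
    have := ((hint hu hu1 x (hdb hx) d hd).norm.add (hint hu hu2 x (hdb hx) d hd).norm)
    refine this.congr (Eventually.of_forall fun t => ?_)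
    simp only [Pi.add_apply, norm_mul, hρn, hG]
    ring
  have hq0 : ∀ x, 0 ≤ q x := fun x => integral_nonneg hnn
  have hbj : ∀ {g g' : ℝ → ℂ}, InDom a b ω σf χf ρf g g' (fun t => z₀ * g t) →
      (∀ t, ‖g t‖ ≤ G t) → ∀ x ∈ Ioo a d,
      ‖u x * g' x - v x * g x‖ ≤ ‖u d * g' d - v d * g d‖ + C * q x := by
    intro g g' hg hgG x hx
    have hl := lagrange hatoms hu hg (hdb hx) hd hx.2.le
    have : u x * g' x - v x * g x = (u d * g' d - v d * g d) -
        (z - z₀) * ∫ t in Ico x d, u t * (g t * ρf t) ∂ω := by linear_combination -hl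
    rw [this]
    refine (norm_sub_le _ _).trans ?_
    rw [norm_mul]
    gcongr
    refine (norm_integral_le_integral_norm _).trans ?_
    refine integral_mono_of_nonneg (Eventually.of_forall fun t => norm_nonneg _) (hqi x hx)
      (Eventually.of_forall fun t => ?_)
    simp only [norm_mul, hρn]
    rw [← mul_assoc]
    have := hρ0 t
    gcongr
    exact hgG t
  have hub : ∀ x ∈ Ioo a d, ‖u x‖ ≤ (K + C * q x) * G x := by
    intro x hx
    have e : u x = (u x * v2 x - v x * u2 x) * u1 x - (u x * v1 x - v x * u1 x) * u2 x := by
      linear_combination (-u x) * hW x (hdb hx)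
    have b1 := hbj hu2 (fun t => by simp [hG]) x hx
    have b2 := hbj hu1 (fun t => by simp [hG]) x hx
    have b1' : ‖u x * v2 x - v x * u2 x‖ ≤ K + C * q x := by
      refine b1.trans ?_; simp only [hK]; linarith [norm_nonneg (u d * v1 d - v d * u1 d)]
    have b2' : ‖u x * v1 x - v x * u1 x‖ ≤ K + C * q x := by
      refine b2.trans ?_; simp only [hK]; linarith [norm_nonneg (u d * v2 d - v d * u2 d)]
    calc ‖u x‖ ≤ ‖u x * v2 x - v x * u2 x‖ * ‖u1 x‖ + ‖u x * v1 x - v x * u1 x‖ * ‖u2 x‖ := by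
          nth_rewrite 1 [e]
          refine (norm_sub_le _ _).trans ?_
          rw [norm_mul, norm_mul]
      _ ≤ (K + C * q x) * ‖u1 x‖ + (K + C * q x) * ‖u2 x‖ := by gcongr
      _ = _ := by simp only [hG]; ring
  have hqb : ∀ x ∈ Ioo a d, q x ≤ 2 * K * ε := by
    intro x hx
    have hsub : Ico x d ⊆ Ioo a d := fun t ht => hlt hx ht
    have h1 : q x ≤ ∫ t in Ico x d, (K + C * q x) * k t ∂ω := by
      refine setIntegral_mono_on (hqi x hx) (((hkint d hd).mono_set hsub).const_mul _)
        measurableSet_Ico ?_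
      intro t ht
      have hqt : q t ≤ q x := setIntegral_mono_set (hqi x hx) (Eventually.of_forall hnn)
        (Ico_subset_Ico_left ht.1).eventuallyLE
      have h2 := hub t (hlt hx ht)
      have h3 := hρ0 t
      have h4 := hG0 t
      calc ‖u t‖ * G t * (ρf t).re ≤ ((K + C * q x) * G t) * G t * (ρf t).re := by
            gcongr
            refine h2.trans ?_
            gcongr
        _ = _ := by simp only [hk]; ring
    rw [integral_const_mul] at h1
    have h2 : ∫ t in Ico x d, k t ∂ω ≤ ε :=
      setIntegral_mono_set (hkint d hd) (Eventually.of_forall hk0) hsub.eventuallyLE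
    have h3 : q x ≤ (K + C * q x) * ε := by
      refine h1.trans ?_
      have := hq0 x
      gcongr
    have h4 : C * ε * q x ≤ 1 / 2 * q x := mul_le_mul_of_nonneg_right hdk.le (hq0 x)
    nlinarith
  have hfin : ∀ x ∈ Ioo a d, ‖u x‖ ≤ 2 * K * G x := by
    intro x hx
    refine (hub x hx).trans ?_
    have := hG0 x
    gcongr
    have h1 : C * q x ≤ C * (2 * K * ε) := by gcongr; exact hqb x hx
    have h2 : (C * ε) * (2 * K) ≤ 1 / 2 * (2 * K) :=
      mul_le_mul_of_nonneg_right hdk.le (by positivity)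
    linarith
  intro c hc
  have hA : IntegrableOn (fun t => ‖u t‖ ^ 2 * (ρf t).re) (Ioo a d) ω := by
    refine Integrable.mono' ((hkint d hd).const_mul ((2 * K) ^ 2)) ?_ ?_
    · exact (((hmeas hu).norm.pow 2).mul
        (Complex.continuous_re.comp_aestronglyMeasurable hρm)).mono_measure
        (Measure.restrict_mono (Ioo_subset_Ioo_right hd.2.le) le_rfl)
    · filter_upwards [ae_restrict_mem measurableSet_Ioo] with t ht
      have h3 := hρ0 t
      rw [Real.norm_of_nonneg (by positivity)]
      calc ‖u t‖ ^ 2 * (ρf t).re ≤ (2 * K * G t) ^ 2 * (ρf t).re := by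
            gcongr; exact hfin t ht
        _ = _ := by simp only [hk]; ring
  have hB : IntegrableOn (fun t => ‖u t‖ ^ 2 * (ρf t).re) (Ico d c) ω := by
    refine (hint hu hu d hd c hc).norm.congr (Eventually.of_forall fun t => ?_)
    simp only [norm_mul, hρn]
    ring
  refine (hA.union hB).mono_set ?_
  intro t ht
  rcases lt_or_ge t d with h' | h'
  · exact Or.inl ⟨ht.1, h'⟩
  · exact Or.inr ⟨h', ht.2⟩

end Helpers

/-- Weyl's alternative (key lemma): if for some `z₀` all solutions of `(τ-z₀)u = 0`
lie in `L²((a,b);ϱ)` near `a`, then this holds for every `z ∈ ℂ`. -/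
theorem stmt12 (a b : ℝ) (hab : a < b) (ω : Measure ℝ) (σf χf ρf : ℝ → ℂ)
    (hσ : LocInt a b ω σf) (hχ : LocInt a b ω χf) (hρ : LocInt a b ω ρf)
    (hreal : RealCoeffs σf χf ρf)
    (hsupp : SuppFull a b ω σf)
    (hatoms : NoCommonAtoms a b ω σf χf ρf)
    (hgapcond : GapCondition a b ω σf χf ρf)
    (htwo : SuppRhoTwoPoints a b ω ρf)
    (h : ∃ z₀ : ℂ, ∀ u v : ℝ → ℂ,
      InDom a b ω σf χf ρf u v (fun t => z₀ * u t) → L2NearA a b ω ρf u) :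
    ∀ z : ℂ, ∀ u v : ℝ → ℂ,
      InDom a b ω σf χf ρf u v (fun t => z * u t) → L2NearA a b ω ρf u := by
  obtain ⟨z₀, h⟩ := h
  exact fun z u v hu => stmt12_aux a b hab ω σf χf ρf hσ hχ hρ hreal hatoms z₀ h z u v hu
end
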